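/- Let S be a set of integral binary cubic forms defined by congruence conditions modulo bounded powers of primes: that is, there is a bound J and, for each prime p, an integer j_p ≤ J and a subset Σ_p of binary cubic forms over ℤ/p^{j_p}ℤ that is invariant under the action of GL₂(ℤ/p^{j_p}ℤ), such that S consists exactly of the integral binary cubic forms whose reduction modulo p^{j_p} lies in Σ_p for every prime p; assume further that for all sufficiently large primes p, every binary cubic form over ℤ/p^{j_p}ℤ excluded from Σ_p has discriminant divisible by p². Let h(S;D) denote the number of GL₂(ℤ)-equivalence classes of integral binary cubic forms that are irreducible over ℚ, have splitting field with Galois group S₃, lie in S, and have discriminant D. Let μ_p(S) = |Σ_p|/p^{4j_p} be the p-adic density of S. Then, as X → ∞: (a) ∑_{−X<D<0} h(S;D) ∼ (π²/24)·X·∏_p μ_p(S), and (b) ∑_{0<D<X} h(S;D) ∼ (π²/72)·X·∏_p μ_p(S). -/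

import Mathlib

open Finset

/-- Evaluation of the binary form of degree `n` with coefficient vector `c` at `(x, y)`:
`c 0 * x^n + c 1 * x^(n-1) * y + ⋯ + c n * y^n`. -/
def binEval {n : ℕ} {R : Type*} [CommRing R] (c : Fin (n + 1) → R) (x y : R) : R :=
  ∑ i : Fin (n + 1), c i * x ^ (n - (i : ℕ)) * y ^ (i : ℕ)

/-- The binary form with coefficient vector `c` as an element of `MvPolynomial (Fin 2) R`. -/
noncomputable def formPolyR {n : ℕ} {R : Type*} [CommRing R] (c : Fin (n + 1) → R) :
    MvPolynomial (Fin 2) R :=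
  ∑ i : Fin (n + 1), MvPolynomial.C (c i) * MvPolynomial.X 0 ^ (n - (i : ℕ)) *
    MvPolynomial.X 1 ^ (i : ℕ)

/-- The binary form with integer coefficient vector `c`, base-changed to `R`. -/
noncomputable def formPoly {n : ℕ} (R : Type*) [CommRing R] (c : Fin (n + 1) → ℤ) :
    MvPolynomial (Fin 2) R :=
  formPolyR (fun i => ((c i : R)))

/-- `F(X, 1)` over `R`, for the binary form with integer coefficient vector `c`. -/
noncomputable def formPolyX {n : ℕ} (R : Type*) [CommRing R] (c : Fin (n + 1) → ℤ) :
    Polynomial R :=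
  ∑ i : Fin (n + 1), Polynomial.C ((c i : R)) * Polynomial.X ^ (n - (i : ℕ))

/-- `IsDisc c D`: the binary form with coefficient vector `c` factors over `ℂ` as
`∏ (αᵢ x - βᵢ y)` and `D = ∏_{i<j} (αᵢ βⱼ - αⱼ βᵢ)²` is its discriminant. -/
def IsDisc {n : ℕ} (c : Fin (n + 1) → ℤ) (D : ℤ) : Prop :=
  ∃ α β : Fin n → ℂ,
    (∀ x y : ℂ, binEval (fun i => ((c i : ℂ))) x y = ∏ i : Fin n, (α i * x - β i * y)) ∧
    (D : ℂ) = ∏ i : Fin n, ∏ j ∈ Finset.univ.filter (fun j => i < j),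
      (α i * β j - α j * β i) ^ 2

/-- `G` is a maximal form: it is not a proper subform of any integral binary form. -/
def IsMaximalForm {n : ℕ} (G : Fin (n + 1) → ℤ) : Prop :=
  ¬ ∃ (F : Fin (n + 1) → ℤ) (a b c d : ℤ), 1 < |a * d - b * c| ∧
      ∀ x y : ℤ, binEval G x y = binEval F (a * x + b * y) (c * x + d * y)

/-- `GL₂(ℤ)`-equivalence of integral binary forms. -/
def FormEquiv {n : ℕ} (F G : Fin (n + 1) → ℤ) : Prop :=
  ∃ a b c d : ℤ, |a * d - b * c| = 1 ∧
    ∀ x y : ℤ, binEval G x y = binEval F (a * x + b * y) (c * x + d * y)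

/-- The form locally represents `h` everywhere: over `ℝ` and over `ℤ_p` for all primes `p`. -/
def LocallyRep {n : ℕ} (c : Fin (n + 1) → ℤ) (h : ℤ) : Prop :=
  (∃ x y : ℝ, binEval (fun i => ((c i : ℝ))) x y = (h : ℝ)) ∧
  ∀ (p : ℕ) (hp : p.Prime),
    haveI : Fact p.Prime := ⟨hp⟩
    ∃ x y : ℤ_[p], binEval (fun i => ((c i : ℤ_[p]))) x y = (h : ℤ_[p])

/-- The integral binary form is primitive: the gcd of its coefficients is 1. -/
def IsPrimitiveForm {n : ℕ} (c : Fin (n + 1) → ℤ) : Prop :=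
  ∀ d : ℤ, (∀ i, d ∣ c i) → IsUnit d

/-- The form splits completely modulo `p`: modulo `p` it is a product of pairwise
non-proportional linear forms over `ℤ/pℤ`. -/
def SplitsCompletelyMod (p : ℕ) {n : ℕ} (c : Fin (n + 1) → ℤ) : Prop :=
  ∃ L : Fin n → ZMod p × ZMod p,
    (∀ i j, i ≠ j → (L i).1 * (L j).2 ≠ (L j).1 * (L i).2) ∧
    formPoly (ZMod p) c =
      ∏ i : Fin n, (MvPolynomial.C (L i).1 * MvPolynomial.X 0 +
        MvPolynomial.C (L i).2 * MvPolynomial.X 1)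

namespace BinaryCubic

theorem form_ext {R : Type*} {f g : Fin 4 → R} (h0 : f 0 = g 0) (h1 : f 1 = g 1) (h2 : f 2 = g 2)
    (h3 : f 3 = g 3) : f = g := by
  funext i; fin_cases i <;> assumption

section Forms

variable {R : Type*} [CommRing R]

/-- The binary cubic form `F(ax + by, cx + dy)`. -/
def sub (a b c d : R) (f : Fin 4 → R) : Fin 4 → R :=
  ![f 0 * a ^ 3 + f 1 * a ^ 2 * c + f 2 * a * c ^ 2 + f 3 * c ^ 3,
    3 * f 0 * a ^ 2 * b + f 1 * (a ^ 2 * d + 2 * a * b * c) + f 2 * (2 * a * c * d + b * c ^ 2)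
      + 3 * f 3 * c ^ 2 * d,
    3 * f 0 * a * b ^ 2 + f 1 * (2 * a * b * d + b ^ 2 * c) + f 2 * (a * d ^ 2 + 2 * b * c * d)
      + 3 * f 3 * c * d ^ 2,
    f 0 * b ^ 3 + f 1 * b ^ 2 * d + f 2 * b * d ^ 2 + f 3 * d ^ 3]

/-- The discriminant of a binary cubic form. -/
def cdisc (f : Fin 4 → R) : R :=
  f 1 ^ 2 * f 2 ^ 2 - 4 * f 0 * f 2 ^ 3 - 4 * f 1 ^ 3 * f 3 - 27 * f 0 ^ 2 * f 3 ^ 2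
    + 18 * f 0 * f 1 * f 2 * f 3

/-- The leading coefficient of the Hessian. -/
def hesP (f : Fin 4 → R) : R := f 1 ^ 2 - 3 * f 0 * f 2

/-- The middle coefficient of the Hessian. -/
def hesQ (f : Fin 4 → R) : R := f 1 * f 2 - 9 * f 0 * f 3

/-- The last coefficient of the Hessian. -/
def hesR (f : Fin 4 → R) : R := f 2 ^ 2 - 3 * f 1 * f 3

theorem binEval_three (f : Fin 4 → R) (x y : R) :
    binEval (n := 3) f x y =
      f 0 * x ^ 3 + f 1 * x ^ 2 * y + f 2 * x * y ^ 2 + f 3 * y ^ 3 := by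
  simp [binEval, Fin.sum_univ_succ, Fin.succ]
  ring

@[simp] theorem sub_zero_apply (a b c d : R) (f : Fin 4 → R) : sub a b c d f 0 =
    f 0 * a ^ 3 + f 1 * a ^ 2 * c + f 2 * a * c ^ 2 + f 3 * c ^ 3 := rfl

@[simp] theorem sub_one_apply (a b c d : R) (f : Fin 4 → R) : sub a b c d f 1 =
    3 * f 0 * a ^ 2 * b + f 1 * (a ^ 2 * d + 2 * a * b * c) + f 2 * (2 * a * c * d + b * c ^ 2)
      + 3 * f 3 * c ^ 2 * d := rfl

@[simp] theorem sub_two_apply (a b c d : R) (f : Fin 4 → R) : sub a b c d f 2 =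
    3 * f 0 * a * b ^ 2 + f 1 * (2 * a * b * d + b ^ 2 * c) + f 2 * (a * d ^ 2 + 2 * b * c * d)
      + 3 * f 3 * c * d ^ 2 := rfl

@[simp] theorem sub_three_apply (a b c d : R) (f : Fin 4 → R) : sub a b c d f 3 =
    f 0 * b ^ 3 + f 1 * b ^ 2 * d + f 2 * b * d ^ 2 + f 3 * d ^ 3 := rfl

theorem binEval_sub (a b c d : R) (f : Fin 4 → R) (x y : R) :
    binEval (n := 3) (sub a b c d f) x y = binEval (n := 3) f (a * x + b * y) (c * x + d * y) := by
  simp only [binEval_three, sub_zero_apply, sub_one_apply, sub_two_apply, sub_three_apply]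
  ring

theorem cdisc_sub (a b c d : R) (f : Fin 4 → R) :
    cdisc (sub a b c d f) = (a * d - b * c) ^ 6 * cdisc f := by
  simp only [cdisc, sub_zero_apply, sub_one_apply, sub_two_apply, sub_three_apply]
  ring

theorem hesP_sub (a b c d : R) (f : Fin 4 → R) : hesP (sub a b c d f) =
    (a * d - b * c) ^ 2 * (hesP f * a ^ 2 + hesQ f * a * c + hesR f * c ^ 2) := by
  simp only [hesP, hesQ, hesR, sub_zero_apply, sub_one_apply, sub_two_apply]
  ring

theorem hesQ_sub (a b c d : R) (f : Fin 4 → R) : hesQ (sub a b c d f) =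
    (a * d - b * c) ^ 2 *
      (2 * hesP f * a * b + hesQ f * (a * d + b * c) + 2 * hesR f * c * d) := by
  simp only [hesP, hesQ, hesR, sub_zero_apply, sub_one_apply, sub_two_apply, sub_three_apply]
  ring

theorem hesR_sub (a b c d : R) (f : Fin 4 → R) : hesR (sub a b c d f) =
    (a * d - b * c) ^ 2 * (hesP f * b ^ 2 + hesQ f * b * d + hesR f * d ^ 2) := by
  simp only [hesP, hesQ, hesR, sub_one_apply, sub_two_apply, sub_three_apply]
  ring

theorem hes_disc (f : Fin 4 → R) : 4 * hesP f * hesR f - hesQ f ^ 2 = 3 * cdisc f := by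
  simp only [hesP, hesQ, hesR, cdisc]; ring

theorem sub_sub (a b c d a' b' c' d' : R) (f : Fin 4 → R) :
    sub a' b' c' d' (sub a b c d f) =
      sub (a * a' + b * c') (a * b' + b * d') (c * a' + d * c') (c * b' + d * d') f := by
  apply form_ext <;>
  · simp only [sub_zero_apply, sub_one_apply, sub_two_apply, sub_three_apply]
    ring

theorem sub_id (f : Fin 4 → R) : sub 1 0 0 1 f = f := by
  apply form_ext <;> simp

theorem sub_map {S : Type*} [CommRing S] (φ : R →+* S) (a b c d : R) (f : Fin 4 → R) :
    (fun i => φ (sub a b c d f i)) = sub (φ a) (φ b) (φ c) (φ d) (fun i => φ (f i)) := by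
  apply form_ext <;> simp [map_ofNat φ]

theorem cdisc_map {S : Type*} [CommRing S] (φ : R →+* S) (f : Fin 4 → R) :
    cdisc (fun i => φ (f i)) = φ (cdisc f) := by
  simp [cdisc, map_ofNat φ]

end Forms

theorem eq_of_binEval_eq {K : Type*} [CommRing K] [IsDomain K] [CharZero K] {f g : Fin 4 → K}
    (h : ∀ x y : ℤ, binEval (n := 3) f (x : K) (y : K) = binEval (n := 3) g (x : K) (y : K)) :
    f = g := by
  have h1 := h 1 0
  have h2 := h 0 1
  have h3 := h 1 1
  have h4 := h 1 (-1)
  simp only [binEval_three] at h1 h2 h3 h4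
  push_cast at h1 h2 h3 h4
  have e2 : (2 : K) ≠ 0 := two_ne_zero
  apply form_ext
  · linear_combination h1
  · apply mul_left_cancel₀ e2; linear_combination h3 - h4 - 2 * h2
  · apply mul_left_cancel₀ e2; linear_combination h3 + h4 - 2 * h1
  · linear_combination h2

theorem formEquiv_iff {f g : Fin 4 → ℤ} : FormEquiv (n := 3) f g ↔
    ∃ a b c d : ℤ, |a * d - b * c| = 1 ∧ g = sub a b c d f := by
  unfold FormEquiv
  refine exists_congr fun a => exists_congr fun b => exists_congr fun c => exists_congr fun d =>
    and_congr_right fun _ => ⟨fun h => ?_, fun h x y => ?_⟩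
  · apply eq_of_binEval_eq
    intro x y
    rw [binEval_sub]
    simpa using h x y
  · rw [h, binEval_sub]

theorem formEquiv_refl (f : Fin 4 → ℤ) : FormEquiv (n := 3) f f :=
  formEquiv_iff.2 ⟨1, 0, 0, 1, by simp, (sub_id f).symm⟩

theorem formEquiv_symm {f g : Fin 4 → ℤ} (h : FormEquiv (n := 3) f g) :
    FormEquiv (n := 3) g f := by
  obtain ⟨a, b, c, d, hd, rfl⟩ := formEquiv_iff.1 h
  rcases (abs_eq zero_le_one).1 hd with hd | hd
  · refine formEquiv_iff.2 ⟨d, -b, -c, a, ?_, ?_⟩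
    · rw [show d * a - -b * -c = a * d - b * c by ring, hd]; simp
    · rw [sub_sub]
      conv_lhs => rw [← sub_id f]
      congr 1 <;> first | ring1 | linear_combination hd | linear_combination -hd
  · refine formEquiv_iff.2 ⟨-d, b, c, -a, ?_, ?_⟩
    · rw [show -d * -a - b * c = a * d - b * c by ring, hd]; simp
    · rw [sub_sub]
      conv_lhs => rw [← sub_id f]
      congr 1 <;> first | ring1 | linear_combination hd | linear_combination -hd

theorem formEquiv_trans {f g k : Fin 4 → ℤ} (h : FormEquiv (n := 3) f g)
    (h' : FormEquiv (n := 3) g k) : FormEquiv (n := 3) f k := by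
  obtain ⟨a, b, c, d, hd, rfl⟩ := formEquiv_iff.1 h
  obtain ⟨a', b', c', d', hd', rfl⟩ := formEquiv_iff.1 h'
  refine formEquiv_iff.2 ⟨_, _, _, _, ?_, sub_sub _ _ _ _ _ _ _ _ _⟩
  rw [show (a * a' + b * c') * (c * b' + d * d') - (a * b' + b * d') * (c * a' + d * c') =
    (a * d - b * c) * (a' * d' - b' * c') by ring, abs_mul, hd, hd', one_mul]

theorem formEquiv_equivalence : Equivalence (@FormEquiv 3) :=
  ⟨formEquiv_refl, formEquiv_symm, formEquiv_trans⟩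

theorem quot_eq_iff {f g : Fin 4 → ℤ} :
    Quot.mk (@FormEquiv 3) f = Quot.mk (@FormEquiv 3) g ↔ FormEquiv (n := 3) f g :=
  ⟨fun h => formEquiv_equivalence.eqvGen_iff.1 (Quot.eqvGen_exact h), fun h => Quot.sound h⟩

theorem cdisc_eq_of_equiv {f g : Fin 4 → ℤ} (h : FormEquiv (n := 3) f g) : cdisc g = cdisc f := by
  obtain ⟨a, b, c, d, hd, rfl⟩ := formEquiv_iff.1 h
  rw [cdisc_sub]
  have : (a * d - b * c) ^ 6 = 1 := by
    rw [show (a * d - b * c) ^ 6 = ((a * d - b * c) ^ 2) ^ 3 by ring, ← sq_abs, hd]; simp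
  rw [this, one_mul]

theorem exists_root_factor (f : Fin 4 → ℂ) : ∃ α β : Fin 3 → ℂ,
    ∀ x y : ℂ, binEval (n := 3) f x y = ∏ i : Fin 3, (α i * x - β i * y) := by
  have lin : ∀ p q r : ℂ, ∃ a b c d : ℂ, ∀ x y : ℂ,
      p * x ^ 2 + q * x * y + r * y ^ 2 = (a * x - b * y) * (c * x - d * y) := by
    intro p q r
    by_cases hp : p = 0
    · exact ⟨0, -1, q, -r, fun x y => by rw [hp]; ring⟩
    · obtain ⟨s, hs⟩ := IsAlgClosed.exists_eq_mul_self (q ^ 2 - 4 * p * r)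
      refine ⟨p, (-q + s) / 2, 1, (-q - s) / (2 * p), fun x y => ?_⟩
      field_simp
      linear_combination (-y ^ 2) * hs
  have key : ∃ u v p q r : ℂ, ∀ x y : ℂ, binEval (n := 3) f x y =
      (u * x - v * y) * (p * x ^ 2 + q * x * y + r * y ^ 2) := by
    by_cases h0 : f 0 = 0
    · exact ⟨0, -1, f 1, f 2, f 3, fun x y => by rw [binEval_three, h0]; ring⟩
    · have hdeg : (Polynomial.C (f 0) * Polynomial.X ^ 3 + Polynomial.C (f 1) * Polynomial.X ^ 2
          + Polynomial.C (f 2) * Polynomial.X + Polynomial.C (f 3)).degree ≠ 0 := by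
        rw [Polynomial.degree_cubic h0]; norm_num
      obtain ⟨z, hz⟩ := IsAlgClosed.exists_root _ hdeg
      simp only [Polynomial.IsRoot.def, Polynomial.eval_add, Polynomial.eval_mul,
        Polynomial.eval_C, Polynomial.eval_pow, Polynomial.eval_X] at hz
      refine ⟨1, z, f 0, f 1 + f 0 * z, f 2 + f 1 * z + f 0 * z ^ 2, fun x y => ?_⟩
      rw [binEval_three]
      linear_combination y ^ 3 * hz
  obtain ⟨u, v, p, q, r, h⟩ := key
  obtain ⟨a, b, c, d, h'⟩ := lin p q r
  refine ⟨![u, a, c], ![v, b, d], fun x y => ?_⟩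
  rw [h, h', Fin.prod_univ_three]
  simp [mul_assoc]

theorem prod_disc_three (α β : Fin 3 → ℂ) :
    ∏ i : Fin 3, ∏ j ∈ Finset.univ.filter (fun j => i < j), (α i * β j - α j * β i) ^ 2 =
      (α 0 * β 1 - α 1 * β 0) ^ 2 * (α 0 * β 2 - α 2 * β 0) ^ 2 *
        (α 1 * β 2 - α 2 * β 1) ^ 2 := by
  have e0 : Finset.univ.filter (fun j : Fin 3 => 0 < j) = {1, 2} := by decide
  have e1 : Finset.univ.filter (fun j : Fin 3 => 1 < j) = {2} := by decide
  have e2 : Finset.univ.filter (fun j : Fin 3 => 2 < j) = ∅ := by decide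
  rw [Fin.prod_univ_three, e0, e1, e2]
  simp

theorem cdisc_of_factor {f : Fin 4 → ℂ} {α β : Fin 3 → ℂ}
    (h : ∀ x y : ℂ, binEval (n := 3) f x y = ∏ i : Fin 3, (α i * x - β i * y)) :
    cdisc f = ∏ i : Fin 3, ∏ j ∈ Finset.univ.filter (fun j => i < j),
      (α i * β j - α j * β i) ^ 2 := by
  have : f = ![α 0 * α 1 * α 2, -(α 0 * α 1 * β 2 + α 0 * β 1 * α 2 + β 0 * α 1 * α 2),
      α 0 * β 1 * β 2 + β 0 * α 1 * β 2 + β 0 * β 1 * α 2, -(β 0 * β 1 * β 2)] := by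
    apply eq_of_binEval_eq
    intro x y
    rw [h, Fin.prod_univ_three, binEval_three]
    simp
    ring
  rw [prod_disc_three, this]
  simp [cdisc]
  ring

theorem isDisc_iff {f : Fin 4 → ℤ} {D : ℤ} : IsDisc (n := 3) f D ↔ D = cdisc f := by
  have hm : cdisc (fun i => ((f i : ℂ))) = ((cdisc f : ℤ) : ℂ) :=
    cdisc_map (Int.castRingHom ℂ) f
  constructor
  · rintro ⟨α, β, h, hD⟩
    rw [← cdisc_of_factor h, hm] at hD
    exact_mod_cast hD
  · rintro rfl
    obtain ⟨α, β, h⟩ := exists_root_factor (fun i => ((f i : ℂ)))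
    exact ⟨α, β, h, by rw [← cdisc_of_factor h, hm]⟩

theorem formPolyR_three {R : Type*} [CommRing R] (f : Fin 4 → R) :
    formPolyR (n := 3) f = MvPolynomial.C (f 0) * MvPolynomial.X 0 ^ 3 +
      MvPolynomial.C (f 1) * MvPolynomial.X 0 ^ 2 * MvPolynomial.X 1 +
      MvPolynomial.C (f 2) * MvPolynomial.X 0 * MvPolynomial.X 1 ^ 2 +
      MvPolynomial.C (f 3) * MvPolynomial.X 1 ^ 3 := by
  simp [formPolyR, Fin.sum_univ_succ, Fin.succ]
  ring

theorem formPolyR_sub {R : Type*} [CommRing R] (a b c d : R) (f : Fin 4 → R) :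
    formPolyR (n := 3) (sub a b c d f) = MvPolynomial.bind₁
      ![MvPolynomial.C a * MvPolynomial.X 0 + MvPolynomial.C b * MvPolynomial.X 1,
        MvPolynomial.C c * MvPolynomial.X 0 + MvPolynomial.C d * MvPolynomial.X 1]
      (formPolyR (n := 3) f) := by
  simp only [formPolyR_three, map_add, map_mul, map_pow, MvPolynomial.bind₁_X_right,
    MvPolynomial.algHom_C, MvPolynomial.algebraMap_eq, Matrix.cons_val_zero, Matrix.cons_val_one,
    sub_zero_apply, sub_one_apply, sub_two_apply, sub_three_apply, map_ofNat]
  ring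

/-- The integral cubic form `f` has no nontrivial rational zero. -/
def Irr (f : Fin 4 → ℤ) : Prop := ∀ x y : ℤ, binEval (n := 3) f x y = 0 → x = 0 ∧ y = 0

theorem Irr.apply_zero_ne {f : Fin 4 → ℤ} (hf : Irr f) : f 0 ≠ 0 := by
  intro h
  have := hf 1 0 (by rw [binEval_three, h]; ring)
  simp at this

theorem Irr.rat {f : Fin 4 → ℤ} (hf : Irr f) {x y : ℚ}
    (h : (f 0 : ℚ) * x ^ 3 + f 1 * x ^ 2 * y + f 2 * x * y ^ 2 + f 3 * y ^ 3 = 0) :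
    x = 0 ∧ y = 0 := by
  have hx : (x.num : ℚ) = x * x.den := (Rat.mul_den_eq_num x).symm
  have hy : (y.num : ℚ) = y * y.den := (Rat.mul_den_eq_num y).symm
  have := hf (x.num * y.den) (y.num * x.den) (by
    rw [binEval_three]
    have : (((f 0 * (x.num * y.den) ^ 3 + f 1 * (x.num * y.den) ^ 2 * (y.num * x.den) +
      f 2 * (x.num * y.den) * (y.num * x.den) ^ 2 + f 3 * (y.num * x.den) ^ 3 : ℤ)) : ℚ) = 0 := by
      push_cast
      rw [hx, hy]
      linear_combination ((x.den : ℚ) * y.den) ^ 3 * h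
    exact_mod_cast this)
  simpa using this

theorem Irr.of_equiv {f g : Fin 4 → ℤ} (h : FormEquiv (n := 3) f g) (hf : Irr f) : Irr g := by
  obtain ⟨a, b, c, d, hd, rfl⟩ := formEquiv_iff.1 h
  intro x y hxy
  rw [binEval_sub] at hxy
  obtain ⟨h1, h2⟩ := hf _ _ hxy
  have hne : a * d - b * c ≠ 0 := by
    intro h; rw [h] at hd; simp at hd
  constructor
  · apply (mul_eq_zero.1 (show (a * d - b * c) * x = 0 by linear_combination d * h1 - b * h2)
      ).resolve_left hne
  · apply (mul_eq_zero.1 (show (a * d - b * c) * y = 0 by linear_combination a * h2 - c * h1)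
      ).resolve_left hne

theorem irr_of_irreducible {f : Fin 4 → ℤ} (h : Irreducible (formPoly (n := 3) ℚ f)) : Irr f := by
  intro x y hxy
  by_contra hne
  rw [binEval_three] at hxy
  have hq : (f 0 : ℚ) * x ^ 3 + f 1 * x ^ 2 * y + f 2 * x * y ^ 2 + f 3 * y ^ 3 = 0 := by
    exact_mod_cast hxy
  have key : ∀ ℓ G : MvPolynomial (Fin 2) ℚ, formPoly (n := 3) ℚ f = ℓ * G →
      (∃ v, MvPolynomial.eval v ℓ = 0) → (∃ v, MvPolynomial.eval v G = 0) → False := by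
    rintro ℓ G hE ⟨v, hv⟩ ⟨w, hw⟩
    rcases h.isUnit_or_isUnit hE with hu | hu
    · have := hu.map (MvPolynomial.eval v)
      rw [hv] at this
      exact not_isUnit_zero this
    · have := hu.map (MvPolynomial.eval w)
      rw [hw] at this
      exact not_isUnit_zero this
  by_cases hy : y = 0
  · have hx : (x : ℚ) ≠ 0 := by
      intro hx; exact hne ⟨by exact_mod_cast hx, hy⟩
    have h0 : (f 0 : ℚ) = 0 := by
      rw [hy] at hq
      simpa [hx] using hq
    refine key (MvPolynomial.X 1) (MvPolynomial.C (f 1 : ℚ) * MvPolynomial.X 0 ^ 2 +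
      MvPolynomial.C (f 2 : ℚ) * MvPolynomial.X 0 * MvPolynomial.X 1 +
      MvPolynomial.C (f 3 : ℚ) * MvPolynomial.X 1 ^ 2) ?_ ⟨0, by simp⟩ ⟨0, by simp⟩
    rw [formPoly, formPolyR_three, h0, map_zero]
    ring
  · have hy' : (y : ℚ) ≠ 0 := by exact_mod_cast hy
    obtain ⟨r, hr⟩ : ∃ r : ℚ, r * y = x := ⟨x / y, by field_simp⟩
    have hroot : (f 0 : ℚ) * r ^ 3 + f 1 * r ^ 2 + f 2 * r + f 3 = 0 := by
      apply (mul_eq_zero.1 (show (y : ℚ) ^ 3 * _ = 0 from ?_)).resolve_left (pow_ne_zero 3 hy')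
      rw [← hr] at hq
      linear_combination hq
    refine key (MvPolynomial.X 0 - MvPolynomial.C r * MvPolynomial.X 1)
      (MvPolynomial.C (f 0 : ℚ) * MvPolynomial.X 0 ^ 2 +
      MvPolynomial.C (f 1 + f 0 * r : ℚ) * MvPolynomial.X 0 * MvPolynomial.X 1 +
      MvPolynomial.C (f 2 + f 1 * r + f 0 * r ^ 2 : ℚ) * MvPolynomial.X 1 ^ 2) ?_
      ⟨0, by simp⟩ ⟨0, by simp⟩
    have hc := congrArg (MvPolynomial.C (σ := Fin 2)) hroot
    rw [formPoly, formPolyR_three]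
    simp only [map_add, map_mul, map_pow, map_zero] at hc ⊢
    linear_combination MvPolynomial.X 1 ^ 3 * hc

theorem eq_linear_of_totalDegree_le {g : MvPolynomial (Fin 2) ℚ} (hg : g.totalDegree ≤ 1) :
    ∃ α β γ : ℚ, g = MvPolynomial.C α * MvPolynomial.X 0 + MvPolynomial.C β * MvPolynomial.X 1 +
      MvPolynomial.C γ := by
  classical
  refine ⟨g.coeff (Finsupp.single 0 1), g.coeff (Finsupp.single 1 1), g.coeff 0, ?_⟩
  ext m
  simp only [MvPolynomial.coeff_add, MvPolynomial.coeff_C_mul, MvPolynomial.coeff_X,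
    MvPolynomial.coeff_C]
  have hne : (Finsupp.single (0 : Fin 2) 1 : Fin 2 →₀ ℕ) ≠ Finsupp.single 1 1 := by
    intro h; have := DFunLike.congr_fun h 0; simp at this
  have hz : ∀ i : Fin 2, (0 : Fin 2 →₀ ℕ) ≠ Finsupp.single i 1 := fun i =>
    (Finsupp.single_ne_zero.2 one_ne_zero).symm
  by_cases h0 : Finsupp.single (0 : Fin 2) 1 = m
  · subst h0; simp [hne.symm, hz]
  by_cases h1 : Finsupp.single (1 : Fin 2) 1 = m
  · subst h1; simp [hne, hz]
  by_cases h2 : 0 = m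
  · subst h2; simp
  simp only [h0, h1, h2, if_false, mul_zero, add_zero]
  apply MvPolynomial.coeff_eq_zero_of_totalDegree_lt
  refine lt_of_le_of_lt hg ?_
  have hsum : ∑ i ∈ m.support, m i = m 0 + m 1 := by
    rw [Finset.sum_subset (Finset.subset_univ _), Fin.sum_univ_two]
    intro i _ hi
    simpa using hi
  rw [hsum]
  by_contra hlt
  have hle : m 0 + m 1 ≤ 1 := by omega
  rcases Nat.eq_zero_or_pos (m 0) with e0 | e0
  · rcases Nat.eq_zero_or_pos (m 1) with e1 | e1
    · exact h2 (by ext i; fin_cases i <;> simp [e0, e1])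
    · exact h1 (by
        ext i; fin_cases i
        · simp [e0]
        · simp; omega)
  · exact h0 (by
      ext i; fin_cases i
      · simp; omega
      · simp; omega)

theorem totalDegree_formPoly_le (f : Fin 4 → ℤ) : (formPoly (n := 3) ℚ f).totalDegree ≤ 3 := by
  rw [formPoly, formPolyR]
  refine MvPolynomial.totalDegree_finsetSum_le fun i _ => ?_
  refine (MvPolynomial.totalDegree_mul _ _).trans ?_
  have a1 := MvPolynomial.totalDegree_mul (MvPolynomial.C ((f i : ℚ)) : MvPolynomial (Fin 2) ℚ)
    (MvPolynomial.X 0 ^ (3 - (i : ℕ)))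
  have a2 := MvPolynomial.totalDegree_X_pow (R := ℚ) (0 : Fin 2) (3 - (i : ℕ))
  have a3 := MvPolynomial.totalDegree_X_pow (R := ℚ) (1 : Fin 2) (i : ℕ)
  have a4 := MvPolynomial.totalDegree_C (σ := Fin 2) ((f i : ℚ))
  have := i.isLt
  omega

theorem Irr.no_linear_factor {f : Fin 4 → ℤ} (hf : Irr f) {g k : MvPolynomial (Fin 2) ℚ}
    (h : formPoly (n := 3) ℚ f = g * k) (hg : g.totalDegree ≤ 1) : IsUnit g ∨ IsUnit k := by
  obtain ⟨α, β, γ, rfl⟩ := eq_linear_of_totalDegree_le hg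
  by_cases h0 : α = 0 ∧ β = 0
  · left
    obtain ⟨rfl, rfl⟩ := h0
    simp only [map_zero, zero_mul, zero_add] at h ⊢
    have hγ : γ ≠ 0 := by
      rintro rfl
      have := congrArg (MvPolynomial.eval ![1, 0]) h
      rw [formPoly, formPolyR_three] at this
      simp at this
      exact hf.apply_zero_ne this
    exact (isUnit_iff_ne_zero.2 hγ).map MvPolynomial.C
  exfalso
  have hF : (f 0 : ℚ) * β ^ 3 + f 1 * β ^ 2 * (-α) + f 2 * β * (-α) ^ 2 + f 3 * (-α) ^ 3 ≠ 0 := by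
    intro hz
    obtain ⟨h1, h2⟩ := hf.rat hz
    exact h0 ⟨by simpa using h2, h1⟩
  set e := (f 0 : ℚ) * β ^ 3 + f 1 * β ^ 2 * (-α) + f 2 * β * (-α) ^ 2 + f 3 * (-α) ^ 3 with he
  let φ : MvPolynomial (Fin 2) ℚ →ₐ[ℚ] Polynomial ℚ :=
    MvPolynomial.aeval ![Polynomial.C β * Polynomial.X, Polynomial.C (-α) * Polynomial.X]
  have h1 : φ (formPoly (n := 3) ℚ f) = Polynomial.C e * Polynomial.X ^ 3 := by
    rw [formPoly, formPolyR_three]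
    simp [φ, he]
    ring
  have h2 : φ (MvPolynomial.C α * MvPolynomial.X 0 + MvPolynomial.C β * MvPolynomial.X 1 +
      MvPolynomial.C γ) = Polynomial.C γ := by
    simp [φ]
    ring
  have hlin : (MvPolynomial.C α * MvPolynomial.X 0 + MvPolynomial.C β * MvPolynomial.X 1 +
      MvPolynomial.C γ : MvPolynomial (Fin 2) ℚ) ≠ 0 := by
    intro hz
    rw [hz, map_zero] at h2
    rw [h, hz, zero_mul, map_zero] at h1
    have := congrArg (fun p => Polynomial.coeff p 3) h1
    simp at this
    exact hF this.symm
  have hk0 : k ≠ 0 := by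
    rintro rfl
    rw [h, mul_zero, map_zero] at h1
    have := congrArg (fun p => Polynomial.coeff p 3) h1
    simp at this
    exact hF this.symm
  have hdl : 1 ≤ (MvPolynomial.C α * MvPolynomial.X 0 + MvPolynomial.C β * MvPolynomial.X 1 +
      MvPolynomial.C γ : MvPolynomial (Fin 2) ℚ).totalDegree := by
    rw [Nat.one_le_iff_ne_zero]
    intro hd
    rw [MvPolynomial.totalDegree_eq_zero_iff_eq_C] at hd
    have e1 := congrArg (MvPolynomial.eval ![1, 0]) hd
    have e2 := congrArg (MvPolynomial.eval ![0, 1]) hd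
    have e3 := congrArg (MvPolynomial.eval ![0, 0]) hd
    simp at e1 e2 e3
    exact h0 ⟨e1, e2⟩
  have hdF := totalDegree_formPoly_le f
  have hdk : k.totalDegree ≤ 2 := by
    rw [h, MvPolynomial.totalDegree_mul_of_isDomain hlin hk0] at hdF
    omega
  have hnk : (φ k).natDegree ≤ 2 := by
    have := MvPolynomial.aeval_natDegree_le (m := k.totalDegree) (n := 1) k le_rfl
      ![Polynomial.C β * Polynomial.X, Polynomial.C (-α) * Polynomial.X] (by
        intro i
        fin_cases i
        · exact (Polynomial.natDegree_C_mul_le _ _).trans Polynomial.natDegree_X_le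
        · exact (Polynomial.natDegree_C_mul_le _ _).trans Polynomial.natDegree_X_le)
    simp only [mul_one] at this
    exact this.trans hdk
  rw [h, map_mul, h2] at h1
  have := congrArg (fun p => Polynomial.coeff p 3) h1
  simp [Polynomial.coeff_eq_zero_of_natDegree_lt (show (φ k).natDegree < 3 by omega)] at this
  exact hF this.symm

theorem Irr.irreducible {f : Fin 4 → ℤ} (hf : Irr f) : Irreducible (formPoly (n := 3) ℚ f) := by
  constructor
  · intro hu
    have := hu.map (MvPolynomial.eval 0)
    rw [formPoly, formPolyR_three] at this
    simp at this
  · intro g k h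
    by_cases hg : g.totalDegree ≤ 1
    · exact hf.no_linear_factor h hg
    by_cases hk : k.totalDegree ≤ 1
    · exact (hf.no_linear_factor (by rw [h, mul_comm]) hk).symm
    exfalso
    have hF : formPoly (n := 3) ℚ f ≠ 0 := by
      intro hz
      have := congrArg (MvPolynomial.eval ![1, 0]) hz
      rw [formPoly, formPolyR_three] at this
      simp at this
      exact hf.apply_zero_ne this
    have hg0 : g ≠ 0 := by rintro rfl; simp [hF] at h
    have hk0 : k ≠ 0 := by rintro rfl; simp [hF] at h
    have hdF := totalDegree_formPoly_le f
    rw [h, MvPolynomial.totalDegree_mul_of_isDomain hg0 hk0] at hdF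
    omega

theorem formPolyX_three (f : Fin 4 → ℤ) : formPolyX (n := 3) ℚ f =
    Polynomial.C (f 0 : ℚ) * Polynomial.X ^ 3 + Polynomial.C (f 1 : ℚ) * Polynomial.X ^ 2 +
      Polynomial.C (f 2 : ℚ) * Polynomial.X + Polynomial.C (f 3 : ℚ) := by
  simp [formPolyX, Fin.sum_univ_succ, Fin.succ]
  ring

theorem Irr.natDegree_formPolyX {f : Fin 4 → ℤ} (hf : Irr f) :
    (formPolyX (n := 3) ℚ f).natDegree = 3 := by
  rw [formPolyX_three]
  exact Polynomial.natDegree_cubic (by exact_mod_cast hf.apply_zero_ne)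

theorem Irr.irreducible_formPolyX {f : Fin 4 → ℤ} (hf : Irr f) :
    Irreducible (formPolyX (n := 3) ℚ f) := by
  have hd := hf.natDegree_formPolyX
  rw [Polynomial.irreducible_iff_roots_eq_zero_of_degree_le_three (by omega) (by omega)]
  refine Multiset.eq_zero_of_forall_notMem fun x hx => ?_
  have h := Polynomial.isRoot_of_mem_roots hx
  rw [formPolyX_three] at h
  simp at h
  have := hf.rat (x := x) (y := 1) (by simpa using h)
  exact one_ne_zero this.2

theorem cdisc_eq_sq_of_roots {K : Type*} [Field K] {f : Fin 4 → K} {r : Fin 3 → K}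
    (hr : Function.Injective r) (h : ∀ i, f 0 * r i ^ 3 + f 1 * r i ^ 2 + f 2 * r i + f 3 = 0) :
    cdisc f = (f 0 ^ 2 * ((r 0 - r 1) * (r 0 - r 2) * (r 1 - r 2))) ^ 2 := by
  have h01 : r 0 - r 1 ≠ 0 := sub_ne_zero.2 (hr.ne (by decide))
  have h02 : r 0 - r 2 ≠ 0 := sub_ne_zero.2 (hr.ne (by decide))
  have h12 : r 1 - r 2 ≠ 0 := sub_ne_zero.2 (hr.ne (by decide))
  have a1 : f 0 * (r 0 ^ 2 + r 0 * r 1 + r 1 ^ 2) + f 1 * (r 0 + r 1) + f 2 = 0 := by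
    apply mul_left_cancel₀ h01; linear_combination h 0 - h 1
  have a2 : f 0 * (r 0 ^ 2 + r 0 * r 2 + r 2 ^ 2) + f 1 * (r 0 + r 2) + f 2 = 0 := by
    apply mul_left_cancel₀ h02; linear_combination h 0 - h 2
  have e1 : f 1 = -f 0 * (r 0 + r 1 + r 2) := by
    apply mul_left_cancel₀ h12; linear_combination a1 - a2
  have e2 : f 2 = f 0 * (r 0 * r 1 + r 0 * r 2 + r 1 * r 2) := by
    rw [e1] at a1; linear_combination a1
  have e3 : f 3 = -f 0 * (r 0 * r 1 * r 2) := by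
    have := h 0
    rw [e1, e2] at this; linear_combination this
  rw [cdisc, e1, e2, e3]; ring

theorem delta_perm {K : Type*} [CommRing K] (r : Fin 3 → K) (π : Equiv.Perm (Fin 3))
    (hπ : Equiv.Perm.sign π = 1) :
    (r (π 0) - r (π 1)) * (r (π 0) - r (π 2)) * (r (π 1) - r (π 2)) =
      (r 0 - r 1) * (r 0 - r 2) * (r 1 - r 2) := by
  have : (π 0 = 0 ∧ π 1 = 1 ∧ π 2 = 2) ∨ (π 0 = 1 ∧ π 1 = 2 ∧ π 2 = 0) ∨
      (π 0 = 2 ∧ π 1 = 0 ∧ π 2 = 1) := by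
    revert π; decide
  rcases this with ⟨h0, h1, h2⟩ | ⟨h0, h1, h2⟩ | ⟨h0, h1, h2⟩ <;> rw [h0, h1, h2] <;> ring

theorem gal_of_not_isSquare {F : Type*} [Field F] [CharZero F] {f : Fin 4 → F} {P : Polynomial F}
    (hirr : Irreducible P) (hsep : P.Separable) (hdeg : P.natDegree = 3)
    (hP3 : P = Polynomial.C (f 0) * Polynomial.X ^ 3 + Polynomial.C (f 1) * Polynomial.X ^ 2 +
      Polynomial.C (f 2) * Polynomial.X + Polynomial.C (f 3)) (hsq : ¬ IsSquare (cdisc f)) :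
    Nonempty (P.Gal ≃* Equiv.Perm (Fin 3)) := by
  have hsplit : (P.map (algebraMap F P.SplittingField)).Splits :=
    Polynomial.SplittingField.splits P
  have hcard : Fintype.card (P.rootSet P.SplittingField) = 3 := by
    rw [Polynomial.card_rootSet_eq_natDegree hsep hsplit, hdeg]
  have e := Fintype.equivFinOfCardEq hcard
  let φ : P.Gal →* Equiv.Perm (Fin 3) := (e.permCongrHom.toMonoidHom).comp
    (@MulAction.toPermHom P.Gal (P.rootSet P.SplittingField) _ (Polynomial.Gal.galActionAux P))
  have hact' : ∀ (σ : P.Gal) (x : P.rootSet P.SplittingField),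
      σ (x : P.SplittingField) = (e.symm (φ σ (e x)) : P.rootSet P.SplittingField) := by
    intro σ x
    simp only [φ, MonoidHom.comp_apply]
    change _ = ((e.symm (e (_ : P.rootSet P.SplittingField)) : P.rootSet P.SplittingField) :
      P.SplittingField)
    rw [e.symm_apply_apply]
    change _ = σ ((e.symm (e x) : P.rootSet P.SplittingField) : P.SplittingField)
    rw [e.symm_apply_apply]
  have hφ : Function.Injective φ := by
    intro σ τ h
    refine Polynomial.Gal.ext P fun x hx => ?_
    rw [hact' σ ⟨x, hx⟩, hact' τ ⟨x, hx⟩, h]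
  have h6 : Nat.card (Equiv.Perm (Fin 3)) = 6 := by
    rw [Nat.card_eq_fintype_card, Fintype.card_perm]; rfl
  have hdvd : Nat.card P.Gal ∣ 6 := h6 ▸ Subgroup.card_dvd_of_injective φ hφ
  have h3 : 3 ∣ Nat.card P.Gal := by
    have := Polynomial.Gal.prime_degree_dvd_card hirr (by rw [hdeg]; exact Nat.prime_three)
    rwa [hdeg] at this
  have hcases : Nat.card P.Gal = 3 ∨ Nat.card P.Gal = 6 := by
    have := Nat.le_of_dvd (by norm_num) hdvd
    interval_cases h : Nat.card P.Gal <;> omega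
  rcases hcases with hc | hc
  · exfalso
    apply hsq
    have hroot : ∀ i, P.aeval ((e.symm i : P.rootSet P.SplittingField) : P.SplittingField) = 0 :=
      fun i => Polynomial.aeval_eq_zero_of_mem_rootSet (e.symm i).2
    set r : Fin 3 → P.SplittingField := fun i => (e.symm i : P.rootSet P.SplittingField) with hrdef
    have hrinj : Function.Injective r := Subtype.val_injective.comp e.symm.injective
    have hact : ∀ (σ : P.Gal) i, σ (r i) = r (φ σ i) := by
      intro σ i
      rw [hrdef, hact' σ (e.symm i), e.apply_symm_apply]
    have hdisc := cdisc_eq_sq_of_roots (f := fun i => algebraMap F P.SplittingField (f i)) hrinj (by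
      intro i
      have h1 := hroot i
      have h2 := congrArg (Polynomial.aeval (r i)) hP3
      rw [h1] at h2
      simpa using h2.symm)
    have hfix : ∀ σ : P.Gal, σ ((r 0 - r 1) * (r 0 - r 2) * (r 1 - r 2)) =
        (r 0 - r 1) * (r 0 - r 2) * (r 1 - r 2) := by
      intro σ
      have hσ : Equiv.Perm.sign (φ σ) = 1 := by
        have h1 : σ ^ 3 = 1 := hc ▸ pow_card_eq_one'
        have h2 : (Equiv.Perm.sign (φ σ)) ^ 3 = 1 := by
          rw [← map_pow, ← map_pow, h1, map_one, map_one]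
        rcases Int.units_eq_one_or (Equiv.Perm.sign (φ σ)) with h | h
        · exact h
        · rw [h] at h2; exact absurd h2 (by decide)
      simp only [map_mul, map_sub, hact]
      exact delta_perm r _ hσ
    have : IsGalois F P.SplittingField := IsGalois.of_separable_splitting_field hsep
    obtain ⟨q, hq⟩ := (IsGalois.mem_range_algebraMap_iff_fixed _).2 hfix
    rw [← hq] at hdisc
    rw [cdisc_map] at hdisc
    refine ⟨f 0 ^ 2 * q, (algebraMap F P.SplittingField).injective ?_⟩
    rw [hdisc, ← sq]; simp
  · refine ⟨MulEquiv.ofBijective φ ?_⟩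
    rw [Nat.bijective_iff_injective_and_card]
    exact ⟨hφ, by rw [hc, h6]⟩

theorem Irr.gal_of_not_isSquare {f : Fin 4 → ℤ} (hf : Irr f) (hsq : ¬ IsSquare (cdisc f)) :
    Nonempty ((formPolyX (n := 3) ℚ f).Gal ≃* Equiv.Perm (Fin 3)) := by
  refine BinaryCubic.gal_of_not_isSquare (f := fun i => (f i : ℚ)) hf.irreducible_formPolyX
    hf.irreducible_formPolyX.separable hf.natDegree_formPolyX (formPolyX_three f) ?_
  have : cdisc (fun i => ((f i : ℤ) : ℚ)) = ((cdisc f : ℤ) : ℚ) :=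
    cdisc_map (Int.castRingHom ℚ) f
  rw [this, Rat.isSquare_intCast_iff]
  exact hsq

/-- Invariance under `GL₂(ℤ/mℤ)`, in the form used by the congruence conditions. -/
theorem mem_of_formEquiv {m : ℕ} {S : Set (Fin 4 → ZMod m)}
    (hinv : ∀ f ∈ S, ∀ a b c d : ZMod m, IsUnit (a * d - b * c) → ∀ g : Fin 4 → ZMod m,
      formPolyR (n := 3) g = MvPolynomial.bind₁
          ![MvPolynomial.C a * MvPolynomial.X 0 + MvPolynomial.C b * MvPolynomial.X 1,
            MvPolynomial.C c * MvPolynomial.X 0 + MvPolynomial.C d * MvPolynomial.X 1]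
          (formPolyR (n := 3) f) → g ∈ S)
    {f g : Fin 4 → ℤ} (h : FormEquiv (n := 3) f g) (hf : (fun i => ((f i : ZMod m))) ∈ S) :
    (fun i => ((g i : ZMod m))) ∈ S := by
  obtain ⟨a, b, c, d, hd, rfl⟩ := formEquiv_iff.1 h
  refine hinv _ hf a b c d ?_ _ ?_
  · have : IsUnit (a * d - b * c) := Int.isUnit_iff_abs_eq.2 hd
    simpa using this.map (Int.castRingHom (ZMod m))
  · rw [← formPolyR_sub]
    exact congrArg _ (sub_map (Int.castRingHom (ZMod m)) a b c d f)

/-- The real cubic forms of discriminant of sign `-s`, parametrized by a point `ξ + iη` of the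
upper half plane and a vector `(p, q)`. -/
def Phi (s p q ξ η : ℝ) : Fin 4 → ℝ :=
  ![p, -3 * p * ξ + (2 - s) * q * η,
    3 * p * ξ ^ 2 - 2 * (2 - s) * q * ξ * η + s * (2 - s) * p * η ^ 2,
    -p * ξ ^ 3 + (2 - s) * q * ξ ^ 2 * η - s * (2 - s) * p * ξ * η ^ 2 + s * q * η ^ 3]

@[simp] theorem Phi_zero (s p q ξ η : ℝ) : Phi s p q ξ η 0 = p := rfl
@[simp] theorem Phi_one (s p q ξ η : ℝ) : Phi s p q ξ η 1 = -3 * p * ξ + (2 - s) * q * η := rfl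
@[simp] theorem Phi_two (s p q ξ η : ℝ) : Phi s p q ξ η 2 =
    3 * p * ξ ^ 2 - 2 * (2 - s) * q * ξ * η + s * (2 - s) * p * η ^ 2 := rfl
@[simp] theorem Phi_three (s p q ξ η : ℝ) : Phi s p q ξ η 3 =
    -p * ξ ^ 3 + (2 - s) * q * ξ ^ 2 * η - s * (2 - s) * p * ξ * η ^ 2 + s * q * η ^ 3 := rfl

theorem cdisc_Phi {s : ℝ} (hs : s = 1 ∨ s = -1) (p q ξ η : ℝ) :
    cdisc (Phi s p q ξ η) = -s * (56 - 52 * s) * (p ^ 2 + q ^ 2) ^ 2 * η ^ 6 := by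
  rcases hs with rfl | rfl <;> simp only [cdisc, Phi_zero, Phi_one, Phi_two, Phi_three] <;> ring

theorem hesP_Phi (p q ξ η : ℝ) : hesP (Phi (-1) p q ξ η) = 9 * (p ^ 2 + q ^ 2) * η ^ 2 := by
  simp only [hesP, Phi_zero, Phi_one, Phi_two]; ring

theorem hesQ_Phi (p q ξ η : ℝ) :
    hesQ (Phi (-1) p q ξ η) = -2 * ξ * (9 * (p ^ 2 + q ^ 2) * η ^ 2) := by
  simp only [hesQ, Phi_zero, Phi_one, Phi_two, Phi_three]; ring

theorem hesR_Phi (p q ξ η : ℝ) :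
    hesR (Phi (-1) p q ξ η) = (ξ ^ 2 + η ^ 2) * (9 * (p ^ 2 + q ^ 2) * η ^ 2) := by
  simp only [hesR, Phi_one, Phi_two, Phi_three]; ring

theorem Phi_inj {s p q ξ η p' q' ξ' η' : ℝ} (hs : s = 1 ∨ s = -1) (hη : 0 < η) (hη' : 0 < η')
    (hp : p ≠ 0) (h : Phi s p q ξ η = Phi s p' q' ξ' η') :
    p = p' ∧ q = q' ∧ ξ = ξ' ∧ η = η' := by
  have h0 : p = p' := congrFun h 0
  subst h0
  have hz : ξ = ξ' ∧ η ^ 2 = η' ^ 2 := by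
    rcases hs with rfl | rfl
    · have h1 := congrFun h 1
      have h2 := congrFun h 2
      have h3 := congrFun h 3
      simp only [Phi_one, Phi_two, Phi_three] at h1 h2 h3
      set z : ℂ := ξ + η * Complex.I with hz
      have hI : Complex.I ^ 2 = -1 := Complex.I_sq
      have hI3 : Complex.I ^ 3 = -Complex.I := Complex.I_pow_three
      have key : ((z - ξ') ^ 2 + (η' : ℂ) ^ 2) * (p * (z - ξ') + q' * η') = 0 := by
        have c1 := congrArg (fun x : ℝ => (x : ℂ)) h1
        have c2 := congrArg (fun x : ℝ => (x : ℂ)) h2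
        have c3 := congrArg (fun x : ℝ => (x : ℂ)) h3
        push_cast at c1 c2 c3
        have hf : ((z - ξ) ^ 2 + (η : ℂ) ^ 2) * (p * (z - ξ) + q * η) = 0 := by
          rw [hz]
          linear_combination ((η : ℂ) ^ 2 * (p * (η * Complex.I) + q * η)) * hI
        linear_combination hf - z ^ 2 * c1 - z * c2 - c3
      rcases mul_eq_zero.1 key with hk | hk
      · have him := congrArg Complex.im hk
        have hre := congrArg Complex.re hk
        simp [hz, sq] at him hre
        have : ξ = ξ' := by
          have : (ξ - ξ') * η = 0 := by linarith
          linarith [(mul_eq_zero.1 this).resolve_right hη.ne']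
        refine ⟨this, ?_⟩
        subst this
        nlinarith
      · have him := congrArg Complex.im hk
        simp [hz, hp] at him
        exact absurd him hη.ne'
    · have hP := congrArg hesP h
      have hQ := congrArg hesQ h
      have hR := congrArg hesR h
      rw [hesP_Phi, hesP_Phi] at hP
      rw [hesQ_Phi, hesQ_Phi, ← hP] at hQ
      rw [hesR_Phi, hesR_Phi, ← hP] at hR
      have hne : 9 * (p ^ 2 + q ^ 2) * η ^ 2 ≠ 0 := by positivity
      have e1 := mul_right_cancel₀ hne hQ
      have e2 := mul_right_cancel₀ hne hR
      have : ξ = ξ' := by linarith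
      subst this
      exact ⟨rfl, by linarith⟩
  obtain ⟨rfl, h2⟩ := hz
  have hηη : η = η' := by
    rwa [sq_eq_sq₀ hη.le hη'.le] at h2
  subst hηη
  refine ⟨rfl, ?_, rfl, rfl⟩
  have h1 := congrFun h 1
  simp only [Phi_one] at h1
  have hne : (2 - s) * η ≠ 0 := by
    rcases hs with rfl | rfl <;> norm_num <;> exact hη.ne'
  apply mul_left_cancel₀ hne
  linarith

theorem sub_Phi {s p q ξ η a b c d : ℝ} (hs : s = 1 ∨ s = -1) (hη : 0 < η)
    (hdet : a * d - b * c = 1) :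
    ∃ p' q', sub a b c d (Phi s p q ξ η) = Phi s p' q'
      (-((a - ξ * c) * (b - ξ * d) + η ^ 2 * c * d) / ((a - ξ * c) ^ 2 + η ^ 2 * c ^ 2))
      (η / ((a - ξ * c) ^ 2 + η ^ 2 * c ^ 2)) := by
  have hA : (a - ξ * c) ^ 2 + η ^ 2 * c ^ 2 ≠ 0 := by
    by_cases hc : c = 0
    · subst hc
      have : a ≠ 0 := by rintro rfl; simp at hdet
      simpa using this
    · positivity
  set A := (a - ξ * c) ^ 2 + η ^ 2 * c ^ 2 with hAdef
  set u := a - ξ * c with hu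
  set v := η * c with hv
  have hη1 : η = u * (η * d) - v * (b - ξ * d) := by
    rw [hu, hv]; linear_combination (-η) * hdet
  have hA2 : A = u ^ 2 + v ^ 2 := by rw [hAdef, hv]; ring
  set X := b - ξ * d with hX
  set Y := η * d with hY
  rw [show u * X + η ^ 2 * c * d = u * X + v * Y by rw [hv, hY]; ring]
  have hsub : ∀ p q, sub a b c d (Phi s p q ξ η) = sub u X v Y (Phi s p q 0 1) := by
    intro p q
    apply form_ext <;> simp only [sub_zero_apply, sub_one_apply, sub_two_apply, sub_three_apply,
      Phi_zero, Phi_one, Phi_two, Phi_three, hu, hv, hX, hY] <;> ring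
  have hsub2 : ∀ p q ξ η, Phi s p q ξ η = sub 1 (-ξ) 0 η (Phi s p q 0 1) := by
    intro p q ξ η
    apply form_ext <;> simp only [sub_zero_apply, sub_one_apply, sub_two_apply, sub_three_apply,
      Phi_zero, Phi_one, Phi_two, Phi_three] <;> ring
  have hX2 : X = u * ((u * X + v * Y) / A) - v * (η / A) := by
    field_simp
    rw [hA2]; linear_combination v * hη1
  have hY2 : Y = v * ((u * X + v * Y) / A) + u * (η / A) := by
    field_simp
    rw [hA2]; linear_combination (-u) * hη1
  simp only [neg_div]
  generalize (u * X + v * Y) / A = K at hX2 hY2 ⊢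
  generalize η / A = L at hX2 hY2 ⊢
  have hrot : sub u X v Y (Phi s p q 0 1) =
      sub 1 K 0 L (sub u (-v) v u (Phi s p q 0 1)) := by
    rw [sub_sub]
    rw [hX2, hY2]
    congr 1 <;> ring
  rw [hsub, hrot]
  rcases hs with rfl | rfl
  · refine ⟨A * (p * u + q * v), A * (q * u - p * v), ?_⟩
    rw [hsub2 (A * (p * u + q * v))]
    congr 1
    · ring
    · rw [hA2]
      apply form_ext <;> simp only [sub_zero_apply, sub_one_apply, sub_two_apply, sub_three_apply,
        Phi_zero, Phi_one, Phi_two, Phi_three] <;> ring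
  · refine ⟨p * (u ^ 3 - 3 * u * v ^ 2) + q * (3 * u ^ 2 * v - v ^ 3),
      q * (u ^ 3 - 3 * u * v ^ 2) - p * (3 * u ^ 2 * v - v ^ 3), ?_⟩
    rw [hsub2 (p * (u ^ 3 - 3 * u * v ^ 2) + q * (3 * u ^ 2 * v - v ^ 3))]
    congr 1
    · ring
    · apply form_ext <;> simp only [sub_zero_apply, sub_one_apply, sub_two_apply, sub_three_apply,
        Phi_zero, Phi_one, Phi_two, Phi_three] <;> ring

theorem exists_real_root {f : Fin 4 → ℝ} (h0 : f 0 ≠ 0) :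
    ∃ r, f 0 * r ^ 3 + f 1 * r ^ 2 + f 2 * r + f 3 = 0 := by
  have hdeg := Polynomial.natDegree_cubic (b := f 1) (c := f 2) (d := f 3) h0
  have hred : ¬ Irreducible (Polynomial.C (f 0) * Polynomial.X ^ 3 +
      Polynomial.C (f 1) * Polynomial.X ^ 2 + Polynomial.C (f 2) * Polynomial.X +
      Polynomial.C (f 3)) := by
    intro h
    have := h.natDegree_le_two
    omega
  rw [Polynomial.irreducible_iff_roots_eq_zero_of_degree_le_three (by omega) (by omega)] at hred
  obtain ⟨r, hr⟩ := Multiset.exists_mem_of_ne_zero hred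
  exact ⟨r, by simpa using Polynomial.isRoot_of_mem_roots hr⟩

theorem exists_Phi {s : ℝ} (hs : s = 1 ∨ s = -1) {f : Fin 4 → ℝ} (h0 : f 0 ≠ 0)
    (hD : s * cdisc f < 0) : ∃ p q ξ η, 0 < η ∧ f = Phi s p q ξ η := by
  rcases hs with rfl | rfl
  · obtain ⟨r, hr⟩ := exists_real_root h0
    obtain ⟨b, hb⟩ : ∃ b, f 1 = b - f 0 * r := ⟨f 1 + f 0 * r, by ring⟩
    obtain ⟨c, hc⟩ : ∃ c, f 2 = c - b * r := ⟨f 2 + b * r, by ring⟩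
    have h3 : f 3 = -c * r := by rw [hb, hc] at hr; linear_combination hr
    have hq : 0 < 4 * f 0 * c - b ^ 2 := by
      have : cdisc f = (b ^ 2 - 4 * f 0 * c) * (f 0 * r ^ 2 + b * r + c) ^ 2 := by
        rw [cdisc, h3, hc, hb]; ring
      rw [this, one_mul] at hD
      by_contra hcon
      have : 0 ≤ (b ^ 2 - 4 * f 0 * c) * (f 0 * r ^ 2 + b * r + c) ^ 2 :=
        mul_nonneg (by linarith) (sq_nonneg _)
      linarith
    obtain ⟨η, hη, hη2⟩ : ∃ η : ℝ, 0 < η ∧ η ^ 2 = (4 * f 0 * c - b ^ 2) / (4 * f 0 ^ 2) :=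
      ⟨√((4 * f 0 * c - b ^ 2) / (4 * f 0 ^ 2)), by positivity, Real.sq_sqrt (by positivity)⟩
    have hη3 : 4 * f 0 ^ 2 * η ^ 2 = 4 * f 0 * c - b ^ 2 := by rw [hη2]; field_simp
    obtain ⟨ξ, hξ⟩ : ∃ ξ, b = -2 * f 0 * ξ := ⟨-b / (2 * f 0), by field_simp⟩
    have hc2 : c = f 0 * (ξ ^ 2 + η ^ 2) := by
      apply mul_left_cancel₀ (show (4 * f 0) ≠ 0 by simpa using h0)
      rw [hξ] at hη3; linear_combination -hη3
    obtain ⟨q, hq2⟩ : ∃ q, q * η = f 0 * (ξ - r) := ⟨f 0 * (ξ - r) / η, by field_simp⟩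
    refine ⟨f 0, q, ξ, η, hη, form_ext rfl ?_ ?_ ?_⟩
    · rw [Phi_one, hb, hξ]; linear_combination -hq2
    · rw [Phi_two, hc, hc2, hξ]; linear_combination 2 * ξ * hq2
    · rw [Phi_three, h3, hc2]; linear_combination (-(ξ ^ 2 + η ^ 2)) * hq2
  · have hD' : 0 < cdisc f := by linarith
    have hP3 : 4 * hesP f ^ 3 = (2 * f 1 ^ 3 - 9 * f 0 * f 1 * f 2 + 27 * f 0 ^ 2 * f 3) ^ 2 +
        27 * f 0 ^ 2 * cdisc f := by
      simp only [hesP, cdisc]; ring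
    have hP : 0 < hesP f := by
      have : 0 < hesP f ^ 3 := by
        have : 0 < 27 * f 0 ^ 2 * cdisc f := by positivity
        nlinarith [sq_nonneg (2 * f 1 ^ 3 - 9 * f 0 * f 1 * f 2 + 27 * f 0 ^ 2 * f 3)]
      exact (Odd.pow_pos_iff (by decide)).1 this
    have hPR := hes_disc f
    have s1 : f 2 * hesP f = f 1 * hesQ f - 3 * f 0 * hesR f := by
      simp only [hesP, hesQ, hesR]; ring
    have s2 : 3 * f 3 * hesP f = f 2 * hesQ f - f 1 * hesR f := by
      simp only [hesP, hesQ, hesR]; ring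
    generalize hesP f = P at hP hPR s1 s2
    generalize hesQ f = Q at hPR s1 s2
    generalize hesR f = R at hPR s1 s2
    obtain ⟨η, hη, hη2⟩ : ∃ η : ℝ, 0 < η ∧ η ^ 2 = 3 * cdisc f / (4 * P ^ 2) :=
      ⟨√(3 * cdisc f / (4 * P ^ 2)), by positivity, Real.sq_sqrt (by positivity)⟩
    have hη3 : 4 * P ^ 2 * η ^ 2 = 4 * P * R - Q ^ 2 := by rw [hη2, hPR]; field_simp
    obtain ⟨ξ, hξ⟩ : ∃ ξ, Q = -2 * P * ξ := ⟨-Q / (2 * P), by field_simp⟩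
    have hR : R = P * (ξ ^ 2 + η ^ 2) := by
      apply mul_left_cancel₀ (show (4 * P) ≠ 0 by positivity)
      rw [hξ] at hη3; linear_combination -hη3
    rw [hR, hξ] at s1 s2
    have t1 : f 2 = -2 * f 1 * ξ - 3 * f 0 * (ξ ^ 2 + η ^ 2) := by
      apply mul_right_cancel₀ hP.ne'; linear_combination s1
    have t2 : 3 * f 3 = -2 * f 2 * ξ - f 1 * (ξ ^ 2 + η ^ 2) := by
      apply mul_right_cancel₀ hP.ne'; linear_combination s2
    obtain ⟨q, hq⟩ : ∃ q, 3 * q * η = f 1 + 3 * f 0 * ξ :=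
      ⟨(f 1 + 3 * f 0 * ξ) / (3 * η), by field_simp⟩
    refine ⟨f 0, q, ξ, η, hη, form_ext rfl ?_ ?_ ?_⟩
    · rw [Phi_one]; linear_combination -hq
    · rw [Phi_two, t1]; linear_combination 2 * ξ * hq
    · rw [Phi_three]
      apply mul_left_cancel₀ (show (3 : ℝ) ≠ 0 by norm_num)
      rw [t2, t1]; linear_combination (-3 * ξ ^ 2 + η ^ 2) * hq

/-- The parameters of `Phi` are those of a reduced form. -/
structure IsRed (s : ℝ) (f : Fin 4 → ℝ) (p q ξ η : ℝ) : Prop where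
  eq : f = Phi s p q ξ η
  p_pos : 0 < p
  η_pos : 0 < η
  ξ_nonneg : 0 ≤ ξ
  ξ_le : ξ ≤ 1 / 2
  norm_ge : 1 ≤ ξ ^ 2 + η ^ 2

/-- A form with integral coefficients, viewed as a real form. -/
def toR (f : Fin 4 → ℤ) : Fin 4 → ℝ := fun i => (f i : ℝ)

@[simp] theorem toR_apply (f : Fin 4 → ℤ) (i : Fin 4) : toR f i = f i := rfl

theorem toR_sub (a b c d : ℤ) (f : Fin 4 → ℤ) : toR (sub a b c d f) = sub (a : ℝ) b c d (toR f) :=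
  sub_map (Int.castRingHom ℝ) a b c d f

theorem cdisc_toR (f : Fin 4 → ℤ) : cdisc (toR f) = cdisc f := cdisc_map (Int.castRingHom ℝ) f

theorem sub_flip_Phi (s p q ξ η : ℝ) :
    sub 1 0 0 (-1) (Phi s p q ξ η) = Phi s p (-q) (-ξ) η := by
  apply form_ext <;> simp <;> ring

theorem sub_neg_Phi (s p q ξ η : ℝ) :
    sub (-1) 0 0 (-1) (Phi s p q ξ η) = Phi s (-p) (-q) ξ η := by
  apply form_ext <;> simp <;> ring

theorem sub_translate_Phi (s p q ξ η n : ℝ) :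
    sub 1 n 0 1 (Phi s p q ξ η) = Phi s p q (ξ - n) η := by
  apply form_ext <;> simp <;> ring

open UpperHalfPlane in
theorem exists_reduced {s : ℝ} (hs : s = 1 ∨ s = -1) {f : Fin 4 → ℤ} (hf : Irr f)
    (hD : s * cdisc f < 0) :
    ∃ g, FormEquiv (n := 3) f g ∧ ∃ p q ξ η, IsRed s (toR g) p q ξ η := by
  obtain ⟨p, q, ξ, η, hη, hΦ⟩ := exists_Phi hs (f := toR f)
    (by simpa using hf.apply_zero_ne) (by rwa [cdisc_toR])
  obtain ⟨γ, hγ1, hγ2⟩ := ModularGroup.exists_smul_mem_fd ⟨⟨ξ, η⟩, hη⟩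
  have hdet : γ 0 0 * γ 1 1 - γ 0 1 * γ 1 0 = 1 := by
    have := γ.det_coe; rwa [Matrix.det_fin_two] at this
  generalize hz : γ • (⟨⟨ξ, η⟩, hη⟩ : ℍ) = z at hγ1 hγ2
  have hzc := coe_specialLinearGroup_apply γ (⟨⟨ξ, η⟩, hη⟩ : ℍ)
  rw [hz] at hzc
  obtain ⟨p1, q1, h1⟩ := sub_Phi (p := p) (q := q) (ξ := ξ) (a := γ 1 1) (b := -γ 0 1)
    (c := -γ 1 0) (d := γ 0 0) hs hη (by
      have : ((γ 0 0 * γ 1 1 - γ 0 1 * γ 1 0 : ℤ) : ℝ) = 1 := by rw [hdet]; simp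
      push_cast at this; linarith)
  have hzre : z.re = -(((γ 1 1 : ℝ) - ξ * -γ 1 0) * (-γ 0 1 - ξ * γ 0 0) +
      η ^ 2 * -γ 1 0 * γ 0 0) / (((γ 1 1 : ℝ) - ξ * -γ 1 0) ^ 2 + η ^ 2 * (-γ 1 0) ^ 2) := by
    have h := congrArg Complex.re hzc
    simp [Complex.div_re, Complex.normSq_apply] at h
    rw [h]
    rw [← add_div]
    congr 1
    · ring
    · ring
  have hzim : z.im = η / (((γ 1 1 : ℝ) - ξ * -γ 1 0) ^ 2 + η ^ 2 * (-γ 1 0) ^ 2) := by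
    have h := congrArg Complex.im hzc
    simp [Complex.div_im, Complex.normSq_apply] at h
    rw [h]
    have hR : ((γ 0 0 * γ 1 1 - γ 0 1 * γ 1 0 : ℤ) : ℝ) = 1 := by rw [hdet]; simp
    push_cast at hR
    rw [← sub_div]
    congr 1
    · linear_combination η * hR
    · ring
  rw [← hzre, ← hzim] at h1
  obtain ⟨F, hF, hFE⟩ : ∃ F : Fin 4 → ℤ, FormEquiv (n := 3) f F ∧ toR F = Phi s p1 q1 z.re z.im :=
    ⟨sub (γ 1 1) (-γ 0 1) (-γ 1 0) (γ 0 0) f, formEquiv_iff.2 ⟨_, _, _, _, by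
      rw [show γ 1 1 * γ 0 0 - -γ 0 1 * -γ 1 0 = 1 by linarith, abs_one], rfl⟩, by
      rw [toR_sub, hΦ, ← h1]; push_cast; rfl⟩
  obtain ⟨G, hG, q2, x, hx0, hx2, hn, hGE⟩ : ∃ G : Fin 4 → ℤ, FormEquiv (n := 3) f G ∧ ∃ q2 x,
      0 ≤ x ∧ x ≤ 1 / 2 ∧ 1 ≤ x ^ 2 + z.im ^ 2 ∧ toR G = Phi s p1 q2 x z.im := by
    have hn : 1 ≤ z.re ^ 2 + z.im ^ 2 := by
      rw [Complex.normSq_apply] at hγ1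
      simpa [sq] using hγ1
    obtain ⟨l1, l2⟩ := abs_le.1 hγ2
    rcases le_total 0 z.re with h0 | h0
    · exact ⟨F, hF, q1, z.re, h0, l2, hn, hFE⟩
    · refine ⟨sub 1 0 0 (-1) F, formEquiv_trans hF (formEquiv_iff.2 ⟨1, 0, 0, -1, by simp, rfl⟩),
        -q1, -z.re, by linarith, by linarith, by simpa using hn, ?_⟩
      rw [toR_sub, hFE, ← sub_flip_Phi]; simp
  have hp1 : p1 ≠ 0 := by
    have := (hf.of_equiv hG).apply_zero_ne
    have h2 := congrFun hGE 0
    simp only [toR_apply, Phi_zero] at h2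
    rw [← h2]; exact_mod_cast this
  rcases lt_or_gt_of_ne hp1 with hp | hp
  · refine ⟨sub (-1) 0 0 (-1) G, formEquiv_trans hG (formEquiv_iff.2 ⟨-1, 0, 0, -1, by simp, rfl⟩),
      -p1, -q2, x, z.im, ⟨?_, by linarith, z.im_pos, hx0, hx2, hn⟩⟩
    rw [toR_sub, hGE, ← sub_neg_Phi]; simp
  · exact ⟨G, hG, p1, q2, x, z.im, ⟨hGE, hp, z.im_pos, hx0, hx2, hn⟩⟩

theorem one_lt_normSq {a c : ℤ} {ξ η : ℝ} (hc : c ≠ 0) (hξ : |ξ| < 1 / 2)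
    (hn : 1 < ξ ^ 2 + η ^ 2) : 1 < (a - ξ * c) ^ 2 + η ^ 2 * (c : ℝ) ^ 2 := by
  have hge : (1 : ℤ) ≤ a ^ 2 - |a * c| + c ^ 2 := by
    rw [abs_mul, ← sq_abs a, ← sq_abs c]
    have h1 : 1 ≤ |c| := Int.one_le_abs hc
    have h2 : 0 ≤ |a| := abs_nonneg a
    rcases h2.eq_or_lt with h | h
    · rw [← h]; nlinarith
    · nlinarith [sq_nonneg (|a| - |c|), mul_le_mul h1 (show 1 ≤ |a| from h) zero_le_one
        (by linarith)]
  have hR : (1 : ℝ) ≤ (a : ℝ) ^ 2 - |(a : ℝ) * c| + (c : ℝ) ^ 2 := by exact_mod_cast hge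
  have hc2 : (0 : ℝ) < (c : ℝ) ^ 2 := by positivity
  have h3 : 2 * ξ * (a * c) ≤ |(a : ℝ) * c| := by
    have h4 : ξ * (a * c) ≤ |ξ| * |(a : ℝ) * c| := by rw [← abs_mul]; exact le_abs_self _
    nlinarith [abs_nonneg ((a : ℝ) * c)]
  nlinarith

theorem eta_lt_of_sub {s p q ξ η p' q' ξ' η' : ℝ} (hs : s = 1 ∨ s = -1) {a b c d : ℤ}
    (hdet : a * d - b * c = 1) (hc : c ≠ 0) (hη : 0 < η) (hη' : 0 < η') (hξ : |ξ| < 1 / 2)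
    (hn : 1 < ξ ^ 2 + η ^ 2) (hp' : p' ≠ 0)
    (h : sub (a : ℝ) b c d (Phi s p q ξ η) = Phi s p' q' ξ' η') : η' < η := by
  obtain ⟨p1, q1, h1⟩ := sub_Phi (p := p) (q := q) (ξ := ξ) (a := a) (b := b)
    (c := c) (d := d) hs hη (by exact_mod_cast hdet)
  have hA := one_lt_normSq (a := a) hc hξ hn
  rw [h] at h1
  have h2 := (Phi_inj hs hη' (div_pos hη (by linarith)) hp' h1).2.2.2
  rw [h2]
  exact div_lt_self hη hA

theorem eq_zero_of_sub {s p q ξ η p' q' ξ' η' : ℝ} (hs : s = 1 ∨ s = -1) {a b c d : ℤ}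
    (hdet : a * d - b * c = 1) (hη : 0 < η) (hη' : 0 < η') (hξ : |ξ| < 1 / 2)
    (hn : 1 < ξ ^ 2 + η ^ 2) (hξ' : |ξ'| < 1 / 2) (hn' : 1 < ξ' ^ 2 + η' ^ 2)
    (hp : p ≠ 0) (hp' : p' ≠ 0) (h : sub (a : ℝ) b c d (Phi s p q ξ η) = Phi s p' q' ξ' η') :
    c = 0 := by
  by_contra hc
  have h1 := eta_lt_of_sub hs hdet hc hη hη' hξ hn hp' h
  have h2 : sub (d : ℝ) (-b : ℤ) (-c : ℤ) a (Phi s p' q' ξ' η') = Phi s p q ξ η := by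
    rw [← h, sub_sub]
    have hR : (a * d - b * c : ℝ) = 1 := by exact_mod_cast hdet
    conv_rhs => rw [← sub_id (Phi s p q ξ η)]
    congr 1 <;> push_cast <;> first | ring1 | linear_combination hR
  have := eta_lt_of_sub hs (by linarith) (neg_ne_zero.2 hc) hη' hη hξ' hn' hp h2
  linarith

/-- The parameters of `Phi` are those of a form in the interior of the reduction domain. -/
structure IsStrictRed (s : ℝ) (f : Fin 4 → ℝ) (p q ξ η : ℝ) : Prop where
  eq : f = Phi s p q ξ η
  p_pos : 0 < p
  η_pos : 0 < η
  ξ_pos : 0 < ξ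
  ξ_lt : ξ < 1 / 2
  norm_gt : 1 < ξ ^ 2 + η ^ 2

theorem IsStrictRed.eq_of_equiv {s p q ξ η p' q' ξ' η' : ℝ} (hs : s = 1 ∨ s = -1)
    {f g : Fin 4 → ℤ} (hf : IsStrictRed s (toR f) p q ξ η)
    (hg : IsStrictRed s (toR g) p' q' ξ' η') (h : FormEquiv (n := 3) f g) : f = g := by
  obtain ⟨a, b, c, d, hd, rfl⟩ := formEquiv_iff.1 h
  have hG := hg.eq
  rw [toR_sub, hf.eq] at hG
  have hξ : |ξ| < 1 / 2 := by rw [abs_of_pos hf.ξ_pos]; exact hf.ξ_lt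
  have hξ' : |ξ'| < 1 / 2 := by rw [abs_of_pos hg.ξ_pos]; exact hg.ξ_lt
  rcases (abs_eq zero_le_one).1 hd with hdet | hdet
  · have hc := eq_zero_of_sub hs hdet hf.η_pos hg.η_pos hξ hf.norm_gt hξ' hg.norm_gt
      hf.p_pos.ne' hg.p_pos.ne' hG
    subst hc
    rw [mul_zero, sub_zero] at hdet
    have hab : a = d ∧ (a = 1 ∨ a = -1) := by
      rcases Int.eq_one_or_neg_one_of_mul_eq_one hdet with rfl | rfl
      · exact ⟨by linarith, .inl rfl⟩
      · exact ⟨by linarith, .inr rfl⟩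
    obtain ⟨rfl, ha⟩ := hab
    have h0 := congrFun hG 0
    have hpp := hf.p_pos
    have hpp' := hg.p_pos
    rcases ha with rfl | rfl
    · have hb : b = 0 := by
        have h2 := hG
        rw [Int.cast_one, Int.cast_zero, sub_translate_Phi] at h2
        have h3 := (Phi_inj hs hf.η_pos hg.η_pos hf.p_pos.ne' h2).2.2.1
        have h4 := hf.ξ_pos
        have h5 := hf.ξ_lt
        have h6 := hg.ξ_pos
        have h7 := hg.ξ_lt
        have h8 : (b : ℝ) < 1 := by linarith
        have h9 : (-1 : ℝ) < b := by linarith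
        have h10 : b < 1 := by exact_mod_cast h8
        have h11 : -1 < b := by exact_mod_cast h9
        omega
      subst hb
      exact (sub_id f).symm
    · simp at h0
      linarith
  · exfalso
    have hG' : sub (a : ℝ) b (-c : ℤ) (-d : ℤ) (Phi s p (-q) (-ξ) η) = Phi s p' q' ξ' η' := by
      rw [← sub_flip_Phi, sub_sub, ← hG]
      congr 1 <;> push_cast <;> ring
    have hdet' : a * -d - b * -c = 1 := by linarith
    have hc := eq_zero_of_sub hs hdet' hf.η_pos hg.η_pos (by rwa [abs_neg])
      (by rw [neg_sq]; exact hf.norm_gt) hξ' hg.norm_gt hf.p_pos.ne' hg.p_pos.ne' hG'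
    have hc0 : c = 0 := by simpa using hc
    subst hc0
    have hab : a = -d ∧ (a = 1 ∨ a = -1) := by
      rcases Int.eq_one_or_neg_one_of_mul_eq_one (show a * -d = 1 by linarith) with rfl | rfl
      · exact ⟨by linarith, .inl rfl⟩
      · exact ⟨by linarith, .inr rfl⟩
    obtain ⟨had, ha⟩ := hab
    rw [← had] at hG'
    have h0 := congrFun hG' 0
    have hpp := hf.p_pos
    have hpp' := hg.p_pos
    rcases ha with rfl | rfl
    · have h2 := hG'
      rw [Int.cast_one, neg_zero, Int.cast_zero, sub_translate_Phi] at h2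
      have h3 := (Phi_inj hs hf.η_pos hg.η_pos hf.p_pos.ne' h2).2.2.1
      have h4 := hf.ξ_pos
      have h5 := hf.ξ_lt
      have h6 := hg.ξ_pos
      have h7 := hg.ξ_lt
      have h8 : (b : ℝ) < 0 := by linarith
      have h9 : (-1 : ℝ) < b := by linarith
      have h10 : b < 0 := by exact_mod_cast h8
      have h11 : -1 < b := by exact_mod_cast h9
      omega
    · simp at h0
      linarith

theorem card_le_of_congr {S : Finset ℤ} {N : ℝ} {p : ℕ} (hp : 0 < p) (hN : 0 ≤ N)
    (hS : ∀ n ∈ S, |(n : ℝ)| ≤ N) (hc : ∀ m ∈ S, ∀ n ∈ S, (p : ℤ) ∣ m - n) :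
    (S.card : ℝ) ≤ 2 * N / p + 1 := by
  have hpR : (0 : ℝ) < p := by exact_mod_cast hp
  rcases S.eq_empty_or_nonempty with rfl | hne
  · simp; positivity
  set m := S.min' hne with hm
  have hmS : m ∈ S := S.min'_mem hne
  have hcard : S.card ≤ (Finset.range (⌊2 * N / p⌋₊ + 1)).card := by
    refine Finset.card_le_card_of_injOn (fun n => ((n - m) / p).toNat) ?_ ?_
    · intro n hn
      have hn : n ∈ S := hn
      rw [Finset.coe_range, Set.mem_Iio, Nat.lt_succ_iff, Nat.le_floor_iff (by positivity),
        le_div_iff₀ hpR]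
      obtain ⟨k, hk⟩ := hc n hn m hmS
      have hle : m ≤ n := S.min'_le n hn
      have hk0 : 0 ≤ k := by
        by_contra hneg
        have : (p : ℤ) * k < 0 := mul_neg_of_pos_of_neg (by exact_mod_cast hp) (by linarith)
        linarith
      simp only [hk]
      rw [Int.mul_ediv_cancel_left _ (by positivity)]
      have h1 : ((k.toNat : ℤ) : ℝ) = (k : ℝ) := by rw [Int.toNat_of_nonneg hk0]
      have h2 : ((n - m : ℤ) : ℝ) = p * k := by rw [hk]; push_cast; ring
      push_cast at h1 h2
      rw [h1, mul_comm, ← h2]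
      have := abs_le.1 (hS n hn)
      have := abs_le.1 (hS m hmS)
      linarith
    · intro a ha b hb hab
      have ha : a ∈ S := ha
      have hb : b ∈ S := hb
      obtain ⟨k, hk⟩ := hc a ha m hmS
      obtain ⟨l, hl⟩ := hc b hb m hmS
      have hla : m ≤ a := S.min'_le a ha
      have hlb : m ≤ b := S.min'_le b hb
      simp only [hk, hl] at hab
      rw [Int.mul_ediv_cancel_left _ (by positivity), Int.mul_ediv_cancel_left _ (by positivity)]
        at hab
      have hpos : (0 : ℤ) < p := by exact_mod_cast hp
      have hk0 : 0 ≤ k := nonneg_of_mul_nonneg_right (by linarith) hpos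
      have hl0 : 0 ≤ l := nonneg_of_mul_nonneg_right (by linarith) hpos
      have : k = l := by omega
      subst this
      linarith
  rw [Finset.card_range] at hcard
  calc (S.card : ℝ) ≤ ((⌊2 * N / p⌋₊ + 1 : ℕ) : ℝ) := by exact_mod_cast hcard
    _ ≤ 2 * N / p + 1 := by
      push_cast
      have := Nat.floor_le (show 0 ≤ 2 * N / p by positivity)
      linarith

theorem card_le_mul_of_proj {α β : Type*} [DecidableEq β] {S : Finset α} (π : α → β) {m n : ℝ}
    (hm : 0 ≤ m) (hn : ((S.image π).card : ℝ) ≤ n)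
    (h : ∀ b, ((S.filter (fun x => π x = b)).card : ℝ) ≤ m) : (S.card : ℝ) ≤ n * m := by
  rw [Finset.card_eq_sum_card_image π S]
  push_cast
  calc ∑ b ∈ S.image π, ((S.filter (fun x => π x = b)).card : ℝ) ≤ ∑ b ∈ S.image π, m :=
        Finset.sum_le_sum fun b _ => h b
    _ = (S.image π).card * m := by rw [Finset.sum_const, nsmul_eq_mul]
    _ ≤ n * m := mul_le_mul_of_nonneg_right hn hm

theorem card_le_mul_of_step {U : Finset (Fin 4 → ℤ)} {b : Fin 4 → ℝ} {B : ℝ} (hB : 0 ≤ B)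
    (i : Fin 4) (hi : ((U.image (fun f => f i)).card : ℝ) ≤ b i)
    (h : ∀ V ⊆ U, (∀ f ∈ V, ∀ g ∈ V, f i = g i) → (V.card : ℝ) ≤ B) :
    (U.card : ℝ) ≤ b i * B :=
  card_le_mul_of_proj (fun f => f i) hB hi fun _ =>
    h _ (Finset.filter_subset _ _) fun _ hf _ hg =>
      (Finset.mem_filter.1 hf).2.trans (Finset.mem_filter.1 hg).2.symm

/-- Counting forms in a box whose coefficients are successively determined modulo `p i`. -/
theorem card_le_prod {S : Finset (Fin 4 → ℤ)} {N : Fin 4 → ℝ} {p : Fin 4 → ℕ}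
    (hp : ∀ i, 0 < p i) (hN : ∀ i, 0 ≤ N i) (hS : ∀ f ∈ S, ∀ i, |(f i : ℝ)| ≤ N i)
    (hc : ∀ f ∈ S, ∀ g ∈ S, ∀ i, (∀ j, j < i → f j = g j) → (p i : ℤ) ∣ f i - g i) :
    (S.card : ℝ) ≤ (2 * N 0 / p 0 + 1) * ((2 * N 1 / p 1 + 1) *
      ((2 * N 2 / p 2 + 1) * (2 * N 3 / p 3 + 1))) := by
  obtain ⟨b, hb⟩ : ∃ b : Fin 4 → ℝ, ∀ i, b i = 2 * N i / p i + 1 := ⟨_, fun _ => rfl⟩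
  have hpos : ∀ i, 0 ≤ b i := fun i => by
    have := hN i
    rw [hb]
    positivity
  have step : ∀ (i : Fin 4) (U : Finset (Fin 4 → ℤ)), U ⊆ S →
      (∀ f ∈ U, ∀ g ∈ U, ∀ j, j < i → f j = g j) →
      ((U.image (fun f => f i)).card : ℝ) ≤ b i := by
    intro i U hU h
    rw [hb]
    refine card_le_of_congr (hp i) (hN i) ?_ ?_
    · intro n hn
      obtain ⟨f, hf, rfl⟩ := Finset.mem_image.1 hn
      exact hS f (hU hf) i
    · intro m hm n hn
      obtain ⟨f, hf, rfl⟩ := Finset.mem_image.1 hm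
      obtain ⟨g, hg, rfl⟩ := Finset.mem_image.1 hn
      exact hc f (hU hf) g (hU hg) i (h f hf g hg)
  simp only [← hb]
  have lt1 : ∀ j : Fin 4, j < 1 → j = 0 := by decide
  have lt2 : ∀ j : Fin 4, j < 2 → j = 0 ∨ j = 1 := by decide
  have lt3 : ∀ j : Fin 4, j < 3 → j = 0 ∨ j = 1 ∨ j = 2 := by decide
  refine card_le_mul_of_step (mul_nonneg (hpos 1) (mul_nonneg (hpos 2) (hpos 3))) 0
    (step 0 S subset_rfl fun f _ g _ j hj => absurd hj (Fin.not_lt_zero j)) fun V hV h0 => ?_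
  refine card_le_mul_of_step (mul_nonneg (hpos 2) (hpos 3)) 1
    (step 1 V hV fun f hf g hg j hj => lt1 j hj ▸ h0 f hf g hg) fun W hW h1 => ?_
  refine card_le_mul_of_step (hpos 3) 2
    (step 2 W (hW.trans hV) fun f hf g hg j hj => ?_) fun U hU h2 => ?_
  · rcases lt2 j hj with rfl | rfl
    · exact h0 f (hW hf) g (hW hg)
    · exact h1 f hf g hg
  have hinj : (U.image (fun f => f 3)).card = U.card :=
    Finset.card_image_of_injOn fun f hf g hg h =>
      form_ext (h0 f (hW (hU hf)) g (hW (hU hg))) (h1 f (hU hf) g (hU hg)) (h2 f hf g hg) h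
  rw [← hinj]
  refine step 3 U (hU.trans (hW.trans hV)) fun f hf g hg j hj => ?_
  rcases lt3 j hj with rfl | rfl | rfl
  · exact h0 f (hW (hU hf)) g (hW (hU hg))
  · exact h1 f (hU hf) g (hU hg)
  · exact h2 f hf g hg

theorem finite_of_abs_le (N : Fin 4 → ℝ) : {f : Fin 4 → ℤ | ∀ i, |(f i : ℝ)| ≤ N i}.Finite := by
  refine (Set.finite_Icc (fun i => -⌈N i⌉) (fun i => ⌈N i⌉)).subset fun f hf => ?_
  refine ⟨fun i => ?_, fun i => ?_⟩
  · have h1 := (abs_le.1 (hf i)).1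
    have h2 := Int.le_ceil (N i)
    have : ((-⌈N i⌉ : ℤ) : ℝ) ≤ f i := by push_cast; linarith
    exact_mod_cast this
  · have h1 := (abs_le.1 (hf i)).2
    have h2 := Int.le_ceil (N i)
    have : (f i : ℝ) ≤ ⌈N i⌉ := by linarith
    exact_mod_cast this

theorem ncard_le_prod {S : Set (Fin 4 → ℤ)} {N : Fin 4 → ℝ} {p : Fin 4 → ℕ}
    (hp : ∀ i, 0 < p i) (hN : ∀ i, 0 ≤ N i) (hS : ∀ f ∈ S, ∀ i, |(f i : ℝ)| ≤ N i)
    (hc : ∀ f ∈ S, ∀ g ∈ S, ∀ i, (∀ j, j < i → f j = g j) → (p i : ℤ) ∣ f i - g i) :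
    (S.ncard : ℝ) ≤ (2 * N 0 / p 0 + 1) * ((2 * N 1 / p 1 + 1) *
      ((2 * N 2 / p 2 + 1) * (2 * N 3 / p 3 + 1))) := by
  have hfin : S.Finite := (finite_of_abs_le N).subset hS
  rw [Set.ncard_eq_toFinset_card S hfin]
  exact card_le_prod hp hN (by simpa using hS) (by simpa using hc)

/-- Side lengths of the box containing the translates of the reduced forms at height `4 ^ k`. -/
noncomputable def side (L : ℝ) (k : ℕ) : Fin 4 → ℝ := ![L / 8 ^ k, L / 2 ^ k, L * 2 ^ k, L * 8 ^ k]

/-- Forms with positive leading coefficient in the box of side lengths `side L k`. -/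
def box (L : ℝ) (k : ℕ) : Set (Fin 4 → ℤ) := {f | 0 < f 0 ∧ ∀ i, |(f i : ℝ)| ≤ side L k i}

theorem box_finite (L : ℝ) (k : ℕ) : (box L k).Finite :=
  (finite_of_abs_le (side L k)).subset fun _ hf => hf.2

theorem one_le_of_box {L : ℝ} {k : ℕ} {f : Fin 4 → ℤ} (h : f ∈ box L k) : (8 : ℝ) ^ k ≤ L := by
  have h1 : (1 : ℝ) ≤ |(f 0 : ℝ)| := by
    have : (1 : ℤ) ≤ |f 0| := Int.one_le_abs h.1.ne'
    exact_mod_cast this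
  have h2 := h1.trans (h.2 0)
  rwa [side, Matrix.cons_val_zero, le_div_iff₀ (by positivity), one_mul] at h2

theorem side_mono {L : ℝ} {k : ℕ} (hL : (8 : ℝ) ^ k ≤ L) :
    1 ≤ side L k 0 ∧ side L k 0 ≤ side L k 1 ∧ side L k 1 ≤ L ∧ L ≤ side L k 2 ∧
      side L k 2 ≤ side L k 3 := by
  have hL0 : (0 : ℝ) ≤ L := le_trans (by positivity) hL
  have h28 : (2 : ℝ) ^ k ≤ 8 ^ k := pow_le_pow_left₀ (by norm_num) (by norm_num) k
  have h2 : (1 : ℝ) ≤ 2 ^ k := one_le_pow₀ (by norm_num)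
  refine ⟨?_, ?_, ?_, ?_, ?_⟩ <;> simp only [side, Matrix.cons_val]
  · rw [le_div_iff₀ (by positivity)]; linarith
  · gcongr
  · exact div_le_self hL0 h2
  · nlinarith
  · gcongr

theorem side_prod (L : ℝ) (k : ℕ) :
    side L k 0 * (side L k 1 * (side L k 2 * side L k 3)) = L ^ 4 := by
  simp only [side, Matrix.cons_val]
  field_simp

theorem side_bound {N : ℝ} {p : ℕ} (hp : 0 < p) (h : (p : ℝ) ≤ N) :
    2 * N / p + 1 ≤ 3 * N / p := by
  have hpR : (0 : ℝ) < p := by exact_mod_cast hp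
  rw [div_add_one hpR.ne']
  gcongr
  linarith

theorem box_ncard_le {L : ℝ} {k : ℕ} (T : Set (Fin 4 → ℤ)) :
    ((box L k ∩ T).ncard : ℝ) ≤ 81 * L ^ 4 := by
  by_cases hL : (8 : ℝ) ^ k ≤ L
  · obtain ⟨h1, h2, h3, h4, h5⟩ := side_mono hL
    have h6 : (1 : ℝ) ≤ L := le_trans (one_le_pow₀ (by norm_num)) hL
    have hs : ∀ i, 1 ≤ side L k i := by
      intro i; fin_cases i <;> simp only [Fin.zero_eta, Fin.mk_one, Fin.reduceFinMk] <;> linarith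
    refine (ncard_le_prod (N := side L k) (p := fun _ => 1) (by simp)
      (fun i => zero_le_one.trans (hs i)) (fun f hf => hf.1.2) (by simp)).trans ?_
    rw [← side_prod L k]
    have h := fun i => side_bound (p := 1) one_pos (by simpa using hs i)
    have hp : ∀ i, 0 ≤ 2 * side L k i / ((1 : ℕ) : ℝ) + 1 := fun i => by
      have := hs i
      positivity
    have hp' : ∀ i, 0 ≤ side L k i := fun i => zero_le_one.trans (hs i)
    calc _ ≤ (3 * side L k 0 / (1 : ℕ)) * ((3 * side L k 1 / (1 : ℕ)) *
        ((3 * side L k 2 / (1 : ℕ)) * (3 * side L k 3 / (1 : ℕ)))) := by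
          have := hp 0; have := hp 1; have := hp 2; have := hp 3
          have := hp' 0; have := hp' 1; have := hp' 2; have := hp' 3
          gcongr <;> exact h _
      _ = _ := by push_cast; ring
  · have : box L k ∩ T = ∅ := by
      ext f; simp; intro hf; exact absurd (one_le_of_box hf) hL
    rw [this]; simp; positivity

/-- Invariance of a set of forms under integral translations. -/
def TransInv (T : Set (Fin 4 → ℤ)) : Prop := ∀ f ∈ T, ∀ n : ℤ, sub 1 n 0 1 f ∈ T

/-- Reduced forms in `T` with discriminant of sign `-s`, of size less than `lam ^ 4`, and with
height at least `h`. -/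
def redSet (s lam h : ℝ) (T : Set (Fin 4 → ℤ)) : Set (Fin 4 → ℤ) :=
  {f | f ∈ T ∧ ∃ p q ξ η, IsRed s (toR f) p q ξ η ∧ h ≤ η ∧ -s * ((cdisc f : ℤ) : ℝ) < lam ^ 4}

/-- The slice of reduced forms of height between `4 ^ k / 2` and `4 ^ (k + 1) / 2`. -/
def redSlice (s lam : ℝ) (k : ℕ) (T : Set (Fin 4 → ℤ)) : Set (Fin 4 → ℤ) :=
  {f | f ∈ T ∧ ∃ p q ξ η, IsRed s (toR f) p q ξ η ∧ 4 ^ k / 2 ≤ η ∧ η < 4 ^ (k + 1) / 2 ∧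
    -s * ((cdisc f : ℤ) : ℝ) < lam ^ 4}

theorem Phi_bound {s p q x η m t : ℝ} (hs : s = 1 ∨ s = -1) (hp : |p| ≤ m) (hq : |q| ≤ m)
    (hx : |x| ≤ t) (hη : |η| ≤ 2 * t) :
    |Phi s p q x η 1| ≤ 9 * (m * t) ∧ |Phi s p q x η 2| ≤ 27 * (m * t ^ 2) ∧
      |Phi s p q x η 3| ≤ 27 * (m * t ^ 3) := by
  have hm : 0 ≤ m := (abs_nonneg p).trans hp
  have ht : 0 ≤ t := (abs_nonneg x).trans hx
  have h2s : |2 - s| ≤ 3 := by rcases hs with rfl | rfl <;> norm_num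
  have hs1 : |s| = 1 := by rcases hs with rfl | rfl <;> norm_num
  simp only [Phi_one, Phi_two, Phi_three]
  refine ⟨?_, ?_, ?_⟩
  · calc |-3 * p * x + (2 - s) * q * η| ≤ |-3 * p * x| + |(2 - s) * q * η| := abs_add_le _ _
      _ = 3 * |p| * |x| + |2 - s| * |q| * |η| := by simp [abs_mul]
      _ ≤ 3 * m * t + 3 * m * (2 * t) := by gcongr
      _ = _ := by ring
  · calc |3 * p * x ^ 2 - 2 * (2 - s) * q * x * η + s * (2 - s) * p * η ^ 2|
        ≤ |3 * p * x ^ 2| + |2 * (2 - s) * q * x * η| + |s * (2 - s) * p * η ^ 2| :=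
          (abs_add_le _ _).trans (add_le_add (abs_sub _ _) le_rfl)
      _ = 3 * |p| * |x| ^ 2 + 2 * |2 - s| * |q| * |x| * |η| + |s| * |2 - s| * |p| * |η| ^ 2 := by
          simp [abs_mul]
      _ ≤ 3 * m * t ^ 2 + 2 * 3 * m * t * (2 * t) + 1 * 3 * m * (2 * t) ^ 2 := by
          rw [hs1]; gcongr
      _ = _ := by ring
  · calc |-p * x ^ 3 + (2 - s) * q * x ^ 2 * η - s * (2 - s) * p * x * η ^ 2 + s * q * η ^ 3|
        ≤ |-p * x ^ 3| + |(2 - s) * q * x ^ 2 * η| + |s * (2 - s) * p * x * η ^ 2| +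
            |s * q * η ^ 3| :=
          (abs_add_le _ _).trans (add_le_add ((abs_sub _ _).trans
            (add_le_add (abs_add_le _ _) le_rfl)) le_rfl)
      _ = |p| * |x| ^ 3 + |2 - s| * |q| * |x| ^ 2 * |η| + |s| * |2 - s| * |p| * |x| * |η| ^ 2 +
            |s| * |q| * |η| ^ 3 := by
          simp [abs_mul]
      _ ≤ m * t ^ 3 + 3 * m * t ^ 2 * (2 * t) + 1 * 3 * m * t * (2 * t) ^ 2 +
            1 * m * (2 * t) ^ 3 := by
          rw [hs1]; gcongr
      _ = _ := by ring

theorem pq_bound {s p q η lam : ℝ} {k : ℕ} (hs : s = 1 ∨ s = -1) (hlam : 0 < lam)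
    (hη : 4 ^ k / 2 ≤ η)
    (h : (56 - 52 * s) * (p ^ 2 + q ^ 2) ^ 2 * η ^ 6 < lam ^ 4) :
    |p| ≤ 2 * lam / 8 ^ k ∧ |q| ≤ 2 * lam / 8 ^ k := by
  have h8 : (0 : ℝ) < 8 ^ k := by positivity
  have h1 : ((8 : ℝ) ^ k) ^ 2 = (4 ^ k) ^ 3 := by
    rw [← pow_mul, ← pow_mul, mul_comm k 2, mul_comm k 3, pow_mul, pow_mul]; norm_num
  have h2 : ((8 : ℝ) ^ k) ^ 4 / 64 ≤ η ^ 6 := by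
    have h3 : ((4 : ℝ) ^ k / 2) ^ 6 ≤ η ^ 6 := pow_le_pow_left₀ (by positivity) hη 6
    have h4 : ((8 : ℝ) ^ k) ^ 4 / 64 = (4 ^ k / 2) ^ 6 := by
      have : ((8 : ℝ) ^ k) ^ 4 = (((8 : ℝ) ^ k) ^ 2) ^ 2 := by ring
      rw [this, h1]; ring
    linarith
  have h4s : 4 ≤ 56 - 52 * s := by rcases hs with rfl | rfl <;> norm_num
  have h5 : 4 * (p ^ 2 + q ^ 2) ^ 2 * ((8 ^ k) ^ 4 / 64) < lam ^ 4 :=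
    lt_of_le_of_lt (by gcongr) h
  have h6 : (p ^ 2 + q ^ 2) * (8 ^ k) ^ 2 < 4 * lam ^ 2 := by
    refine lt_of_pow_lt_pow_left₀ 2 (by positivity) ?_
    nlinarith
  refine ⟨abs_le_of_sq_le_sq ?_ (by positivity), abs_le_of_sq_le_sq ?_ (by positivity)⟩ <;>
    rw [div_pow, le_div_iff₀ (by positivity)] <;> nlinarith [sq_nonneg (p * 8 ^ k), sq_nonneg (q * 8 ^ k)]

theorem translate_mem_box {s lam : ℝ} (hs : s = 1 ∨ s = -1) (hlam : 0 < lam) {k : ℕ}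
    {T : Set (Fin 4 → ℤ)} (hT : TransInv T) {f : Fin 4 → ℤ} (hf : f ∈ redSlice s lam k T)
    {n : ℕ} (hn : n < 4 ^ k) : sub 1 (n : ℤ) 0 1 f ∈ box (54 * lam) k ∩ T := by
  obtain ⟨hfT, p, q, ξ, η, hr, hη, hη', hd⟩ := hf
  refine ⟨?_, hT f hfT n⟩
  have hR : toR (sub 1 (n : ℤ) 0 1 f) = Phi s p q (ξ - n) η := by
    rw [toR_sub, hr.eq]
    push_cast
    exact sub_translate_Phi s p q ξ η n
  have hs2 : s * s = 1 := by rcases hs with rfl | rfl <;> norm_num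
  rw [← cdisc_toR, hr.eq, cdisc_Phi hs] at hd
  obtain ⟨hp, hq⟩ := pq_bound (p := p) (q := q) hs hlam hη (by
    have : -s * (-s * (56 - 52 * s) * (p ^ 2 + q ^ 2) ^ 2 * η ^ 6) =
      (s * s) * ((56 - 52 * s) * (p ^ 2 + q ^ 2) ^ 2 * η ^ 6) := by ring
    rwa [this, hs2, one_mul] at hd)
  have hn1 : (n : ℝ) + 1 ≤ 4 ^ k := by exact_mod_cast hn
  have hn0 : (0 : ℝ) ≤ n := n.cast_nonneg
  have hx : |ξ - n| ≤ 4 ^ k := abs_le.2 ⟨by linarith [hr.ξ_nonneg], by linarith [hr.ξ_le]⟩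
  have hηb : |η| ≤ 2 * 4 ^ k := by
    rw [abs_of_pos hr.η_pos]; rw [pow_succ] at hη'; linarith
  obtain ⟨b1, b2, b3⟩ := Phi_bound hs hp hq hx hηb
  have e := fun i => congrFun hR i
  simp only [toR_apply] at e
  have h8 : (8 : ℝ) ^ k = 2 ^ k * 4 ^ k := by rw [← mul_pow]; norm_num
  have h4 : (4 : ℝ) ^ k = 2 ^ k * 2 ^ k := by rw [← mul_pow]; norm_num
  refine ⟨?_, fun i => ?_⟩
  · have := e 0
    rw [Phi_zero] at this
    have h : (0 : ℝ) < (sub 1 (n : ℤ) 0 1 f 0 : ℤ) := by rw [this]; exact hr.p_pos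
    exact_mod_cast h
  · rw [e]
    have h2k : (2 : ℝ) ^ k ≠ 0 := by positivity
    fin_cases i
    · simp only [Fin.zero_eta, Phi_zero, side, Matrix.cons_val]
      refine hp.trans ?_
      gcongr; norm_num
    · simp only [Fin.mk_one, side, Matrix.cons_val]
      refine b1.trans ?_
      rw [h8, div_mul_eq_mul_div, mul_div_mul_right _ _ (by positivity), mul_div_assoc',
        div_le_div_iff_of_pos_right (by positivity)]
      linarith
    · simp only [Fin.reduceFinMk, side, Matrix.cons_val]
      refine b2.trans (le_of_eq ?_)
      rw [h8, h4]; field_simp; norm_num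
    · simp only [Fin.reduceFinMk, side, Matrix.cons_val]
      refine b3.trans (le_of_eq ?_)
      rw [h8, h4]; field_simp; norm_num

theorem redSlice_bound {s lam : ℝ} (hs : s = 1 ∨ s = -1) (hlam : 0 < lam) (k : ℕ)
    {T : Set (Fin 4 → ℤ)} (hT : TransInv T) :
    (redSlice s lam k T).Finite ∧
      4 ^ k * (redSlice s lam k T).ncard ≤ (box (54 * lam) k ∩ T).ncard := by
  have hmaps : Set.MapsTo (fun x : (Fin 4 → ℤ) × ℕ => sub 1 (x.2 : ℤ) 0 1 x.1)
      (redSlice s lam k T ×ˢ Set.Iio (4 ^ k)) (box (54 * lam) k ∩ T) :=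
    fun x hx => translate_mem_box hs hlam hT hx.1 hx.2
  have hinj : Set.InjOn (fun x : (Fin 4 → ℤ) × ℕ => sub 1 (x.2 : ℤ) 0 1 x.1)
      (redSlice s lam k T ×ˢ Set.Iio (4 ^ k)) := by
    rintro ⟨f, n⟩ ⟨hf, -⟩ ⟨g, m⟩ ⟨hg, -⟩ h
    simp only at hf hg h
    obtain ⟨-, p, q, ξ, η, hr, -⟩ := hf
    obtain ⟨-, p', q', ξ', η', hr', -⟩ := hg
    have h1 := congrArg toR h
    rw [toR_sub, toR_sub, hr.eq, hr'.eq] at h1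
    push_cast at h1
    rw [sub_translate_Phi, sub_translate_Phi] at h1
    obtain ⟨rfl, rfl, hξ, rfl⟩ := Phi_inj hs hr.η_pos hr'.η_pos hr.p_pos.ne' h1
    have hnm : n = m := by
      have h2 : ((n : ℤ) - m : ℝ) < 1 := by push_cast; linarith [hr.ξ_le, hr'.ξ_nonneg]
      have h3 : ((m : ℤ) - n : ℝ) < 1 := by push_cast; linarith [hr'.ξ_le, hr.ξ_nonneg]
      have h4 : (n : ℤ) - m < 1 := by exact_mod_cast h2
      have h5 : (m : ℤ) - n < 1 := by exact_mod_cast h3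
      omega
    subst hnm
    have hξ' : ξ = ξ' := by linarith
    subst hξ'
    have h6 := hr.eq.trans hr'.eq.symm
    have : f = g := funext fun i => by
      have := congrFun h6 i
      simpa using this
    rw [this]
  have hfin := (box_finite (54 * lam) k).inter_of_left T
  have hprod := Set.Finite.of_injOn hmaps hinj hfin
  have hS : (redSlice s lam k T).Finite := by
    refine (hprod.image Prod.fst).subset fun f hf => ⟨(f, 0), ⟨hf, ?_⟩, rfl⟩
    exact Set.mem_Iio.2 (by positivity)
  refine ⟨hS, ?_⟩
  have h1 := Set.ncard_le_ncard_of_injOn _ hmaps hinj hfin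
  rw [Set.ncard_prod] at h1
  have h2 : (Set.Iio (4 ^ k) : Set ℕ).ncard = 4 ^ k := by
    rw [← Finset.coe_Iio, Set.ncard_coe_finset, Nat.card_Iio]
  rwa [h2, mul_comm] at h1

/-- Few reduced forms lie high in the cusp. -/
theorem redSet_bound {s lam : ℝ} (hs : s = 1 ∨ s = -1) (hlam : 0 < lam) (k₀ : ℕ)
    {T : Set (Fin 4 → ℤ)} (hT : TransInv T) {B : ℝ}
    (hB : ∀ k, (8 : ℝ) ^ k ≤ 54 * lam → ((box (54 * lam) k ∩ T).ncard : ℝ) ≤ B) :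
    (redSet s lam (4 ^ k₀ / 2) T).Finite ∧
      ((redSet s lam (4 ^ k₀ / 2) T).ncard : ℝ) ≤ 2 * (max B 0) / 4 ^ k₀ := by
  have hslice : ∀ k, ((redSlice s lam k T).ncard : ℝ) ≤ max B 0 / 4 ^ k := by
    intro k
    by_cases hk : (8 : ℝ) ^ k ≤ 54 * lam
    · rw [le_div_iff₀ (by positivity), mul_comm]
      have := (redSlice_bound hs hlam k hT).2
      have h1 : ((4 : ℝ) ^ k * (redSlice s lam k T).ncard) ≤ (box (54 * lam) k ∩ T).ncard := by
        exact_mod_cast this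
      exact h1.trans ((hB k hk).trans (le_max_left _ _))
    · have : redSlice s lam k T = ∅ := by
        ext f
        simp only [Set.mem_empty_iff_false, iff_false]
        intro hf
        exact hk (one_le_of_box (translate_mem_box hs hlam hT hf (n := 0) (by positivity)).1)
      rw [this]
      simp only [Set.ncard_empty, Nat.cast_zero]
      positivity
  obtain ⟨K, hK⟩ := pow_unbounded_of_one_lt (54 * lam) (show (1 : ℝ) < 8 by norm_num)
  have hcover : redSet s lam (4 ^ k₀ / 2) T ⊆
      ⋃ i ∈ Finset.range K, redSlice s lam (k₀ + i) T := by
    rintro f ⟨hfT, p, q, ξ, η, hr, hη, hd⟩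
    have h2 : 4 ^ k₀ ≤ 2 * η := by linarith
    obtain ⟨k, hk1, hk2⟩ := exists_nat_pow_near (x := 2 * η / 4 ^ k₀) (y := (4 : ℝ))
      ((one_le_div (by positivity)).2 h2) (by norm_num)
    rw [le_div_iff₀ (by positivity), ← pow_add] at hk1
    rw [div_lt_iff₀ (by positivity), ← pow_add] at hk2
    have hf : f ∈ redSlice s lam (k₀ + k) T := by
      refine ⟨hfT, p, q, ξ, η, hr, ?_, ?_, hd⟩
      · rw [add_comm]; linarith
      · have : k₀ + k + 1 = k + 1 + k₀ := by ring
        rw [this]; linarith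
    have h8 := one_le_of_box (translate_mem_box hs hlam hT hf (n := 0) (by positivity)).1
    have hkK : k < K := by
      by_contra hge
      have : (8 : ℝ) ^ K ≤ 8 ^ (k₀ + k) := pow_le_pow_right₀ (by norm_num) (by omega)
      linarith
    simp only [Set.mem_iUnion]
    exact ⟨k, Finset.mem_range.2 hkK, hf⟩
  have hfinU : (⋃ i ∈ Finset.range K, redSlice s lam (k₀ + i) T).Finite :=
    Set.Finite.biUnion (Finset.range K).finite_toSet fun i _ =>
      (redSlice_bound hs hlam (k₀ + i) hT).1
  refine ⟨hfinU.subset hcover, ?_⟩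
  have h1 : (redSet s lam (4 ^ k₀ / 2) T).ncard ≤
      ∑ i ∈ Finset.range K, (redSlice s lam (k₀ + i) T).ncard :=
    (Set.ncard_le_ncard hcover hfinU).trans (Finset.set_ncard_biUnion_le _ _)
  calc ((redSet s lam (4 ^ k₀ / 2) T).ncard : ℝ)
      ≤ ∑ i ∈ Finset.range K, ((redSlice s lam (k₀ + i) T).ncard : ℝ) := by exact_mod_cast h1
    _ ≤ ∑ i ∈ Finset.range K, max B 0 / 4 ^ k₀ * (1 / 4) ^ i := by
        refine Finset.sum_le_sum fun i _ => (hslice _).trans (le_of_eq ?_)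
        rw [pow_add, one_div, inv_pow]; field_simp
    _ = max B 0 / 4 ^ k₀ * ∑ i ∈ Finset.range K, (1 / 4 : ℝ) ^ i := by rw [Finset.mul_sum]
    _ ≤ max B 0 / 4 ^ k₀ * 2 := by
        gcongr
        rw [geom_sum_eq (by norm_num)]
        have : (0 : ℝ) ≤ (1 / 4) ^ K := by positivity
        rw [div_le_iff_of_neg (by norm_num)]; linarith
    _ = _ := by ring

/-- Forms whose Hessian vanishes modulo the prime `p`, that is, forms with a triple root modulo
`p`. -/
def hesZero (p : ℕ) : Set (Fin 4 → ℤ) :=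
  {f | (p : ℤ) ∣ hesP f ∧ (p : ℤ) ∣ hesQ f ∧ (p : ℤ) ∣ hesR f}

/-- Forms whose Hessian vanishes modulo some prime greater than `M`. -/
def hesTail (M : ℕ) : Set (Fin 4 → ℤ) := {f | ∃ p : ℕ, p.Prime ∧ M < p ∧ f ∈ hesZero p}

theorem hesTail_transInv (M : ℕ) : TransInv (hesTail M) := by
  rintro f ⟨p, hp, hM, h1, h2, h3⟩ n
  refine ⟨p, hp, hM, ?_, ?_, ?_⟩
  · rw [hesP_sub]; simpa using h1
  · rw [hesQ_sub]
    obtain ⟨a, ha⟩ := h1; obtain ⟨b, hb⟩ := h2; obtain ⟨c, hc⟩ := h3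
    exact ⟨2 * n * a + b, by rw [ha, hb, hc]; ring⟩
  · rw [hesR_sub]
    obtain ⟨a, ha⟩ := h1; obtain ⟨b, hb⟩ := h2; obtain ⟨c, hc⟩ := h3
    exact ⟨n ^ 2 * a + n * b + c, by rw [ha, hb, hc]; ring⟩

theorem dvd_of_dvd_three_mul {p : ℕ} (hp : p.Prime) (h3 : 3 < p) {a x : ℤ} (ha : ¬ (p : ℤ) ∣ a)
    (h : (p : ℤ) ∣ 3 * a * x) : (p : ℤ) ∣ x := by
  have hpp : Prime (p : ℤ) := Nat.prime_iff_prime_int.1 hp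
  rcases hpp.dvd_or_dvd h with h | h
  · rcases hpp.dvd_or_dvd h with h | h
    · have := Int.le_of_dvd (by norm_num) h
      omega
    · exact absurd h ha
  · exact h

theorem dvd_of_hesP {p : ℕ} (hp : p.Prime) (h3 : 3 < p) {f g : Fin 4 → ℤ}
    (ha : ¬ (p : ℤ) ∣ f 0) (hf : (p : ℤ) ∣ hesP f) (hg : (p : ℤ) ∣ hesP g) (h0 : f 0 = g 0)
    (h1 : f 1 = g 1) : (p : ℤ) ∣ f 2 - g 2 := by
  refine dvd_of_dvd_three_mul hp h3 ha ?_
  have := dvd_sub hg hf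
  simp only [hesP] at this
  rw [← h0, ← h1] at this
  rwa [show 3 * f 0 * (f 2 - g 2) = f 1 ^ 2 - 3 * f 0 * g 2 - (f 1 ^ 2 - 3 * f 0 * f 2) by ring]

theorem dvd_of_hesQ {p : ℕ} (hp : p.Prime) (h3 : 3 < p) {f g : Fin 4 → ℤ}
    (ha : ¬ (p : ℤ) ∣ f 0) (hf : (p : ℤ) ∣ hesQ f) (hg : (p : ℤ) ∣ hesQ g) (h0 : f 0 = g 0)
    (h1 : f 1 = g 1) (h2 : f 2 = g 2) : (p : ℤ) ∣ f 3 - g 3 := by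
  refine dvd_of_dvd_three_mul hp h3 ha (dvd_of_dvd_three_mul hp h3 (a := 1) ?_ ?_)
  · intro h
    have := Int.le_of_dvd (by norm_num) h
    omega
  have := dvd_sub hg hf
  simp only [hesQ] at this
  rw [← h0, ← h1, ← h2] at this
  rwa [show 3 * 1 * (3 * f 0 * (f 3 - g 3)) =
    f 1 * f 2 - 9 * f 0 * g 3 - (f 1 * f 2 - 9 * f 0 * f 3) by ring]

theorem sum_inv_sq_le {M K : ℕ} (hM : 0 < M) :
    ∑ p ∈ Finset.Ioc M K, ((p : ℝ) ^ 2)⁻¹ ≤ 1 / M := by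
  rcases le_total M K with h | h
  · have := sum_Ioc_inv_sq_le_sub (α := ℝ) hM.ne' h
    have h2 : (0 : ℝ) ≤ (K : ℝ)⁻¹ := by positivity
    rw [one_div]; linarith
  · rw [Finset.Ioc_eq_empty_of_le h, Finset.sum_empty]; positivity

section Box

variable {L : ℝ} {k : ℕ}

theorem box_sides (hL : (8 : ℝ) ^ k ≤ L) : ∀ i, 1 ≤ side L k i := by
  obtain ⟨h1, h2, h3, h4, h5⟩ := side_mono hL
  have h6 : (1 : ℝ) ≤ L := le_trans (one_le_pow₀ (by norm_num)) hL
  intro i; fin_cases i <;> simp only [Fin.zero_eta, Fin.mk_one, Fin.reduceFinMk] <;> linarith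

theorem hesZero_small_ncard (hL : (8 : ℝ) ^ k ≤ L) {p : ℕ} (hp : p.Prime) (h3 : 3 < p)
    (hpN : (p : ℝ) ≤ side L k 2) :
    ((box L k ∩ {f | f ∈ hesZero p ∧ ¬ (p : ℤ) ∣ f 0}).ncard : ℝ) ≤ 81 * L ^ 4 * ((p : ℝ) ^ 2)⁻¹ := by
  have hs := box_sides hL
  obtain ⟨-, -, -, -, h23⟩ := side_mono hL
  have hp0 : (0 : ℝ) < p := by exact_mod_cast hp.pos
  have hpos : ∀ i, 0 ≤ side L k i := fun i => zero_le_one.trans (hs i)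
  refine (ncard_le_prod (N := side L k) (p := ![1, 1, p, p]) ?_ hpos (fun f hf => hf.1.2) ?_).trans ?_
  · intro i; fin_cases i <;> simp [hp.pos]
  · rintro f ⟨-, hf, hfa⟩ g ⟨-, hg, -⟩ i hi
    fin_cases i
    · simp
    · simp
    · exact dvd_of_hesP hp h3 hfa hf.1 hg.1 (hi 0 (by decide)) (hi 1 (by decide))
    · exact dvd_of_hesQ hp h3 hfa hf.2.1 hg.2.1 (hi 0 (by decide)) (hi 1 (by decide))
        (hi 2 (by decide))
  · simp only [Matrix.cons_val]
    calc _ ≤ (3 * side L k 0 / (1 : ℕ)) * ((3 * side L k 1 / (1 : ℕ)) *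
        ((3 * side L k 2 / p) * (3 * side L k 3 / p))) := by
          have := hpos 0; have := hpos 1; have := hpos 2; have := hpos 3
          gcongr
          · exact side_bound one_pos (by simpa using hs 0)
          · exact side_bound one_pos (by simpa using hs 1)
          · exact side_bound hp.pos hpN
          · exact side_bound hp.pos (hpN.trans h23)
      _ = 81 * (side L k 0 * (side L k 1 * (side L k 2 * side L k 3))) * ((p : ℝ) ^ 2)⁻¹ := by
          push_cast; field_simp; ring
      _ = _ := by rw [side_prod]

theorem hesZero_dvd_ncard (hL : (8 : ℝ) ^ k ≤ L) {p : ℕ} (hp : p.Prime) (h3 : 3 < p)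
    (hpN : (p : ℝ) ≤ side L k 0) :
    ((box L k ∩ {f | f ∈ hesZero p ∧ (p : ℤ) ∣ f 0}).ncard : ℝ) ≤ 81 * L ^ 4 * ((p : ℝ) ^ 2)⁻¹ := by
  have hs := box_sides hL
  obtain ⟨-, h01, -, -, h23⟩ := side_mono hL
  have hp0 : (0 : ℝ) < p := by exact_mod_cast hp.pos
  have hpp : Prime (p : ℤ) := Nat.prime_iff_prime_int.1 hp
  have hpos : ∀ i, 0 ≤ side L k i := fun i => zero_le_one.trans (hs i)
  have hb : ∀ f ∈ hesZero p, (p : ℤ) ∣ f 0 → (p : ℤ) ∣ f 1 := fun f hf h0 => by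
    have := dvd_add hf.1 (Dvd.dvd.mul_left (Dvd.dvd.mul_right h0 (f 2)) 3)
    refine hpp.dvd_of_dvd_pow (n := 2) ?_
    convert this using 1
    simp only [hesP]; ring
  refine (ncard_le_prod (N := side L k) (p := ![p, p, 1, 1]) ?_ hpos (fun f hf => hf.1.2) ?_).trans ?_
  · intro i; fin_cases i <;> simp [hp.pos]
  · rintro f ⟨-, hf, hfa⟩ g ⟨-, hg, hga⟩ i hi
    fin_cases i
    · exact dvd_sub hfa hga
    · exact dvd_sub (hb f hf hfa) (hb g hg hga)
    · simp
    · simp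
  · simp only [Matrix.cons_val]
    calc _ ≤ (3 * side L k 0 / p) * ((3 * side L k 1 / p) *
        ((3 * side L k 2 / (1 : ℕ)) * (3 * side L k 3 / (1 : ℕ)))) := by
          have := hpos 0; have := hpos 1; have := hpos 2; have := hpos 3
          gcongr
          · exact side_bound hp.pos hpN
          · exact side_bound hp.pos (hpN.trans h01)
          · exact side_bound one_pos (by simpa using hs 2)
          · exact side_bound one_pos (by simpa using hs 3)
      _ = 81 * (side L k 0 * (side L k 1 * (side L k 2 * side L k 3))) * ((p : ℝ) ^ 2)⁻¹ := by
          push_cast; field_simp; ring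
      _ = _ := by rw [side_prod]

theorem side_prod_le (hL : (8 : ℝ) ^ k ≤ L) :
    side L k 0 * side L k 1 * side L k 3 ≤ L ^ 3 := by
  obtain ⟨-, -, -, h, -⟩ := side_mono hL
  have hs := box_sides hL
  have h0 := hs 0; have h1 := hs 1; have h3 := hs 3
  have hL1 : 1 ≤ L := (one_le_pow₀ (by norm_num)).trans hL
  have : side L k 0 * side L k 1 * side L k 3 * L ≤ L ^ 3 * L :=
    calc _ ≤ side L k 0 * side L k 1 * side L k 3 * side L k 2 := by gcongr
      _ = side L k 0 * (side L k 1 * (side L k 2 * side L k 3)) := by ring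
      _ = L ^ 3 * L := by rw [side_prod]; ring
  exact le_of_mul_le_mul_right this (by linarith)

theorem hesP_eq_zero_ncard (hL : (8 : ℝ) ^ k ≤ L) :
    ((box L k ∩ {f | hesP f = 0}).ncard : ℝ) ≤ 54 * L ^ 3 := by
  have hs := box_sides hL
  have hpos : ∀ i, 0 ≤ side L k i := fun i => zero_le_one.trans (hs i)
  obtain ⟨m, hm⟩ := exists_nat_ge (2 * side L k 2)
  have hm0 : 0 < m := by
    have := hs 2
    have : (0 : ℝ) < m := by linarith
    exact_mod_cast this
  refine (ncard_le_prod (N := side L k) (p := ![1, 1, m, 1]) ?_ hpos (fun f hf => hf.1.2) ?_).trans ?_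
  · intro i; fin_cases i <;> simp [hm0]
  · rintro f ⟨⟨hfa, -⟩, hf⟩ g ⟨-, hg⟩ i hi
    fin_cases i
    · simp
    · simp
    · have h0 := hi 0 (by decide)
      have h1 := hi 1 (by decide)
      simp only [Set.mem_setOf_eq, hesP] at hf hg
      rw [← h0, ← h1, ← hf] at hg
      have : f 2 = g 2 := by
        refine mul_left_cancel₀ (mul_ne_zero three_ne_zero hfa.ne') ?_
        linarith
      simp [this]
    · simp
  · simp only [Matrix.cons_val]
    have hm' : 2 * side L k 2 / m + 1 ≤ 2 := by
      have : 2 * side L k 2 / m ≤ 1 := div_le_one_of_le₀ hm (by positivity)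
      linarith
    calc _ ≤ (3 * side L k 0 / (1 : ℕ)) * ((3 * side L k 1 / (1 : ℕ)) *
        (2 * (3 * side L k 3 / (1 : ℕ)))) := by
          have := hpos 0; have := hpos 1; have := hpos 2; have := hpos 3
          gcongr
          · exact side_bound one_pos (by simpa using hs 0)
          · exact side_bound one_pos (by simpa using hs 1)
          · exact side_bound one_pos (by simpa using hs 3)
      _ = 54 * (side L k 0 * side L k 1 * side L k 3) := by push_cast; ring
      _ ≤ _ := by gcongr; exact side_prod_le hL

/-- At most two primes exceeding `L` divide a nonzero integer of size at most `4 * L ^ 2`. -/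
theorem card_large_primeFactors_le {L : ℝ} (hL : 4 < L) {N : ℝ} (hN : L ≤ N) {n : ℕ} (hn : n ≠ 0)
    (h : (n : ℝ) ≤ 4 * L ^ 2) : (n.primeFactors.filter (fun p : ℕ => N < (p : ℝ))).card ≤ 2 := by
  by_contra hlt
  set s := n.primeFactors.filter (fun p : ℕ => N < (p : ℝ)) with hs
  have hdvd : ∏ p ∈ s, p ∣ n :=
    (Finset.prod_dvd_prod_of_subset _ _ _ (Finset.filter_subset _ _)).trans
      (Nat.prod_primeFactors_dvd n)
  have hle : ((∏ p ∈ s, p : ℕ) : ℝ) ≤ n := by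
    exact_mod_cast Nat.le_of_dvd (Nat.pos_of_ne_zero hn) hdvd
  have h1 : L ^ s.card ≤ ((∏ p ∈ s, p : ℕ) : ℝ) := by
    push_cast
    rw [← Finset.prod_const]
    exact Finset.prod_le_prod (fun _ _ => by linarith) fun p hp =>
      hN.trans (Finset.mem_filter.1 hp).2.le
  have h2 : L ^ 3 ≤ L ^ s.card := pow_le_pow_right₀ (by linarith) (by omega)
  nlinarith [sq_nonneg L, pow_pos (show 0 < L by linarith) 2]

theorem hesP_natAbs_le (hL : (8 : ℝ) ^ k ≤ L) {f : Fin 4 → ℤ} (hf : f ∈ box L k) :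
    ((hesP f).natAbs : ℝ) ≤ 4 * L ^ 2 := by
  obtain ⟨h1, h01, h1L, hL2, h23⟩ := side_mono hL
  have hs := box_sides hL
  have h0 := hs 0; have h1' := hs 1; have h2 := hs 2
  have hb := hf.2
  have e1 : side L k 1 * side L k 1 ≤ L ^ 2 := by nlinarith
  have e2 : side L k 0 * side L k 2 ≤ L ^ 2 :=
    calc side L k 0 * side L k 2 ≤ side L k 1 * side L k 2 := by gcongr
      _ = L ^ 2 := by simp only [side, Matrix.cons_val]; field_simp
  rw [Nat.cast_natAbs, hesP]
  push_cast
  calc |(f 1 : ℝ) ^ 2 - 3 * f 0 * f 2| ≤ |(f 1 : ℝ) ^ 2| + |3 * (f 0 : ℝ) * f 2| := abs_sub _ _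
    _ = |(f 1 : ℝ)| * |(f 1 : ℝ)| + 3 * (|(f 0 : ℝ)| * |(f 2 : ℝ)|) := by
        rw [abs_mul, abs_mul, abs_pow, abs_of_pos (show (0 : ℝ) < 3 by norm_num)]; ring
    _ ≤ side L k 1 * side L k 1 + 3 * (side L k 0 * side L k 2) :=
        add_le_add (mul_le_mul (hb 1) (hb 1) (abs_nonneg _) (by linarith))
          (mul_le_mul_of_nonneg_left (mul_le_mul (hb 0) (hb 2) (abs_nonneg _) (by linarith))
            (by norm_num))
    _ ≤ _ := by linarith

theorem card_fiber_prime_le (hL : (8 : ℝ) ^ k ≤ L) {p : ℕ} (hp : p.Prime) (h3 : 3 < p)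
    (hsp : side L k 2 < p) {W : Finset (Fin 4 → ℤ)}
    (hW : ∀ f ∈ W, f ∈ box L k ∧ f ∈ hesZero p ∧ ¬ (p : ℤ) ∣ f 0)
    (hagree : ∀ f ∈ W, ∀ g ∈ W, f 0 = g 0 ∧ f 1 = g 1 ∧ f 2 = g 2) :
    (W.card : ℝ) ≤ 3 * side L k 3 / side L k 2 := by
  obtain ⟨-, -, -, -, h23⟩ := side_mono hL
  have hs := box_sides hL
  have hs2 : 0 < side L k 2 := by linarith [hs 2]
  have hs3 : 0 ≤ side L k 3 := by linarith [hs 3]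
  have hinj : (W.image fun f => f 3).card = W.card := by
    refine Finset.card_image_of_injOn fun f hf g hg h => ?_
    obtain ⟨e0, e1, e2⟩ := hagree f hf g hg
    exact form_ext e0 e1 e2 h
  rw [← hinj]
  refine (card_le_of_congr hp.pos hs3 ?_ ?_).trans ?_
  · intro n hn
    obtain ⟨f, hf, rfl⟩ := Finset.mem_image.1 hn
    exact (hW f hf).1.2 3
  · intro m hm n hn
    obtain ⟨f, hf, rfl⟩ := Finset.mem_image.1 hm
    obtain ⟨g, hg, rfl⟩ := Finset.mem_image.1 hn
    obtain ⟨e0, e1, e2⟩ := hagree f hf g hg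
    exact dvd_of_hesQ hp h3 (hW f hf).2.2 (hW f hf).2.1.2.1 (hW g hg).2.1.2.1 e0 e1 e2
  · have e1 : 2 * side L k 3 / p ≤ 2 * side L k 3 / side L k 2 := by gcongr
    have e2 : 1 ≤ side L k 3 / side L k 2 := (one_le_div hs2).2 h23
    have e3 : 3 * side L k 3 / side L k 2 =
      2 * side L k 3 / side L k 2 + side L k 3 / side L k 2 := by ring
    linarith

theorem card_fiber_le (hL : (8 : ℝ) ^ k ≤ L) (hL4 : 4 < L) {M : ℕ} (hM : 3 ≤ M)
    {V : Finset (Fin 4 → ℤ)}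
    (hV : ∀ f ∈ V, f ∈ box L k ∧ hesP f ≠ 0 ∧ ∃ p : ℕ, p.Prime ∧ M < p ∧ side L k 2 < p ∧
      f ∈ hesZero p ∧ ¬ (p : ℤ) ∣ f 0)
    (hagree : ∀ f ∈ V, ∀ g ∈ V, f 0 = g 0 ∧ f 1 = g 1 ∧ f 2 = g 2) :
    (V.card : ℝ) ≤ 6 * side L k 3 / side L k 2 := by
  classical
  have hs := box_sides hL
  have hs2 : 0 < side L k 2 := by linarith [hs 2]
  have hs3 : 0 ≤ side L k 3 := by linarith [hs 3]
  rcases V.eq_empty_or_nonempty with rfl | ⟨f₀, hf₀⟩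
  · rw [Finset.card_empty, Nat.cast_zero]
    positivity
  obtain ⟨-, -, -, hL2, -⟩ := side_mono hL
  have hQc := card_large_primeFactors_le hL4 hL2
    (Int.natAbs_ne_zero.2 (hV f₀ hf₀).2.1) (hesP_natAbs_le hL (hV f₀ hf₀).1)
  set Q := (hesP f₀).natAbs.primeFactors.filter (fun p : ℕ => side L k 2 < (p : ℝ)) with hQ
  have hcover : V ⊆ Q.biUnion fun p => V.filter fun f => f ∈ hesZero p ∧ ¬ (p : ℤ) ∣ f 0 ∧
      p.Prime ∧ 3 < p := by
    intro f hf
    obtain ⟨-, hne, p, hp, hMp, hsp, hz, hnd⟩ := hV f hf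
    obtain ⟨e0, e1, e2⟩ := hagree f hf f₀ hf₀
    have hPe : hesP f = hesP f₀ := by simp only [hesP, e0, e1, e2]
    refine Finset.mem_biUnion.2 ⟨p, Finset.mem_filter.2 ⟨?_, hsp⟩, Finset.mem_filter.2
      ⟨hf, hz, hnd, hp, by omega⟩⟩
    rw [Nat.mem_primeFactors]
    refine ⟨hp, ?_, by rw [← hPe]; exact Int.natAbs_ne_zero.2 hne⟩
    rw [← hPe, ← Int.natCast_dvd]
    exact hz.1
  have hpiece : ∀ p ∈ Q, ((V.filter fun f => f ∈ hesZero p ∧ ¬ (p : ℤ) ∣ f 0 ∧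
      p.Prime ∧ 3 < p).card : ℝ) ≤ 3 * side L k 3 / side L k 2 := by
    intro p hp
    have hsp : side L k 2 < p := (Finset.mem_filter.1 hp).2
    rcases (V.filter fun f => f ∈ hesZero p ∧ ¬ (p : ℤ) ∣ f 0 ∧
      p.Prime ∧ 3 < p).eq_empty_or_nonempty with he | ⟨g, hg⟩
    · rw [he, Finset.card_empty, Nat.cast_zero]
      positivity
    obtain ⟨-, -, -, hpr, h3⟩ := Finset.mem_filter.1 hg
    refine card_fiber_prime_le hL hpr h3 hsp (fun f hf => ?_) fun f hf g hg =>
      hagree f (Finset.mem_filter.1 hf).1 g (Finset.mem_filter.1 hg).1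
    obtain ⟨hfV, hz, hd, -⟩ := Finset.mem_filter.1 hf
    exact ⟨(hV f hfV).1, hz, hd⟩
  have h1 := (Finset.card_le_card hcover).trans Finset.card_biUnion_le
  calc (V.card : ℝ) ≤ ∑ p ∈ Q, ((V.filter fun f => f ∈ hesZero p ∧ ¬ (p : ℤ) ∣ f 0 ∧
        p.Prime ∧ 3 < p).card : ℝ) := by exact_mod_cast h1
    _ ≤ ∑ p ∈ Q, 3 * side L k 3 / side L k 2 := Finset.sum_le_sum hpiece
    _ = Q.card * (3 * side L k 3 / side L k 2) := by rw [Finset.sum_const, nsmul_eq_mul]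
    _ ≤ 2 * (3 * side L k 3 / side L k 2) := by
        gcongr
        exact_mod_cast hQc
    _ = _ := by ring

/-- The form with the last coefficient erased. -/
def initPart (f : Fin 4 → ℤ) : Fin 4 → ℤ := ![f 0, f 1, f 2, 0]

theorem card_image_init_le (hL : (8 : ℝ) ^ k ≤ L) {S : Finset (Fin 4 → ℤ)}
    (hS : ∀ f ∈ S, f ∈ box L k) : ((S.image initPart).card : ℝ) ≤
      27 * (side L k 0 * side L k 1 * side L k 2) := by
  have hs := box_sides hL
  have h0 := hs 0; have h1 := hs 1; have h2 := hs 2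
  have hpos : ∀ i, 0 ≤ side L k i := fun i => zero_le_one.trans (hs i)
  refine (card_le_prod (N := ![side L k 0, side L k 1, side L k 2, 0]) (p := fun _ => 1)
    (by simp) ?_ ?_ (by simp)).trans ?_
  · intro i; fin_cases i
    exacts [hpos 0, hpos 1, hpos 2, le_rfl]
  · intro f hf i
    obtain ⟨g, hg, rfl⟩ := Finset.mem_image.1 hf
    have := (hS g hg).2
    fin_cases i
    exacts [this 0, this 1, this 2, by simp [initPart]]
  · simp only [Matrix.cons_val]
    calc _ ≤ (3 * side L k 0 / (1 : ℕ)) * ((3 * side L k 1 / (1 : ℕ)) *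
        ((3 * side L k 2 / (1 : ℕ)) * 1)) := by
          gcongr
          · exact side_bound one_pos (by simpa using h0)
          · exact side_bound one_pos (by simpa using h1)
          · exact side_bound one_pos (by simpa using h2)
          · simp
      _ = _ := by push_cast; ring

theorem hesP_ne_zero_ncard (hL : (8 : ℝ) ^ k ≤ L) (hL4 : 4 < L) {M : ℕ} (hM : 3 ≤ M) :
    ((box L k ∩ {f | hesP f ≠ 0 ∧ ∃ p : ℕ, p.Prime ∧ M < p ∧ side L k 2 < p ∧ f ∈ hesZero p ∧
      ¬ (p : ℤ) ∣ f 0}).ncard : ℝ) ≤ 162 * L ^ 3 := by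
  have hs := box_sides hL
  have hs2 : 0 < side L k 2 := by linarith [hs 2]
  have hs3 : 0 ≤ side L k 3 := by linarith [hs 3]
  have hfin := (box_finite L k).inter_of_left {f | hesP f ≠ 0 ∧ ∃ p : ℕ, p.Prime ∧ M < p ∧
    side L k 2 < p ∧ f ∈ hesZero p ∧ ¬ (p : ℤ) ∣ f 0}
  rw [Set.ncard_eq_toFinset_card _ hfin]
  have hmem : ∀ f ∈ hfin.toFinset, f ∈ box L k ∧ hesP f ≠ 0 ∧ ∃ p : ℕ, p.Prime ∧ M < p ∧
      side L k 2 < p ∧ f ∈ hesZero p ∧ ¬ (p : ℤ) ∣ f 0 := fun f hf => hfin.mem_toFinset.1 hf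
  generalize hfin.toFinset = S at hmem
  refine (card_le_mul_of_proj initPart (m := 6 * side L k 3 / side L k 2)
    (by positivity) (card_image_init_le hL fun f hf => (hmem f hf).1) fun v => ?_).trans ?_
  · refine card_fiber_le hL hL4 hM (fun f hf => hmem f (Finset.mem_filter.1 hf).1) ?_
    intro f hf g hg
    have := (Finset.mem_filter.1 hf).2.trans (Finset.mem_filter.1 hg).2.symm
    exact ⟨congrFun this 0, congrFun this 1, congrFun this 2⟩
  · calc _ = 162 * (side L k 0 * side L k 1 * side L k 3) := by field_simp; ring
      _ ≤ _ := by gcongr; exact side_prod_le hL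

/-- Few forms in the box have a triple root modulo a large prime. -/
theorem hesTail_ncard (hL : (8 : ℝ) ^ k ≤ L) (hL4 : 4 < L) {M : ℕ} (hM : 3 ≤ M) :
    ((box L k ∩ hesTail M).ncard : ℝ) ≤ 162 * L ^ 4 / M + 216 * L ^ 3 := by
  classical
  obtain ⟨-, h01, h1L, hL2, -⟩ := side_mono hL
  have hs := box_sides hL
  have hs2 : 0 ≤ side L k 2 := zero_le_one.trans (hs 2)
  set A : ℕ → Set (Fin 4 → ℤ) := fun p =>
    if p.Prime then box L k ∩ {f | f ∈ hesZero p ∧ ¬ (p : ℤ) ∣ f 0} else ∅ with hA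
  set D : ℕ → Set (Fin 4 → ℤ) := fun p =>
    if p.Prime ∧ (p : ℝ) ≤ side L k 0 then box L k ∩ {f | f ∈ hesZero p ∧ (p : ℤ) ∣ f 0}
    else ∅ with hD
  set E := box L k ∩ {f | hesP f ≠ 0 ∧ ∃ p : ℕ, p.Prime ∧ M < p ∧ side L k 2 < p ∧
    f ∈ hesZero p ∧ ¬ (p : ℤ) ∣ f 0} with hE
  set F := box L k ∩ {f | hesP f = 0} with hF
  set I := Finset.Ioc M ⌊side L k 2⌋₊ with hI
  have hcover : box L k ∩ hesTail M ⊆ (⋃ p ∈ I, A p) ∪ (⋃ p ∈ I, D p) ∪ (E ∪ F) := by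
    rintro f ⟨hfb, p, hp, hMp, hz⟩
    by_cases hd : (p : ℤ) ∣ f 0
    · left; right
      have h1 : (p : ℤ) ≤ f 0 := Int.le_of_dvd hfb.1 hd
      have h2 : (p : ℝ) ≤ side L k 0 := by
        have h3 : ((p : ℤ) : ℝ) ≤ f 0 := by exact_mod_cast h1
        push_cast at h3
        exact h3.trans ((le_abs_self _).trans (hfb.2 0))
      refine Set.mem_iUnion₂.2 ⟨p, Finset.mem_Ioc.2 ⟨hMp, Nat.le_floor (by linarith)⟩, ?_⟩
      simp only [hD]
      rw [if_pos ⟨hp, h2⟩]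
      exact ⟨hfb, hz, hd⟩
    · by_cases hsp : (p : ℝ) ≤ side L k 2
      · left; left
        refine Set.mem_iUnion₂.2 ⟨p, Finset.mem_Ioc.2 ⟨hMp, Nat.le_floor hsp⟩, ?_⟩
        simp only [hA]
        rw [if_pos hp]
        exact ⟨hfb, hz, hd⟩
      · right
        by_cases h0 : hesP f = 0
        · exact Or.inr ⟨hfb, h0⟩
        · exact Or.inl ⟨hfb, h0, p, hp, hMp, not_le.1 hsp, hz, hd⟩
  have hAb : ∀ p ∈ I, ((A p).ncard : ℝ) ≤ 81 * L ^ 4 * ((p : ℝ) ^ 2)⁻¹ := by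
    intro p hp
    obtain ⟨h1, h2⟩ := Finset.mem_Ioc.1 hp
    by_cases hpr : p.Prime
    · simp only [hA]
      rw [if_pos hpr]
      exact hesZero_small_ncard hL hpr (by omega) ((Nat.cast_le.2 h2).trans (Nat.floor_le hs2))
    · simp only [hA]
      rw [if_neg hpr]
      simp only [Set.ncard_empty, Nat.cast_zero]
      positivity
  have hDb : ∀ p ∈ I, ((D p).ncard : ℝ) ≤ 81 * L ^ 4 * ((p : ℝ) ^ 2)⁻¹ := by
    intro p hp
    obtain ⟨h1, h2⟩ := Finset.mem_Ioc.1 hp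
    by_cases hpr : p.Prime ∧ (p : ℝ) ≤ side L k 0
    · simp only [hD]
      rw [if_pos hpr]
      exact hesZero_dvd_ncard hL hpr.1 (by omega) hpr.2
    · simp only [hD]
      rw [if_neg hpr]
      simp only [Set.ncard_empty, Nat.cast_zero]
      positivity
  have hfin : ∀ s : Set (Fin 4 → ℤ), s ⊆ box L k → s.Finite := fun s h => (box_finite L k).subset h
  have hAs : ∀ p, A p ⊆ box L k := fun p => by
    simp only [hA]; split_ifs
    exacts [Set.inter_subset_left, Set.empty_subset _]
  have hDs : ∀ p, D p ⊆ box L k := fun p => by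
    simp only [hD]; split_ifs
    exacts [Set.inter_subset_left, Set.empty_subset _]
  have hU : ((⋃ p ∈ I, A p) ∪ (⋃ p ∈ I, D p) ∪ (E ∪ F)).Finite := hfin _
    (Set.union_subset (Set.union_subset (Set.iUnion₂_subset fun p _ => hAs p)
      (Set.iUnion₂_subset fun p _ => hDs p))
      (Set.union_subset Set.inter_subset_left Set.inter_subset_left))
  have hn : (box L k ∩ hesTail M).ncard ≤ ∑ p ∈ I, (A p).ncard + ∑ p ∈ I, (D p).ncard +
      (E.ncard + F.ncard) :=
    (Set.ncard_le_ncard hcover hU).trans ((Set.ncard_union_le _ _).trans (add_le_add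
      ((Set.ncard_union_le _ _).trans (add_le_add (Finset.set_ncard_biUnion_le _ _)
        (Finset.set_ncard_biUnion_le _ _))) (Set.ncard_union_le _ _)))
  have hsum : 81 * L ^ 4 * ∑ p ∈ I, ((p : ℝ) ^ 2)⁻¹ ≤ 81 * L ^ 4 * (1 / M) := by
    gcongr
    exact sum_inv_sq_le (by omega)
  have hE' := hesP_ne_zero_ncard hL hL4 hM
  have hF' := hesP_eq_zero_ncard hL
  calc ((box L k ∩ hesTail M).ncard : ℝ)
      ≤ ∑ p ∈ I, ((A p).ncard : ℝ) + ∑ p ∈ I, ((D p).ncard : ℝ) + (E.ncard + F.ncard) := by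
        exact_mod_cast hn
    _ ≤ ∑ p ∈ I, 81 * L ^ 4 * ((p : ℝ) ^ 2)⁻¹ + ∑ p ∈ I, 81 * L ^ 4 * ((p : ℝ) ^ 2)⁻¹ +
        (162 * L ^ 3 + 54 * L ^ 3) := by
        gcongr with p hp p hp
        · exact hAb p hp
        · exact hDb p hp
    _ = 2 * (81 * L ^ 4 * ∑ p ∈ I, ((p : ℝ) ^ 2)⁻¹) + 216 * L ^ 3 := by
        rw [← Finset.mul_sum]; ring
    _ ≤ 2 * (81 * L ^ 4 * (1 / M)) + 216 * L ^ 3 := by gcongr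
    _ = _ := by ring

end Box

/-- The equivalence classes of the forms in `S`. -/
def classes (S : Set (Fin 4 → ℤ)) : Set (Quot (@FormEquiv 3)) := Quot.mk (@FormEquiv 3) '' S

theorem classes_mono {S T : Set (Fin 4 → ℤ)} (h : S ⊆ T) : classes S ⊆ classes T :=
  Set.image_mono h

theorem classes_subset_of_rep {S R : Set (Fin 4 → ℤ)} (h : ∀ f ∈ S, ∃ g ∈ R, FormEquiv f g) :
    classes S ⊆ classes R := by
  rintro _ ⟨f, hf, rfl⟩
  obtain ⟨g, hg, hfg⟩ := h f hf
  exact ⟨g, hg, (quot_eq_iff.2 hfg).symm⟩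

theorem classes_ncard_le {S R : Set (Fin 4 → ℤ)} (hR : R.Finite)
    (h : ∀ f ∈ S, ∃ g ∈ R, FormEquiv f g) :
    (classes S).Finite ∧ (classes S).ncard ≤ R.ncard := by
  have hsub := classes_subset_of_rep h
  have hfin : (classes R).Finite := hR.image _
  exact ⟨hfin.subset hsub, (Set.ncard_le_ncard hsub hfin).trans (Set.ncard_image_le hR)⟩

theorem redSet_univ_bound {s lam : ℝ} (hs : s = 1 ∨ s = -1) (hlam : 0 < lam) (k₀ : ℕ) :
    (redSet s lam (4 ^ k₀ / 2) Set.univ).Finite ∧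
      ((redSet s lam (4 ^ k₀ / 2) Set.univ).ncard : ℝ) ≤ 162 * (54 * lam) ^ 4 / 4 ^ k₀ := by
  obtain ⟨h1, h2⟩ := redSet_bound hs hlam k₀ (T := Set.univ) (fun _ _ _ => trivial)
    (fun k _ => box_ncard_le (L := 54 * lam) (k := k) Set.univ)
  refine ⟨h1, h2.trans (le_of_eq ?_)⟩
  rw [max_eq_left (by positivity)]
  ring

theorem redSet_hesTail_bound {s lam : ℝ} (hs : s = 1 ∨ s = -1) (hlam : 1 ≤ lam) {M : ℕ}
    (hM : 3 ≤ M) : (redSet s lam (1 / 2) (hesTail M)).Finite ∧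
      ((redSet s lam (1 / 2) (hesTail M)).ncard : ℝ) ≤
        2 * (162 * (54 * lam) ^ 4 / M + 216 * (54 * lam) ^ 3) := by
  obtain ⟨h1, h2⟩ := redSet_bound hs (zero_lt_one.trans_le hlam) 0 (hesTail_transInv M)
    (fun k hk => hesTail_ncard hk (by linarith) hM)
  rw [pow_zero] at h1 h2
  refine ⟨h1, h2.trans (le_of_eq ?_)⟩
  rw [max_eq_left (by positivity), div_one]

theorem IsRed.half_le {s p q ξ η : ℝ} {f : Fin 4 → ℝ} (h : IsRed s f p q ξ η) : 1 / 2 ≤ η := by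
  nlinarith [h.norm_ge, h.ξ_nonneg, h.ξ_le, h.η_pos]

theorem exists_mem_redSet {s lam : ℝ} (hs : s = 1 ∨ s = -1) {f : Fin 4 → ℤ} (hf : Irr f)
    (hD : s * ((cdisc f : ℤ) : ℝ) < 0) (hX : -s * ((cdisc f : ℤ) : ℝ) < lam ^ 4)
    {T : Set (Fin 4 → ℤ)} (hT : ∀ g, FormEquiv f g → g ∈ T) :
    ∃ g ∈ redSet s lam (1 / 2) T, FormEquiv f g := by
  obtain ⟨g, hfg, p, q, ξ, η, hr⟩ := exists_reduced hs hf hD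
  exact ⟨g, ⟨hT g hfg, p, q, ξ, η, hr, hr.half_le, by rwa [cdisc_eq_of_equiv hfg]⟩, hfg⟩

/-- Irreducible forms with discriminant of sign `-s` and absolute value less than `X`. -/
def irrSet (s X : ℝ) : Set (Fin 4 → ℤ) :=
  {f | Irr f ∧ s * ((cdisc f : ℤ) : ℝ) < 0 ∧ -s * ((cdisc f : ℤ) : ℝ) < X}

theorem irrSet_classes_bound {s X : ℝ} (hs : s = 1 ∨ s = -1) (hX : 0 < X) :
    (classes (irrSet s X)).Finite ∧ ((classes (irrSet s X)).ncard : ℝ) ≤ 162 * 54 ^ 4 * X := by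
  obtain ⟨lam, hlam, hlX⟩ : ∃ lam : ℝ, 0 < lam ∧ lam ^ 4 = X :=
    ⟨X ^ ((4 : ℝ)⁻¹), by positivity, by
      rw [← Real.rpow_natCast, ← Real.rpow_mul hX.le]; norm_num⟩
  obtain ⟨h1, h2⟩ := redSet_univ_bound hs hlam 0
  rw [pow_zero] at h1 h2
  obtain ⟨h3, h4⟩ := classes_ncard_le (S := irrSet s X) h1 fun f hf => exists_mem_redSet hs hf.1 hf.2.1
    (by rw [hlX]; exact hf.2.2) fun _ _ => trivial
  refine ⟨h3, le_trans (by exact_mod_cast h4) (h2.trans (le_of_eq ?_))⟩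
  rw [← hlX]; ring

theorem hesTail_classes_bound {s X : ℝ} (hs : s = 1 ∨ s = -1) (hX : 1 ≤ X) {M : ℕ} (hM : 3 ≤ M) :
    ((classes (irrSet s X ∩ hesTail M)).ncard : ℝ) ≤
      2 * (162 * 54 ^ 4 * X / M + 216 * 54 ^ 3 * X ^ ((3 : ℝ) / 4)) := by
  have hX0 : 0 < X := by linarith
  have hlam : 1 ≤ X ^ ((4 : ℝ)⁻¹) := Real.one_le_rpow hX (by norm_num)
  have e4 : (X ^ ((4 : ℝ)⁻¹)) ^ 4 = X := by
    rw [← Real.rpow_natCast, ← Real.rpow_mul hX0.le]; norm_num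
  have e3 : (X ^ ((4 : ℝ)⁻¹)) ^ 3 = X ^ ((3 : ℝ) / 4) := by
    rw [← Real.rpow_natCast, ← Real.rpow_mul hX0.le]; norm_num
  have hinv : ∀ f ∈ hesTail M, ∀ g, FormEquiv f g → g ∈ hesTail M := by
    intro f hf g hg
    obtain ⟨a, b, c, d, -, rfl⟩ := formEquiv_iff.1 hg
    obtain ⟨p, hp, hMp, ⟨u, hu⟩, ⟨v, hv⟩, ⟨w, hw⟩⟩ := hf
    refine ⟨p, hp, hMp, ?_, ?_, ?_⟩
    · rw [hesP_sub, hu, hv, hw]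
      exact Dvd.intro ((a * d - b * c) ^ 2 * (u * a ^ 2 + v * a * c + w * c ^ 2)) (by ring)
    · rw [hesQ_sub, hu, hv, hw]
      exact Dvd.intro ((a * d - b * c) ^ 2 * (2 * u * a * b + v * (a * d + b * c) + 2 * w * c * d))
        (by ring)
    · rw [hesR_sub, hu, hv, hw]
      exact Dvd.intro ((a * d - b * c) ^ 2 * (u * b ^ 2 + v * b * d + w * d ^ 2)) (by ring)
  obtain ⟨h1, h2⟩ := redSet_hesTail_bound hs hlam hM
  obtain ⟨h3, h4⟩ := classes_ncard_le (S := irrSet s X ∩ hesTail M) h1 fun f hf =>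
    exists_mem_redSet hs hf.1.1 hf.1.2.1 (by rw [e4]; exact hf.1.2.2) (T := hesTail M)
      (hinv f hf.2)
  refine le_trans (by exact_mod_cast h4) (h2.trans (le_of_eq ?_))
  rw [mul_pow, mul_pow, e4, e3]; ring

/-- `p * F(x, y) = G(x, p * y)`, with the second coefficient of `F` prime to `p`. -/
structure IsOverform (p : ℕ) (F G : Fin 4 → ℤ) : Prop where
  zero : G 0 = p * F 0
  one : G 1 = F 1
  two : F 2 = p * G 2
  three : F 3 = p ^ 2 * G 3
  not_dvd : ¬ (p : ℤ) ∣ G 1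

/-- Forms whose discriminant is divisible by `p ^ 2` but which have no triple root modulo `p`. -/
def weakSet (p : ℕ) : Set (Fin 4 → ℤ) := {f | (p : ℤ) ^ 2 ∣ cdisc f ∧ f ∉ hesZero p}

theorem formEquiv_sub {f : Fin 4 → ℤ} {a b c d : ℤ} (h : |a * d - b * c| = 1) :
    FormEquiv f (sub a b c d f) := formEquiv_iff.2 ⟨a, b, c, d, h, rfl⟩

theorem exists_overform_of_not_dvd {p : ℕ} (hp : p.Prime) (h3 : 3 < p) {f : Fin 4 → ℤ}
    (hd : (p : ℤ) ^ 2 ∣ cdisc f) (hP : ¬ (p : ℤ) ∣ hesP f) :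
    ∃ F G, FormEquiv f F ∧ IsOverform p F G := by
  have hpp : Prime (p : ℤ) := Nat.prime_iff_prime_int.1 hp
  have hcop : ∀ x : ℤ, ¬ (p : ℤ) ∣ x → IsCoprime ((p : ℤ) ^ 2) x := fun x hx =>
    ((Prime.coprime_iff_not_dvd hpp).2 hx).pow_left
  have h2 : ¬ (p : ℤ) ∣ 2 := fun h => by have := Int.le_of_dvd (by norm_num) h; omega
  have h3' : ¬ (p : ℤ) ∣ 3 := fun h => by have := Int.le_of_dvd (by norm_num) h; omega
  have h2P : IsCoprime ((p : ℤ) ^ 2) (2 * hesP f) :=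
    hcop _ fun h => (hpp.dvd_or_dvd h).elim h2 hP
  obtain ⟨u, v, huv⟩ := h2P
  set r : ℤ := -(v * hesQ f) with hr
  set F := sub 1 r 0 1 f with hF
  have hPF : hesP F = hesP f := by rw [hF, hesP_sub]; ring
  have hQF : (p : ℤ) ^ 2 ∣ hesQ F := by
    refine ⟨u * hesQ f, ?_⟩
    rw [hF, hesQ_sub, hr]
    linear_combination (-hesQ f) * huv
  have hdF : (p : ℤ) ^ 2 ∣ cdisc F := by rw [hF, cdisc_sub]; exact Dvd.dvd.mul_left hd _
  have hPF' : ¬ (p : ℤ) ∣ hesP F := by rwa [hPF]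
  have hRF : (p : ℤ) ^ 2 ∣ hesR F := by
    have h4 : IsCoprime ((p : ℤ) ^ 2) (2 * 2 * hesP F) := hcop _ fun h =>
      (hpp.dvd_or_dvd h).elim (fun h => (hpp.dvd_or_dvd h).elim h2 h2) hPF'
    refine h4.dvd_of_dvd_mul_left ?_
    have e : 2 * 2 * hesP F * hesR F = hesQ F * hesQ F + 3 * cdisc F := by
      linear_combination hes_disc F
    rw [e]
    exact dvd_add (Dvd.dvd.mul_left hQF _) (Dvd.dvd.mul_left hdF _)
  have hC : (p : ℤ) ^ 2 ∣ F 2 := by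
    refine (hcop _ hPF').dvd_of_dvd_mul_left ?_
    have e : hesP F * F 2 = F 1 * hesQ F - 3 * F 0 * hesR F := by
      simp only [hesP, hesQ, hesR]; ring
    rw [e]
    exact dvd_sub (Dvd.dvd.mul_left hQF _) (Dvd.dvd.mul_left hRF _)
  have hD : (p : ℤ) ^ 2 ∣ F 3 := by
    refine (hcop (3 * hesP F) fun h => (hpp.dvd_or_dvd h).elim h3' hPF').dvd_of_dvd_mul_left ?_
    have e : 3 * hesP F * F 3 = F 2 * hesQ F - F 1 * hesR F := by
      simp only [hesP, hesQ, hesR]; ring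
    rw [e]
    exact dvd_sub (Dvd.dvd.mul_left hQF _) (Dvd.dvd.mul_left hRF _)
  obtain ⟨c, hc⟩ := hC
  obtain ⟨d, hd'⟩ := hD
  refine ⟨F, ![p * F 0, F 1, p * c, d], formEquiv_sub (by norm_num),
    rfl, rfl, by simp [hc]; ring, by simpa using hd', fun h => hPF' ?_⟩
  have h : (p : ℤ) ∣ F 1 := h
  rw [hesP, hc]
  exact dvd_sub (Dvd.dvd.pow h two_ne_zero)
    ⟨3 * F 0 * (p * c), by ring⟩

theorem exists_overform {p : ℕ} (hp : p.Prime) (h3 : 3 < p) {f : Fin 4 → ℤ} (hf : f ∈ weakSet p) :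
    ∃ F G, FormEquiv f F ∧ IsOverform p F G := by
  have hpp : Prime (p : ℤ) := Nat.prime_iff_prime_int.1 hp
  obtain ⟨hd, hz⟩ := hf
  by_cases hP : (p : ℤ) ∣ hesP f
  · have hQ : (p : ℤ) ∣ hesQ f := by
      refine hpp.dvd_of_dvd_pow (n := 2) ?_
      have e : hesQ f ^ 2 = 4 * hesP f * hesR f - 3 * cdisc f := by
        linear_combination -hes_disc f
      rw [e]
      exact dvd_sub (Dvd.dvd.mul_right (Dvd.dvd.mul_left hP _) _)
        (Dvd.dvd.mul_left ((dvd_pow_self _ two_ne_zero).trans hd) _)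
    have hR : ¬ (p : ℤ) ∣ hesR f := fun h => hz ⟨hP, hQ, h⟩
    obtain ⟨F, G, h1, h2⟩ := exists_overform_of_not_dvd hp h3 (f := sub 0 1 1 0 f)
      (by rw [cdisc_sub]; exact Dvd.dvd.mul_left hd _) (by rw [hesP_sub]; simpa using hR)
    exact ⟨F, G, formEquiv_trans (formEquiv_sub (by norm_num)) h1, h2⟩
  · exact exists_overform_of_not_dvd hp h3 hd hP

theorem IsOverform.cdisc_eq {p : ℕ} {F G : Fin 4 → ℤ} (h : IsOverform p F G) :
    cdisc F = p ^ 2 * cdisc G := by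
  simp only [cdisc, h.zero, h.one, h.two, h.three]; ring

theorem IsOverform.irr {p : ℕ} (hp : 0 < p) {F G : Fin 4 → ℤ} (h : IsOverform p F G) (hF : Irr F) :
    Irr G := by
  intro x y hxy
  have hp' : (p : ℤ) ≠ 0 := by exact_mod_cast hp.ne'
  have := hF (p * x) y (by
    rw [binEval_three] at hxy ⊢
    rw [h.zero, h.one] at hxy
    rw [h.two, h.three]
    linear_combination (p : ℤ) ^ 2 * hxy)
  exact ⟨(mul_eq_zero.1 this.1).resolve_left hp', this.2⟩

theorem IsOverform.equiv_of_sub {p : ℕ} (hp : 0 < p) {F G F' G' : Fin 4 → ℤ}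
    (h : IsOverform p F G) (h' : IsOverform p F' G') {u v w z : ℤ} (hw : (p : ℤ) ∣ w)
    (hdet : |u * z - v * w| = 1) (hG : G' = sub u v w z G) : FormEquiv F F' := by
  have hp' : (p : ℤ) ≠ 0 := by exact_mod_cast hp.ne'
  obtain ⟨w, rfl⟩ := hw
  refine formEquiv_iff.2 ⟨u, p * v, w, z, by rw [← hdet]; ring_nf, ?_⟩
  have e0 := congrFun hG 0
  have e1 := congrFun hG 1
  have e2 := congrFun hG 2
  have e3 := congrFun hG 3
  simp only [sub_zero_apply, sub_one_apply, sub_two_apply, sub_three_apply] at e0 e1 e2 e3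
  rw [h'.zero, h.zero, h.one] at e0
  rw [h'.one, h.zero, h.one] at e1
  rw [h.zero, h.one] at e2 e3
  apply form_ext
  · rw [sub_zero_apply, h.two, h.three]
    exact mul_left_cancel₀ hp' (by linear_combination e0)
  · rw [sub_one_apply, h.two, h.three]
    linear_combination e1
  · rw [sub_two_apply, h'.two, h.two, h.three]
    linear_combination (p : ℤ) * e2
  · rw [sub_three_apply, h'.three, h.two, h.three]
    linear_combination (p : ℤ) ^ 2 * e3

/-- The residues modulo `p` of the first column of a matrix, as a point of the projective line. -/
noncomputable def projPoint (p : ℕ) [Fact p.Prime] (a c : ℤ) : Option (ZMod p) :=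
  if (c : ZMod p) = 0 then none else some ((a : ZMod p) / c)

theorem dvd_of_projPoint_eq {p : ℕ} [Fact p.Prime] {a c a' c' : ℤ}
    (h : projPoint p a c = projPoint p a' c') : (p : ℤ) ∣ a * c' - a' * c := by
  rw [← ZMod.intCast_zmod_eq_zero_iff_dvd]
  push_cast
  unfold projPoint at h
  split_ifs at h with h1 h2 h2
  · rw [h1, h2]; ring
  · have := Option.some_injective _ h
    rw [div_eq_div_iff h1 h2] at this
    rw [this, sub_self]

open Polynomial in
theorem card_roots_le {p : ℕ} [Fact p.Prime] {g : Fin 4 → ℤ} (hg : ¬ (p : ℤ) ∣ g 1) :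
    ∃ R : Finset (ZMod p), R.card ≤ 3 ∧ ∀ x : ZMod p,
      (g 0 : ZMod p) * x ^ 3 + g 1 * x ^ 2 + g 2 * x + g 3 = 0 → x ∈ R := by
  classical
  set P : Cubic (ZMod p) := ⟨g 0, g 1, g 2, g 3⟩ with hP
  have hP0 : P.toPoly ≠ 0 := fun h0 => hg <| by
    rw [← ZMod.intCast_zmod_eq_zero_iff_dvd]
    have := congrArg (fun q => q.coeff 2) h0
    simpa only [Cubic.coeff_eq_b, coeff_zero] using this
  refine ⟨P.toPoly.roots.toFinset, ?_, fun x hx => ?_⟩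
  · exact (Multiset.toFinset_card_le _).trans ((card_roots' _).trans natDegree_cubic_le)
  · rw [Multiset.mem_toFinset, mem_roots hP0, IsRoot.def, hP]
    simpa [Cubic.toPoly] using hx

theorem IsOverform.sub_inv {g G : Fin 4 → ℤ} {a b c d : ℤ} (hdet : |a * d - b * c| = 1)
    (hG : G = sub a b c d g) :
    g = sub ((a * d - b * c) * d) (-((a * d - b * c) * b)) (-((a * d - b * c) * c))
      ((a * d - b * c) * a) G := by
  have h1 : (a * d - b * c) * (a * d - b * c) = 1 := by
    rcases (abs_eq zero_le_one).1 hdet with h | h <;> rw [h] <;> norm_num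
  rw [hG, sub_sub]
  have e1 : a * ((a * d - b * c) * d) + b * -((a * d - b * c) * c) = 1 := by linear_combination h1
  have e2 : a * -((a * d - b * c) * b) + b * ((a * d - b * c) * a) = 0 := by ring
  have e3 : c * ((a * d - b * c) * d) + d * -((a * d - b * c) * c) = 0 := by ring
  have e4 : c * -((a * d - b * c) * b) + d * ((a * d - b * c) * a) = 1 := by linear_combination h1
  rw [e1, e2, e3, e4, sub_id]

theorem IsOverform.equiv_of_projPoint {p : ℕ} [Fact p.Prime] {F G F' G' g : Fin 4 → ℤ}
    (h : IsOverform p F G) (h' : IsOverform p F' G') {a b c d a' b' c' d' : ℤ}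
    (hdet : |a * d - b * c| = 1) (hdet' : |a' * d' - b' * c'| = 1) (hG : G = sub a b c d g)
    (hG' : G' = sub a' b' c' d' g) (hpt : projPoint p a c = projPoint p a' c') :
    FormEquiv F F' := by
  have hg := IsOverform.sub_inv hdet hG
  rw [hg, sub_sub] at hG'
  refine h.equiv_of_sub (Fact.out : p.Prime).pos h' ?_ ?_ hG'
  · have := Dvd.dvd.mul_left (dvd_of_projPoint_eq hpt) (a * d - b * c)
    rwa [show (a * d - b * c) * (a * c' - a' * c) = -((a * d - b * c) * c) * a' +
      (a * d - b * c) * a * c' by ring] at this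
  · have e : ((a * d - b * c) * d * a' + -((a * d - b * c) * b) * c') *
        (-((a * d - b * c) * c) * b' + (a * d - b * c) * a * d') -
        ((a * d - b * c) * d * b' + -((a * d - b * c) * b) * d') *
        (-((a * d - b * c) * c) * a' + (a * d - b * c) * a * c') =
        (a * d - b * c) ^ 3 * (a' * d' - b' * c') := by ring
    rw [e, abs_mul, abs_pow, hdet, hdet']; norm_num

theorem projPoint_mem {p : ℕ} [Fact p.Prime] {F G g : Fin 4 → ℤ} (h : IsOverform p F G)
    {a b c d : ℤ} (hG : G = sub a b c d g) {R : Finset (ZMod p)} (hR : ∀ x : ZMod p,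
      (g 0 : ZMod p) * x ^ 3 + g 1 * x ^ 2 + g 2 * x + g 3 = 0 → x ∈ R) :
    projPoint p a c ∈ Finset.insertNone R := by
  unfold projPoint
  split_ifs with hc
  · exact Finset.none_mem_insertNone
  · rw [Finset.some_mem_insertNone]
    apply hR
    have e := congrFun hG 0
    rw [h.zero, sub_zero_apply] at e
    have e' := congrArg (fun n : ℤ => (n : ZMod p)) e
    push_cast at e'
    rw [CharP.cast_eq_zero, zero_mul] at e'
    field_simp
    linear_combination -e'

theorem weakSet_overform {s X : ℝ} {p : ℕ} (hp : p.Prime) (h3 : 3 < p) {φ : Quot (@FormEquiv 3)}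
    (hφ : φ ∈ classes (irrSet s X ∩ weakSet p)) :
    ∃ F G, Quot.mk _ F = φ ∧ IsOverform p F G ∧ G ∈ irrSet s (X / (p : ℝ) ^ 2) := by
  obtain ⟨f, ⟨⟨hirr, h1, h2⟩, hw⟩, rfl⟩ := hφ
  obtain ⟨F, G, hfF, hFG⟩ := exists_overform hp h3 hw
  have hp0 : (0 : ℝ) < (p : ℝ) ^ 2 := by have := hp.pos; positivity
  have hd : ((cdisc f : ℤ) : ℝ) = (p : ℝ) ^ 2 * ((cdisc G : ℤ) : ℝ) := by
    rw [← cdisc_eq_of_equiv hfF, hFG.cdisc_eq]; push_cast; rfl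
  refine ⟨F, G, (quot_eq_iff.2 hfF).symm, hFG, hFG.irr hp.pos (hirr.of_equiv hfF), ?_, ?_⟩
  · rw [hd] at h1
    by_contra! h
    nlinarith [mul_nonneg hp0.le h]
  · rw [lt_div_iff₀ hp0]
    rw [hd] at h2
    linarith

theorem weakSet_classes_bound {s X : ℝ} (hs : s = 1 ∨ s = -1) (hX : 0 < X) {p : ℕ} (hp : p.Prime)
    (h3 : 3 < p) : ((classes (irrSet s X ∩ weakSet p)).ncard : ℝ) ≤
      4 * (162 * 54 ^ 4 * X) * ((p : ℝ) ^ 2)⁻¹ := by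
  classical
  have : Fact p.Prime := ⟨hp⟩
  have hp0 : (0 : ℝ) < (p : ℝ) ^ 2 := by have := hp.pos; positivity
  have hfin : (classes (irrSet s X ∩ weakSet p)).Finite :=
    (irrSet_classes_bound hs hX).1.subset (classes_mono Set.inter_subset_left)
  obtain ⟨hGfin, hGle⟩ := irrSet_classes_bound hs (div_pos hX hp0)
  have hex := fun (φ : Quot (@FormEquiv 3)) (hφ : φ ∈ hfin.toFinset) =>
    weakSet_overform hp h3 (hfin.mem_toFinset.1 hφ)
  choose! F G hF hFG hG using hex
  rw [Set.ncard_eq_toFinset_card _ hfin]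
  have key := card_le_mul_of_proj (S := hfin.toFinset) (m := 4)
    (n := 162 * 54 ^ 4 * (X / (p : ℝ) ^ 2))
    (fun φ => (Quot.mk (@FormEquiv 3) (G φ))) (by norm_num) ?_ ?_
  · refine key.trans (le_of_eq ?_)
    field_simp
  · refine le_trans ?_ hGle
    rw [← Set.ncard_coe_finset]
    refine Nat.cast_le.2 (Set.ncard_le_ncard (fun ψ hψ => ?_) hGfin)
    obtain ⟨φ, hφ, rfl⟩ := Finset.mem_image.1 (Finset.mem_coe.1 hψ)
    exact ⟨_, hG φ hφ, rfl⟩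
  · intro ψ
    rcases Finset.eq_empty_or_nonempty
      (hfin.toFinset.filter fun φ => Quot.mk (@FormEquiv 3) (G φ) = ψ) with h0 | ⟨φ₀, h0⟩
    · rw [h0]; norm_num
    rw [Finset.mem_filter] at h0
    have hmat : ∀ φ ∈ hfin.toFinset.filter (fun φ => Quot.mk (@FormEquiv 3) (G φ) = ψ),
        ∃ a b c d : ℤ, |a * d - b * c| = 1 ∧ G φ = sub a b c d (G φ₀) := fun φ hφ => by
      rw [Finset.mem_filter] at hφ
      exact formEquiv_iff.1 (quot_eq_iff.1 (h0.2.trans hφ.2.symm))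
    choose! a b c d hdet hsub using hmat
    obtain ⟨R, hR, hR'⟩ := card_roots_le (p := p) (hFG φ₀ h0.1).not_dvd
    have hcard : (Finset.insertNone R).card ≤ 4 := by rw [Finset.card_insertNone]; omega
    refine le_trans (Nat.cast_le.2 (Finset.card_le_card_of_injOn
      (fun φ => projPoint p (a φ) (c φ)) (fun φ hφ => ?_) fun φ hφ φ' hφ' h => ?_))
      (by exact_mod_cast hcard : ((Finset.insertNone R).card : ℝ) ≤ 4)
    · exact projPoint_mem (hFG φ (Finset.mem_filter.1 hφ).1) (hsub φ hφ) hR'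
    · have h1 := (Finset.mem_filter.1 hφ).1
      have h2 := (Finset.mem_filter.1 hφ').1
      rw [← hF φ h1, ← hF φ' h2]
      exact quot_eq_iff.2 ((hFG φ h1).equiv_of_projPoint (hFG φ' h2) (hdet φ hφ) (hdet φ' hφ')
        (hsub φ hφ) (hsub φ' hφ') h)

/-- Forms whose discriminant is divisible by the square of a prime exceeding `M`. -/
def sqTail (M : ℕ) : Set (Fin 4 → ℤ) := {f | ∃ p : ℕ, p.Prime ∧ M < p ∧ (p : ℤ) ^ 2 ∣ cdisc f}

theorem irrSet_inter_sqTail_subset {s X : ℝ} (hs : s = 1 ∨ s = -1) (M : ℕ) :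
    irrSet s X ∩ sqTail M ⊆ (irrSet s X ∩ hesTail M) ∪
      ⋃ p ∈ (Finset.Ioc M ⌊X⌋₊).filter Nat.Prime, irrSet s X ∩ weakSet p := by
  rintro f ⟨hf, p, hp, hMp, hpd⟩
  by_cases hz : f ∈ hesZero p
  · exact Or.inl ⟨hf, p, hp, hMp, hz⟩
  · refine Or.inr (Set.mem_biUnion (x := p) ?_ ⟨hf, hpd, hz⟩)
    rw [Finset.coe_filter, Set.mem_ofPred_eq, Finset.mem_Ioc]
    refine ⟨⟨hMp, Nat.le_floor ?_⟩, hp⟩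
    obtain ⟨-, h1, h2⟩ := hf
    have h0 : cdisc f ≠ 0 := by rintro h; rw [h] at h1; simp at h1
    have h4 := Int.le_of_dvd (abs_pos.2 h0) ((dvd_abs _ _).2 hpd)
    have h5 : ((p : ℝ)) ^ 2 ≤ |((cdisc f : ℤ) : ℝ)| := by exact_mod_cast h4
    have h6 : |((cdisc f : ℤ) : ℝ)| < X := by
      rcases hs with rfl | rfl
      · rw [abs_of_neg (by linarith)]; linarith
      · rw [abs_of_pos (by linarith)]; linarith
    have h7 : (1 : ℝ) ≤ p := by exact_mod_cast hp.one_lt.le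
    nlinarith

theorem sqTail_classes_bound {s X : ℝ} (hs : s = 1 ∨ s = -1) (hX : 1 ≤ X) {M : ℕ} (hM : 3 ≤ M) :
    ((classes (irrSet s X ∩ sqTail M)).ncard : ℝ) ≤
      6 * (162 * 54 ^ 4) * X / M + 432 * 54 ^ 3 * X ^ ((3 : ℝ) / 4) := by
  classical
  have hX0 : 0 < X := by linarith
  have hfin := (irrSet_classes_bound hs hX0).1
  set P := (Finset.Ioc M ⌊X⌋₊).filter Nat.Prime with hP
  have hsub : classes (irrSet s X ∩ sqTail M) ⊆ classes (irrSet s X ∩ hesTail M) ∪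
      ⋃ p ∈ P, classes (irrSet s X ∩ weakSet p) := by
    refine (classes_mono (irrSet_inter_sqTail_subset hs M)).trans ?_
    rw [classes, Set.image_union, Set.image_iUnion₂]
    rfl
  have hfin' : (classes (irrSet s X ∩ hesTail M) ∪
      ⋃ p ∈ P, classes (irrSet s X ∩ weakSet p)).Finite :=
    hfin.subset (Set.union_subset (classes_mono Set.inter_subset_left)
      (Set.iUnion₂_subset fun p _ => classes_mono Set.inter_subset_left))
  have h1 : (classes (irrSet s X ∩ sqTail M)).ncard ≤ (classes (irrSet s X ∩ hesTail M)).ncard +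
      ∑ p ∈ P, (classes (irrSet s X ∩ weakSet p)).ncard :=
    (Set.ncard_le_ncard hsub hfin').trans ((Set.ncard_union_le _ _).trans
      (Nat.add_le_add_left (Finset.set_ncard_biUnion_le _ _) _))
  have h2 : ∑ p ∈ P, ((classes (irrSet s X ∩ weakSet p)).ncard : ℝ) ≤
      4 * (162 * 54 ^ 4 * X) * (1 / M) := by
    calc _ ≤ ∑ p ∈ P, 4 * (162 * 54 ^ 4 * X) * ((p : ℝ) ^ 2)⁻¹ :=
          Finset.sum_le_sum fun p hp => by
            rw [hP, Finset.mem_filter, Finset.mem_Ioc] at hp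
            exact weakSet_classes_bound hs hX0 hp.2 (by omega)
      _ ≤ ∑ p ∈ Finset.Ioc M ⌊X⌋₊, 4 * (162 * 54 ^ 4 * X) * ((p : ℝ) ^ 2)⁻¹ :=
          Finset.sum_le_sum_of_subset_of_nonneg (Finset.filter_subset _ _)
            fun p _ _ => by positivity
      _ ≤ _ := by
          rw [← Finset.mul_sum]
          exact mul_le_mul_of_nonneg_left (sum_inv_sq_le (by omega)) (by positivity)
  have h3 := hesTail_classes_bound hs hX hM
  have h4 : ((classes (irrSet s X ∩ sqTail M)).ncard : ℝ) ≤
      (classes (irrSet s X ∩ hesTail M)).ncard +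
      ∑ p ∈ P, ((classes (irrSet s X ∩ weakSet p)).ncard : ℝ) := by exact_mod_cast h1
  refine h4.trans ((add_le_add h3 h2).trans (le_of_eq ?_))
  ring

open MeasureTheory Filter Topology

/-- Integral forms which, after dividing the coefficients by `lam`, lie in `B`. -/
def lat (lam : ℝ) (B : Set (Fin 4 → ℝ)) : Set (Fin 4 → ℤ) := {f | lam⁻¹ • toR f ∈ B}

theorem volume_floor_preimage (K : Finset (Fin 4 → ℤ)) :
    volume {t : Fin 4 → ℝ | (fun i => ⌊t i⌋) ∈ K} = K.card := by
  have h : {t : Fin 4 → ℝ | (fun i => ⌊t i⌋) ∈ K} =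
      ⋃ k ∈ K, Set.univ.pi fun i => Set.Ico (k i : ℝ) (k i + 1) := by
    ext t
    simp only [Set.mem_setOf_eq, Set.mem_iUnion, Set.mem_univ_pi, exists_prop]
    constructor
    · exact fun h => ⟨_, h, fun i => Int.floor_eq_iff.1 rfl⟩
    · rintro ⟨k, hk, h⟩
      rwa [funext fun i => Int.floor_eq_iff.2 (h i)]
  rw [h, measure_biUnion_finset]
  · simp [volume_pi_pi]
  · intro k _ l _ hkl
    refine Set.disjoint_left.2 fun t h1 h2 => hkl (funext fun i => ?_)
    rw [← Int.floor_eq_iff.2 (h1 i trivial), ← Int.floor_eq_iff.2 (h2 i trivial)]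
  · exact fun k _ => MeasurableSet.univ_pi fun i => measurableSet_Ico

/-- The lattice point near `y` in the scaled lattice `lam⁻¹ (v + m ℤ⁴)`. -/
noncomputable def nearPt (m : ℕ) (v : Fin 4 → ℤ) (lam : ℝ) (y : Fin 4 → ℝ) : Fin 4 → ℝ :=
  fun i => lam⁻¹ * ((v i : ℝ) + m * (⌊lam / m * y i⌋ : ℤ))

theorem nearPt_dist {m : ℕ} (hm : 0 < m) (v : Fin 4 → ℤ) {lam : ℝ} (hlam : 0 < lam)
    (y : Fin 4 → ℝ) (i : Fin 4) : |nearPt m v lam y i - y i| ≤ ((∑ i, |(v i : ℝ)|) + m) / lam := by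
  have hm' : (0 : ℝ) < m := by exact_mod_cast hm
  have e : nearPt m v lam y i - y i = (v i - m * Int.fract (lam / m * y i)) / lam := by
    rw [nearPt, Int.fract]; field_simp; ring
  rw [e, abs_div, abs_of_pos hlam]
  refine div_le_div_of_nonneg_right ?_ hlam.le
  have h1 : |(v i : ℝ)| ≤ ∑ i, |(v i : ℝ)| :=
    Finset.single_le_sum (f := fun i => |(v i : ℝ)|) (fun i _ => abs_nonneg _) (Finset.mem_univ i)
  have h2 : |(m : ℝ) * Int.fract (lam / m * y i)| ≤ m := by
    rw [abs_of_nonneg (mul_nonneg hm'.le (Int.fract_nonneg _))]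
    nlinarith [Int.fract_lt_one (lam / m * y i)]
  exact (abs_sub _ _).trans (add_le_add h1 h2)

theorem nearPt_tendsto {m : ℕ} (hm : 0 < m) (v : Fin 4 → ℤ) (y : Fin 4 → ℝ) :
    Tendsto (fun lam => nearPt m v lam y) atTop (𝓝 y) := by
  rw [tendsto_pi_nhds]
  intro i
  rw [tendsto_iff_norm_sub_tendsto_zero]
  refine squeeze_zero' (Eventually.of_forall fun _ => norm_nonneg _)
    ((eventually_gt_atTop 0).mono fun lam hlam => nearPt_dist hm v hlam y i) ?_
  exact tendsto_const_nhds.div_atTop tendsto_id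

theorem volume_nearPt {m : ℕ} (hm : 0 < m) (v : Fin 4 → ℤ) {lam : ℝ} (hlam : 0 < lam)
    {B : Set (Fin 4 → ℝ)} (hfin : (lat lam B).Finite) :
    volume {y | nearPt m v lam y ∈ B} = ENNReal.ofReal ((m : ℝ) ^ 4 * (lam ^ 4)⁻¹ *
      (lat lam B ∩ {f | ∀ i, ((f i : ℤ) : ZMod m) = v i}).ncard) := by
  classical
  have hm' : (0 : ℝ) < m := by exact_mod_cast hm
  set g : (Fin 4 → ℤ) → (Fin 4 → ℤ) := fun k i => v i + m * k i with hg
  have hinj : Function.Injective g := fun k l h => funext fun i => by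
    have := congrFun h i
    simp only [hg] at this
    have hm0 : (m : ℤ) ≠ 0 := by exact_mod_cast hm.ne'
    exact mul_left_cancel₀ hm0 (by linarith)
  have hKfin : (g ⁻¹' lat lam B).Finite := hfin.preimage hinj.injOn
  have himg : lat lam B ∩ {f | ∀ i, ((f i : ℤ) : ZMod m) = v i} = g '' (hKfin.toFinset) := by
    rw [Set.Finite.coe_toFinset, Set.image_preimage_eq_inter_range]
    congr 1
    ext f
    constructor
    · intro h
      have : ∀ i, ∃ k, f i = v i + m * k := fun i => by
        obtain ⟨k, hk⟩ := (ZMod.intCast_eq_intCast_iff_dvd_sub _ _ _).1 (h i).symm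
        exact ⟨k, by linarith⟩
      choose k hk using this
      exact ⟨k, funext fun i => (hk i).symm⟩
    · rintro ⟨k, rfl⟩ i
      simp [hg]
  have hset : {y | nearPt m v lam y ∈ B} =
      (fun y : Fin 4 → ℝ => (lam / m) • y) ⁻¹' {t | (fun i => ⌊t i⌋) ∈ hKfin.toFinset} := by
    ext y
    simp only [Set.mem_preimage, Set.mem_setOf_eq, Set.Finite.mem_toFinset, lat]
    have : nearPt m v lam y = lam⁻¹ • toR (g fun i => ⌊((lam / m) • y) i⌋) := by
      ext i
      simp [nearPt, hg, toR_apply]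
    rw [this]
  rw [hset, Measure.addHaar_preimage_smul _ (by positivity), volume_floor_preimage, himg,
    Set.ncard_image_of_injective _ hinj, Set.ncard_coe_finset, Module.finrank_fin_fun,
    ← ENNReal.ofReal_natCast, ← ENNReal.ofReal_mul (abs_nonneg _)]
  congr 2
  rw [abs_of_pos (by positivity)]
  field_simp

theorem lat_finite {B : Set (Fin 4 → ℝ)} (hB : Bornology.IsBounded B) {lam : ℝ} (hlam : 0 < lam) :
    (lat lam B).Finite := by
  obtain ⟨R, hR⟩ := hB.exists_norm_le
  refine (finite_of_abs_le (fun _ => lam * R)).subset fun f hf i => ?_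
  have h1 := (norm_le_pi_norm _ i).trans (hR _ hf)
  rw [Pi.smul_apply, toR_apply, smul_eq_mul, Real.norm_eq_abs, abs_mul,
    abs_of_pos (inv_pos.2 hlam), inv_mul_le_iff₀ hlam] at h1
  exact h1

theorem lat_residue_tendsto {B : Set (Fin 4 → ℝ)} (hB : Bornology.IsBounded B)
    (hBm : MeasurableSet B) (hfr : volume (frontier B) = 0) {m : ℕ} (hm : 0 < m)
    (v : Fin 4 → ℤ) :
    Tendsto (fun lam : ℝ => ((lat lam B ∩ {f | ∀ i, ((f i : ℤ) : ZMod m) = v i}).ncard : ℝ) /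
      lam ^ 4) atTop (𝓝 ((volume B).toReal / (m : ℝ) ^ 4)) := by
  have hm' : (0 : ℝ) < m := by exact_mod_cast hm
  obtain ⟨R, hR⟩ := hB.exists_norm_le
  have key : Tendsto (fun lam : ℝ => volume {y | nearPt m v lam y ∈ B}) atTop (𝓝 (volume B)) := by
    refine tendsto_measure_of_ae_tendsto_indicator atTop hBm (fun lam => ?_)
      (B := Metric.closedBall 0 (R + ((∑ i, |(v i : ℝ)|) + m))) Metric.isClosed_closedBall.measurableSet
      (Metric.isBounded_closedBall.measure_lt_top.ne) ?_ ?_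
    · have : Measurable fun y => nearPt m v lam y := by
        unfold nearPt
        fun_prop
      exact this hBm
    · filter_upwards [eventually_ge_atTop 1] with lam hlam y hy
      rw [mem_closedBall_zero_iff]
      have hsum : 0 ≤ (∑ i, |(v i : ℝ)|) + m := by positivity
      have hR0 : 0 ≤ R := (norm_nonneg _).trans (hR _ hy)
      rw [pi_norm_le_iff_of_nonneg (by positivity)]
      intro i
      have h1 := nearPt_dist hm v (by linarith : 0 < lam) y i
      have h2 := (norm_le_pi_norm _ i).trans (hR _ hy)
      have h3 := div_le_self hsum hlam
      rw [Real.norm_eq_abs] at h2 ⊢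
      have h4 : y i = nearPt m v lam y i - (nearPt m v lam y i - y i) := by ring
      rw [h4]
      exact (abs_sub _ _).trans (by linarith)
    · have : ∀ᵐ y ∂volume, y ∉ frontier B := measure_eq_zero_iff_ae_notMem.1 hfr
      filter_upwards [this] with y hy
      have hlim := nearPt_tendsto hm v y
      by_cases hyB : y ∈ B
      · have : y ∈ interior B := by
          by_contra h
          exact hy ⟨subset_closure hyB, h⟩
        filter_upwards [hlim (mem_interior_iff_mem_nhds.1 this)] with lam h
        exact iff_of_true h hyB
      · have : y ∈ interior Bᶜ := by
          rw [interior_compl]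
          exact fun h => hy ⟨h, fun h' => hyB (interior_subset h')⟩
        filter_upwards [hlim (mem_interior_iff_mem_nhds.1 this)] with lam h
        exact iff_of_false h hyB
  have h2 := ((ENNReal.tendsto_toReal hB.measure_lt_top.ne).comp key).div_const ((m : ℝ) ^ 4)
  refine h2.congr' ?_
  filter_upwards [eventually_gt_atTop 0] with lam hlam
  rw [Function.comp_apply, volume_nearPt hm v hlam (lat_finite hB hlam), ENNReal.toReal_ofReal
    (by positivity)]
  field_simp

/-- Reduction of an integral form modulo `m`. -/
def red (m : ℕ) (f : Fin 4 → ℤ) : Fin 4 → ZMod m := fun i => (f i : ZMod m)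

theorem lat_congr_tendsto {B : Set (Fin 4 → ℝ)} (hB : Bornology.IsBounded B)
    (hBm : MeasurableSet B) (hfr : volume (frontier B) = 0) {m : ℕ} (hm : 0 < m)
    (T : Set (Fin 4 → ZMod m)) :
    Tendsto (fun lam : ℝ => ((lat lam B ∩ {f | red m f ∈ T}).ncard : ℝ) / lam ^ 4) atTop
      (𝓝 ((volume B).toReal * (Nat.card T / (m : ℝ) ^ 4))) := by
  classical
  have : NeZero m := ⟨hm.ne'⟩
  have hlift : ∀ t : Fin 4 → ZMod m, ∃ v : Fin 4 → ℤ, red m v = t := fun t => by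
    choose v hv using fun i => ZMod.intCast_surjective (t i)
    exact ⟨v, funext hv⟩
  choose v hv using hlift
  have h1 := tendsto_finsetSum (T.toFinite.toFinset) fun t _ =>
    lat_residue_tendsto hB hBm hfr hm (v t)
  rw [Finset.sum_const, nsmul_eq_mul, ← Set.ncard_eq_toFinset_card, ← Nat.card_coe_set_eq] at h1
  rw [show (Nat.card T : ℝ) * ((volume B).toReal / (m : ℝ) ^ 4) =
    (volume B).toReal * (Nat.card T / (m : ℝ) ^ 4) by ring] at h1
  refine h1.congr' ?_
  filter_upwards [eventually_gt_atTop 0] with lam hlam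
  rw [← Finset.sum_div]
  congr 1
  have hfin := lat_finite hB hlam
  have hset : ∀ t, lat lam B ∩ {f | ∀ i, ((f i : ℤ) : ZMod m) = v t i} =
      (hfin.toFinset.filter fun f => red m f = t : Finset _) := fun t => by
    ext f
    have : (∀ i, ((f i : ℤ) : ZMod m) = v t i) ↔ red m f = t := by
      conv_rhs => rw [← hv t]
      exact funext_iff.symm
    simp [this]
  have hset' : lat lam B ∩ {f | red m f ∈ T} =
      (hfin.toFinset.filter fun f => red m f ∈ T : Finset _) := by
    ext f; simp
  rw [hset', Set.ncard_coe_finset]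
  simp_rw [hset, Set.ncard_coe_finset]
  rw [Finset.card_eq_sum_card_fiberwise (f := red m) (t := T.toFinite.toFinset)]
  · push_cast
    refine Finset.sum_congr rfl fun t ht => ?_
    rw [Finset.filter_filter]
    congr 3
    ext f
    constructor
    · rintro rfl; exact ⟨by simpa using ht, rfl⟩
    · exact fun h => h.2
  · intro f hf
    simpa using (Finset.mem_filter.1 hf).2

theorem exists_crt {m n : ℕ} (hmn : m.Coprime n) (T : Set (Fin 4 → ZMod m))
    (U : Set (Fin 4 → ZMod n)) : ∃ W : Set (Fin 4 → ZMod (m * n)),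
      Nat.card W = Nat.card T * Nat.card U ∧
      ∀ f, red (m * n) f ∈ W ↔ red m f ∈ T ∧ red n f ∈ U := by
  set e := ZMod.chineseRemainder hmn
  set E : (Fin 4 → ZMod (m * n)) ≃ (Fin 4 → ZMod m) × (Fin 4 → ZMod n) :=
    (Equiv.piCongrRight fun _ => e.toEquiv).trans (Equiv.arrowProdEquivProdArrow _ _ _) with hE
  refine ⟨E ⁻¹' (T ×ˢ U), ?_, fun f => ?_⟩
  · rw [Nat.card_coe_set_eq, Nat.card_coe_set_eq, Nat.card_coe_set_eq, ← Set.ncard_prod,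
      Set.ncard_preimage_of_injective_subset_range E.injective (by simp [E.surjective.range_eq])]
  · have h1 : (E (red (m * n) f)).1 = red m f := funext fun i => by
      simp [hE, red, Equiv.arrowProdEquivProdArrow]
    have h2 : (E (red (m * n) f)).2 = red n f := funext fun i => by
      simp [hE, red, Equiv.arrowProdEquivProdArrow]
    rw [Set.mem_preimage, Set.mem_prod, h1, h2]

theorem exists_crt_finset (j : ℕ → ℕ) (Sig : ∀ p : ℕ, Set (Fin 4 → ZMod (p ^ j p)))
    (P : Finset ℕ) (hP : ∀ p ∈ P, p.Prime) : ∃ m : ℕ, 0 < m ∧ (∀ q : ℕ, q.Prime → q ∉ P →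
      m.Coprime q) ∧ ∃ T : Set (Fin 4 → ZMod m),
      (Nat.card T / (m : ℝ) ^ 4 = ∏ p ∈ P, (Nat.card (Sig p) : ℝ) / (p : ℝ) ^ (4 * j p)) ∧
      ∀ f, red m f ∈ T ↔ ∀ p ∈ P, red (p ^ j p) f ∈ Sig p := by
  classical
  induction P using Finset.induction_on with
  | empty =>
    refine ⟨1, one_pos, fun q _ _ => Nat.coprime_one_left q, Set.univ, ?_, fun f => by simp⟩
    rw [Nat.card_coe_set_eq, Set.ncard_univ]
    simp [Nat.card_unique]
  | insert q P hq ih =>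
    obtain ⟨m, hm, hcop, T, hT, hT'⟩ := ih fun p hp => hP p (Finset.mem_insert_of_mem hp)
    have hqp := hP q (Finset.mem_insert_self q P)
    have hmq : m.Coprime (q ^ j q) := (hcop q hqp hq).pow_right _
    obtain ⟨W, hW, hW'⟩ := exists_crt hmq T (Sig q)
    refine ⟨m * q ^ j q, Nat.mul_pos hm (pow_pos hqp.pos _), fun r hr hrP => ?_, W, ?_, fun f => ?_⟩
    · rw [Finset.mem_insert, not_or] at hrP
      exact (hcop r hr hrP.2).mul_left (((Nat.coprime_primes hqp hr).2 (Ne.symm hrP.1)).pow_left _)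
    · rw [hW, Finset.prod_insert hq, ← hT]
      push_cast
      rw [pow_mul', mul_pow]
      ring
    · rw [hW', hT', Finset.forall_mem_insert, and_comm]

theorem lat_finset_tendsto {B : Set (Fin 4 → ℝ)} (hB : Bornology.IsBounded B)
    (hBm : MeasurableSet B) (hfr : volume (frontier B) = 0) (j : ℕ → ℕ)
    (Sig : ∀ p : ℕ, Set (Fin 4 → ZMod (p ^ j p))) (P : Finset ℕ) (hP : ∀ p ∈ P, p.Prime) :
    Tendsto (fun lam : ℝ => ((lat lam B ∩ {f | ∀ p ∈ P, red (p ^ j p) f ∈ Sig p}).ncard : ℝ) /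
      lam ^ 4) atTop (𝓝 ((volume B).toReal *
        ∏ p ∈ P, (Nat.card (Sig p) : ℝ) / (p : ℝ) ^ (4 * j p))) := by
  obtain ⟨m, hm, -, T, hT, hT'⟩ := exists_crt_finset j Sig P hP
  have := lat_congr_tendsto hB hBm hfr hm T
  simp_rw [hT'] at this
  rwa [hT] at this

theorem hasStrictFDerivAt_of_rows {F : (Fin 4 → ℝ) → Fin 4 → ℝ} {M : Matrix (Fin 4) (Fin 4) ℝ}
    {y : Fin 4 → ℝ} (h : ∀ i, HasStrictFDerivAt (fun y => F y i)
      (∑ j, M i j • (ContinuousLinearMap.proj j : (Fin 4 → ℝ) →L[ℝ] ℝ)) y) :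
    HasStrictFDerivAt F (Matrix.toLin' M).toContinuousLinearMap y := by
  refine hasStrictFDerivAt_pi'.2 fun i => ?_
  refine (h i).congr_fderiv ?_
  ext z
  simp [Matrix.mulVec, dotProduct]

/-- `Phi` as a map on `ℝ⁴`. -/
def PhiMap (s : ℝ) (y : Fin 4 → ℝ) : Fin 4 → ℝ := Phi s (y 0) (y 1) (y 2) (y 3)

/-- The Jacobian matrix of `PhiMap`. -/
def PhiJac (s : ℝ) (y : Fin 4 → ℝ) : Matrix (Fin 4) (Fin 4) ℝ :=
  !![1, 0, 0, 0;
    -3 * y 2, (2 - s) * y 3, -3 * y 0, (2 - s) * y 1;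
    3 * y 2 ^ 2 + s * (2 - s) * y 3 ^ 2, -2 * (2 - s) * y 2 * y 3,
      6 * y 0 * y 2 - 2 * (2 - s) * y 1 * y 3, -2 * (2 - s) * y 1 * y 2 + 2 * s * (2 - s) * y 0 * y 3;
    -y 2 ^ 3 - s * (2 - s) * y 2 * y 3 ^ 2, (2 - s) * y 2 ^ 2 * y 3 + s * y 3 ^ 3,
      -3 * y 0 * y 2 ^ 2 + 2 * (2 - s) * y 1 * y 2 * y 3 - s * (2 - s) * y 0 * y 3 ^ 2,
      (2 - s) * y 1 * y 2 ^ 2 - 2 * s * (2 - s) * y 0 * y 2 * y 3 + 3 * s * y 1 * y 3 ^ 2]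

theorem PhiMap_hasStrictFDerivAt (s : ℝ) (y : Fin 4 → ℝ) :
    HasStrictFDerivAt (PhiMap s) (Matrix.toLin' (PhiJac s y)).toContinuousLinearMap y := by
  have h0 := hasStrictFDerivAt_apply (𝕜 := ℝ) (F' := fun _ : Fin 4 => ℝ) 0 y
  have h1 := hasStrictFDerivAt_apply (𝕜 := ℝ) (F' := fun _ : Fin 4 => ℝ) 1 y
  have h2 := hasStrictFDerivAt_apply (𝕜 := ℝ) (F' := fun _ : Fin 4 => ℝ) 2 y
  have h3 := hasStrictFDerivAt_apply (𝕜 := ℝ) (F' := fun _ : Fin 4 => ℝ) 3 y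
  refine hasStrictFDerivAt_of_rows fun i => ?_
  fin_cases i
  · refine h0.congr_fderiv ?_
    ext z
    simp [PhiJac, Fin.sum_univ_four]
  · refine (((h0.const_mul (-3)).mul h2).add ((h1.const_mul (2 - s)).mul h3)).congr_fderiv ?_
    ext z
    simp [PhiJac, Fin.sum_univ_four]
    ring
  · refine ((((h0.const_mul 3).mul (h2.pow 2)).sub (((h1.const_mul (2 * (2 - s))).mul h2).mul
      h3)).add ((h0.const_mul (s * (2 - s))).mul (h3.pow 2))).congr_fderiv ?_
    ext z
    simp [PhiJac, Fin.sum_univ_four]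
    ring
  · refine (((h0.neg.mul (h2.pow 3)).add (((h1.const_mul (2 - s)).mul (h2.pow 2)).mul h3)).sub
      (((h0.const_mul (s * (2 - s))).mul h2).mul (h3.pow 2)) |>.add
      ((h1.const_mul s).mul (h3.pow 3))).congr_fderiv ?_
    ext z
    simp [PhiJac, Fin.sum_univ_four]
    ring

theorem PhiJac_det {s : ℝ} (hs : s = 1 ∨ s = -1) (y : Fin 4 → ℝ) :
    |(PhiJac s y).det| = (20 - 16 * s) * y 3 ^ 4 * (y 0 ^ 2 + y 1 ^ 2) := by
  have h : (PhiJac s y).det = -s * ((20 - 16 * s) * y 3 ^ 4 * (y 0 ^ 2 + y 1 ^ 2)) := by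
    rcases hs with rfl | rfl <;>
    simp [PhiJac, Matrix.det_succ_row_zero, Fin.sum_univ_succ, Fin.succAbove, Matrix.submatrix] <;>
    ring
  have h2 : 0 ≤ (20 - 16 * s) * y 3 ^ 4 * (y 0 ^ 2 + y 1 ^ 2) := by
    rcases hs with rfl | rfl <;> norm_num <;> positivity
  rw [h, abs_mul, abs_of_nonneg h2]
  rcases hs with rfl | rfl <;> norm_num

/-- The function `cos ^ (-3 / 2)`. -/
noncomputable def cosPow (ψ : ℝ) : ℝ := (√(Real.cos ψ))⁻¹ ^ 3

theorem cosPow_pos {ψ : ℝ} (h : 0 < Real.cos ψ) : 0 < cosPow ψ :=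
  pow_pos (inv_pos.2 (Real.sqrt_pos.2 h)) 3

theorem cosPow_sq {ψ : ℝ} (h : 0 < Real.cos ψ) : cosPow ψ ^ 2 * Real.cos ψ ^ 3 = 1 := by
  have h1 : (√(Real.cos ψ))⁻¹ ^ 2 = (Real.cos ψ)⁻¹ := by rw [inv_pow, Real.sq_sqrt h.le]
  rw [cosPow, ← pow_mul, mul_comm 3 2, pow_mul, h1, ← mul_pow, inv_mul_cancel₀ h.ne', one_pow]

theorem cosPow_hasStrictDerivAt {ψ : ℝ} (h : 0 < Real.cos ψ) :
    HasStrictDerivAt cosPow (deriv cosPow ψ) ψ := by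
  have h2 : HasStrictDerivAt cosPow _ ψ := ((hasStrictDerivAt_inv (Real.sqrt_pos.2 h).ne').comp ψ
    ((Real.hasStrictDerivAt_cos ψ).sqrt h.ne')).pow 3
  rwa [← h2.hasDerivAt.deriv] at h2

/-- Polar coordinates for the domain of `PhiMap`. -/
noncomputable def polMap (x : Fin 4 → ℝ) : Fin 4 → ℝ :=
  ![x 0 * Real.cos (x 1) * (cosPow (x 2) * x 3 ^ 3),
    x 0 * Real.sin (x 1) * (cosPow (x 2) * x 3 ^ 3),
    Real.sin (x 2), Real.cos (x 2) * (x 3 ^ 2)⁻¹]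

/-- The Jacobian matrix of `polMap`. -/
noncomputable def polJac (x : Fin 4 → ℝ) : Matrix (Fin 4) (Fin 4) ℝ :=
  !![Real.cos (x 1) * (cosPow (x 2) * x 3 ^ 3), -x 0 * Real.sin (x 1) * (cosPow (x 2) * x 3 ^ 3),
      x 0 * Real.cos (x 1) * (deriv cosPow (x 2) * x 3 ^ 3),
      x 0 * Real.cos (x 1) * (cosPow (x 2) * (3 * x 3 ^ 2));
    Real.sin (x 1) * (cosPow (x 2) * x 3 ^ 3), x 0 * Real.cos (x 1) * (cosPow (x 2) * x 3 ^ 3),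
      x 0 * Real.sin (x 1) * (deriv cosPow (x 2) * x 3 ^ 3),
      x 0 * Real.sin (x 1) * (cosPow (x 2) * (3 * x 3 ^ 2));
    0, 0, Real.cos (x 2), 0;
    0, 0, -Real.sin (x 2) * (x 3 ^ 2)⁻¹, Real.cos (x 2) * (-2 * (x 3 ^ 3)⁻¹)]

theorem polMap_hasStrictFDerivAt {x : Fin 4 → ℝ} (hc : 0 < Real.cos (x 2)) (h3 : x 3 ≠ 0) :
    HasStrictFDerivAt polMap (Matrix.toLin' (polJac x)).toContinuousLinearMap x := by
  have p0 := hasStrictFDerivAt_apply (𝕜 := ℝ) (F' := fun _ : Fin 4 => ℝ) 0 x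
  have p1 := hasStrictFDerivAt_apply (𝕜 := ℝ) (F' := fun _ : Fin 4 => ℝ) 1 x
  have p2 := hasStrictFDerivAt_apply (𝕜 := ℝ) (F' := fun _ : Fin 4 => ℝ) 2 x
  have p3 := hasStrictFDerivAt_apply (𝕜 := ℝ) (F' := fun _ : Fin 4 => ℝ) 3 x
  have hw := (cosPow_hasStrictDerivAt hc).comp_hasStrictFDerivAt x p2
  have hinv : HasStrictDerivAt (fun t : ℝ => (t ^ 2)⁻¹) (-2 * (x 3 ^ 3)⁻¹) (x 3) := by
    refine (HasStrictDerivAt.comp (h := fun t : ℝ => t ^ 2) (x 3)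
      (hasStrictDerivAt_inv (pow_ne_zero 2 h3)) (hasStrictDerivAt_pow 2 (x 3))).congr_deriv ?_
    field_simp
    norm_num
    ring
  have hr := hinv.comp_hasStrictFDerivAt x p3
  refine hasStrictFDerivAt_of_rows fun i => ?_
  fin_cases i
  · refine ((p0.mul p1.cos).mul (hw.mul (p3.pow 3))).congr_fderiv ?_
    ext z
    simp [polJac, Fin.sum_univ_four]
    ring
  · refine ((p0.mul p1.sin).mul (hw.mul (p3.pow 3))).congr_fderiv ?_
    ext z
    simp [polJac, Fin.sum_univ_four]
    ring
  · refine p2.sin.congr_fderiv ?_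
    ext z
    simp [polJac, Fin.sum_univ_four]
  · refine (p2.cos.mul hr).congr_fderiv ?_
    ext z
    simp [polJac, Fin.sum_univ_four]
    ring

theorem polJac_det {x : Fin 4 → ℝ} (hc : 0 < Real.cos (x 2)) (h3 : x 3 ≠ 0) :
    (polJac x).det * Real.cos (x 2) = -2 * x 0 * x 3 ^ 3 := by
  have h : (polJac x).det = x 0 * cosPow (x 2) ^ 2 * x 3 ^ 6 * Real.cos (x 2) ^ 2 *
      (-2 * (x 3 ^ 3)⁻¹) := by
    simp [polJac, Matrix.det_succ_row_zero, Fin.sum_univ_succ, Fin.succAbove, Matrix.submatrix]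
    linear_combination (x 0 * cosPow (x 2) ^ 2 * x 3 ^ 6 * Real.cos (x 2) ^ 2 *
      (-2 * (x 3 ^ 3)⁻¹)) * Real.cos_sq_add_sin_sq (x 1)
  rw [h]
  have := cosPow_sq hc
  field_simp
  linear_combination -x 0 * this

theorem polMap_zero (x : Fin 4 → ℝ) :
    polMap x 0 = x 0 * Real.cos (x 1) * (cosPow (x 2) * x 3 ^ 3) := rfl
theorem polMap_one (x : Fin 4 → ℝ) :
    polMap x 1 = x 0 * Real.sin (x 1) * (cosPow (x 2) * x 3 ^ 3) := rfl
theorem polMap_two (x : Fin 4 → ℝ) : polMap x 2 = Real.sin (x 2) := rfl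
theorem polMap_three (x : Fin 4 → ℝ) : polMap x 3 = Real.cos (x 2) * (x 3 ^ 2)⁻¹ := rfl

theorem polMap_sq_add_sq (x : Fin 4 → ℝ) :
    polMap x 0 ^ 2 + polMap x 1 ^ 2 = x 0 ^ 2 * cosPow (x 2) ^ 2 * x 3 ^ 6 := by
  rw [polMap_zero, polMap_one]
  linear_combination (x 0 ^ 2 * cosPow (x 2) ^ 2 * x 3 ^ 6) * Real.cos_sq_add_sin_sq (x 1)

theorem polMap_disc {x : Fin 4 → ℝ} (hc : 0 < Real.cos (x 2)) (h3 : x 3 ≠ 0) :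
    (polMap x 0 ^ 2 + polMap x 1 ^ 2) ^ 2 * polMap x 3 ^ 6 = x 0 ^ 4 := by
  rw [polMap_sq_add_sq, polMap_three]
  have := cosPow_sq hc
  field_simp
  linear_combination x 0 ^ 4 * (cosPow (x 2) ^ 2 * Real.cos (x 2) ^ 3 + 1) * this

/-- The parametrization of real reduced forms by a box. -/
noncomputable def bodyMap (s : ℝ) (x : Fin 4 → ℝ) : Fin 4 → ℝ := PhiMap s (polMap x)

/-- The derivative of `bodyMap`. -/
noncomputable def bodyDeriv (s : ℝ) (x : Fin 4 → ℝ) : (Fin 4 → ℝ) →L[ℝ] (Fin 4 → ℝ) :=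
  (Matrix.toLin' (PhiJac s (polMap x))).toContinuousLinearMap ∘SL
    (Matrix.toLin' (polJac x)).toContinuousLinearMap

theorem bodyMap_hasStrictFDerivAt (s : ℝ) {x : Fin 4 → ℝ} (hc : 0 < Real.cos (x 2))
    (h3 : x 3 ≠ 0) : HasStrictFDerivAt (bodyMap s) (bodyDeriv s x) x :=
  (PhiMap_hasStrictFDerivAt s (polMap x)).comp x (polMap_hasStrictFDerivAt hc h3)

theorem bodyDeriv_det {s : ℝ} (hs : s = 1 ∨ s = -1) {x : Fin 4 → ℝ} (h0 : 0 ≤ x 0)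
    (hc : 0 < Real.cos (x 2)) (h3 : 0 < x 3) :
    |(bodyDeriv s x).det| = 2 * (20 - 16 * s) * x 0 ^ 3 * x 3 := by
  have e : (bodyDeriv s x).det = (PhiJac s (polMap x)).det * (polJac x).det := by
    rw [← LinearMap.det_toLin' (PhiJac s (polMap x)), ← LinearMap.det_toLin' (polJac x),
      ← LinearMap.det_comp]
    rfl
  have e2 : (polJac x).det = -(2 * x 0 * x 3 ^ 3 / Real.cos (x 2)) := by
    have := polJac_det hc h3.ne'
    field_simp
    linear_combination this
  rw [e, abs_mul, PhiJac_det hs, e2, abs_neg, abs_of_nonneg (by positivity), polMap_sq_add_sq,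
    polMap_three]
  have := cosPow_sq hc
  field_simp
  linear_combination (20 - 16 * s) * x 0 ^ 3 * this

/-- The lower corner of the parameter box. -/
noncomputable def loBox (h : ℝ) : Fin 4 → ℝ := ![0, -(Real.pi / 2), 0, h⁻¹]

/-- The upper corner of the parameter box. -/
noncomputable def hiBox (r : ℝ) : Fin 4 → ℝ := ![r, Real.pi / 2, Real.pi / 6, 1]

/-- The open parameter box. -/
def openBox (r h : ℝ) : Set (Fin 4 → ℝ) := Set.univ.pi fun i => Set.Ioo (loBox h i) (hiBox r i)

theorem mem_openBox {r h : ℝ} {x : Fin 4 → ℝ} : x ∈ openBox r h ↔ (0 < x 0 ∧ x 0 < r) ∧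
    (-(Real.pi / 2) < x 1 ∧ x 1 < Real.pi / 2) ∧ (0 < x 2 ∧ x 2 < Real.pi / 6) ∧
    (h⁻¹ < x 3 ∧ x 3 < 1) := by
  simp [openBox, Set.mem_univ_pi, Fin.forall_fin_succ, loBox, hiBox]

theorem mem_closedBox {r h : ℝ} {x : Fin 4 → ℝ} : x ∈ Set.Icc (loBox h) (hiBox r) ↔
    (0 ≤ x 0 ∧ x 0 ≤ r) ∧ (-(Real.pi / 2) ≤ x 1 ∧ x 1 ≤ Real.pi / 2) ∧
    (0 ≤ x 2 ∧ x 2 ≤ Real.pi / 6) ∧ (h⁻¹ ≤ x 3 ∧ x 3 ≤ 1) := by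
  simp [Set.mem_Icc, Pi.le_def, Fin.forall_fin_succ, loBox, hiBox]
  tauto

theorem openBox_subset (r h : ℝ) : openBox r h ⊆ Set.Icc (loBox h) (hiBox r) := fun _ hx =>
  ⟨fun i => (hx i trivial).1.le, fun i => (hx i trivial).2.le⟩

theorem cos_pos_of_closedBox {r h : ℝ} {x : Fin 4 → ℝ} (hx : x ∈ Set.Icc (loBox h) (hiBox r)) :
    0 < Real.cos (x 2) := by
  obtain ⟨-, -, h2, -⟩ := mem_closedBox.1 hx
  have := Real.pi_pos
  exact Real.cos_pos_of_mem_Ioo ⟨by linarith, by linarith⟩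

theorem pos_of_closedBox {r h : ℝ} (hh : 0 < h) {x : Fin 4 → ℝ}
    (hx : x ∈ Set.Icc (loBox h) (hiBox r)) : 0 < x 3 :=
  (inv_pos.2 hh).trans_le (mem_closedBox.1 hx).2.2.2.1

theorem bodyMap_continuousOn (s r : ℝ) {h : ℝ} (hh : 0 < h) :
    ContinuousOn (bodyMap s) (Set.Icc (loBox h) (hiBox r)) := fun _ hx =>
  (bodyMap_hasStrictFDerivAt s (cos_pos_of_closedBox hx)
    (pos_of_closedBox hh hx).ne').continuousAt.continuousWithinAt

/-- The open region of reduced forms of bounded discriminant and height. -/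
def openBody (s r h : ℝ) : Set (Fin 4 → ℝ) := bodyMap s '' openBox r h

/-- The compact region of reduced forms of bounded discriminant and height. -/
def closedBody (s r h : ℝ) : Set (Fin 4 → ℝ) := bodyMap s '' Set.Icc (loBox h) (hiBox r)

theorem openBody_subset (s r h : ℝ) : openBody s r h ⊆ closedBody s r h :=
  Set.image_mono (openBox_subset r h)

theorem closedBody_isCompact (s r : ℝ) {h : ℝ} (hh : 0 < h) : IsCompact (closedBody s r h) :=
  isCompact_Icc.image_of_continuousOn (bodyMap_continuousOn s r hh)

theorem openBody_isOpen {s : ℝ} (hs : s = 1 ∨ s = -1) (r : ℝ) {h : ℝ} (hh : 0 < h) :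
    IsOpen (openBody s r h) := by
  have ho : IsOpen (openBox r h) := isOpen_set_pi Set.finite_univ fun _ _ => isOpen_Ioo
  rw [isOpen_iff_mem_nhds]
  rintro _ ⟨x, hx, rfl⟩
  have hxc := openBox_subset r h hx
  have h0 : 0 < x 0 := (mem_openBox.1 hx).1.1
  have h3 := pos_of_closedBox hh hxc
  have hc := cos_pos_of_closedBox hxc
  have hdet : (bodyDeriv s x).det ≠ 0 := by
    rw [← abs_pos, bodyDeriv_det hs h0.le hc h3]
    rcases hs with rfl | rfl <;> norm_num <;> positivity
  have hr : (bodyDeriv s x : (Fin 4 → ℝ) →ₗ[ℝ] (Fin 4 → ℝ)).range = ⊤ :=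
    LinearMap.range_eq_top.2 (LinearMap.equivOfDetNeZero _ hdet).surjective
  rw [← (bodyMap_hasStrictFDerivAt s hc h3.ne').map_nhds_eq_of_surj hr]
  exact image_mem_map (ho.mem_nhds hx)

theorem volume_closedBody_diff (s r : ℝ) {h : ℝ} (hh : 0 < h) :
    volume (closedBody s r h \ openBody s r h) = 0 := by
  have hsub : closedBody s r h \ openBody s r h ⊆
      bodyMap s '' (Set.Icc (loBox h) (hiBox r) \ openBox r h) := Set.subset_image_diff _ _ _
  refine measure_mono_null hsub ?_
  refine addHaar_image_eq_zero_of_differentiableOn_of_addHaar_eq_zero volume (fun x hx =>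
    (bodyMap_hasStrictFDerivAt s (cos_pos_of_closedBox hx.1)
      (pos_of_closedBox hh hx.1).ne').differentiableAt.differentiableWithinAt) ?_
  have := Measure.univ_pi_Ioo_ae_eq_Icc (μ := fun _ : Fin 4 => (volume : Measure ℝ))
    (f := loBox h) (g := hiBox r)
  exact ae_le_set.1 this.symm.le

theorem frontier_openBody (s r : ℝ) (hs : s = 1 ∨ s = -1) {h : ℝ} (hh : 0 < h) :
    volume (frontier (openBody s r h)) = 0 := by
  refine measure_mono_null (fun y hy => ?_) (volume_closedBody_diff s r hh)
  rw [(openBody_isOpen hs r hh).frontier_eq] at hy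
  exact ⟨closure_minimal (openBody_subset s r h) (closedBody_isCompact s r hh).isClosed hy.1, hy.2⟩

theorem frontier_closedBody (s r : ℝ) (hs : s = 1 ∨ s = -1) {h : ℝ} (hh : 0 < h) :
    volume (frontier (closedBody s r h)) = 0 := by
  refine measure_mono_null (fun y hy => ?_) (volume_closedBody_diff s r hh)
  rw [(closedBody_isCompact s r hh).isClosed.frontier_eq] at hy
  exact ⟨hy.1, fun h' => hy.2 (interior_maximal (openBody_subset s r h) (openBody_isOpen hs r hh) h')⟩

theorem volume_closedBody (s r : ℝ) {h : ℝ} (hh : 0 < h) :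
    volume (closedBody s r h) = volume (openBody s r h) :=
  le_antisymm (measure_mono_ae (ae_le_set.2 (volume_closedBody_diff s r hh)))
    (measure_mono (openBody_subset s r h))

theorem bodyMap_eq (s : ℝ) (x : Fin 4 → ℝ) :
    bodyMap s x = Phi s (polMap x 0) (polMap x 1) (polMap x 2) (polMap x 3) := rfl

theorem polMap_bounds {r h : ℝ} (hh : 0 < h) {x : Fin 4 → ℝ} (hx : x ∈ openBox r h) :
    0 < polMap x 0 ∧ 0 < polMap x 3 ∧ 0 < polMap x 2 ∧ polMap x 2 < 1 / 2 ∧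
      1 < polMap x 2 ^ 2 + polMap x 3 ^ 2 := by
  have hxc := openBox_subset r h hx
  have hc := cos_pos_of_closedBox hxc
  have h3 := pos_of_closedBox hh hxc
  obtain ⟨h0, h1, h2, h3'⟩ := mem_openBox.1 hx
  have hw := cosPow_pos hc
  have hπ := Real.pi_pos
  refine ⟨?_, ?_, ?_, ?_, ?_⟩
  · rw [polMap_zero]
    have := Real.cos_pos_of_mem_Ioo (x := x 1) ⟨h1.1, h1.2⟩
    have := h0.1
    positivity
  · rw [polMap_three]; positivity
  · rw [polMap_two]
    exact Real.sin_pos_of_pos_of_lt_pi h2.1 (by linarith)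
  · rw [polMap_two, ← Real.sin_pi_div_six]
    exact Real.sin_lt_sin_of_lt_of_le_pi_div_two (by linarith) (by linarith) h2.2
  · rw [polMap_two, polMap_three]
    have h4 : x 3 ^ 2 < 1 := by nlinarith
    have h5 : 1 < (x 3 ^ 2)⁻¹ := (one_lt_inv₀ (by positivity)).2 h4
    have h6 := Real.sin_sq_add_cos_sq (x 2)
    have h7 : 0 < Real.cos (x 2) ^ 2 := by positivity
    have h8 : 1 < (x 3 ^ 2)⁻¹ ^ 2 := by nlinarith
    rw [mul_pow]
    nlinarith

theorem smul_Phi (c s p q ξ η : ℝ) : c • Phi s p q ξ η = Phi s (c * p) (c * q) ξ η := by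
  apply form_ext <;> simp <;> ring

theorem isStrictRed_of_mem_openBody {s r h lam : ℝ} (hs : s = 1 ∨ s = -1) (hh : 0 < h)
    (hr : (56 - 52 * s) * r ^ 4 = 1) (hlam : 0 < lam) {f : Fin 4 → ℤ}
    (hf : f ∈ lat lam (openBody s r h)) : (∃ p q ξ η, IsStrictRed s (toR f) p q ξ η) ∧
      s * ((cdisc f : ℤ) : ℝ) < 0 ∧ -s * ((cdisc f : ℤ) : ℝ) < lam ^ 4 := by
  obtain ⟨x, hx, hxf⟩ := hf
  obtain ⟨b0, b3, b2, b2', b4⟩ := polMap_bounds hh hx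
  have hxc := openBox_subset r h hx
  have hc := cos_pos_of_closedBox hxc
  have h3 := pos_of_closedBox hh hxc
  obtain ⟨⟨h0, h0'⟩, -⟩ := mem_openBox.1 hx
  have hD0 : 0 < 56 - 52 * s := by rcases hs with rfl | rfl <;> norm_num
  have hss : s * s = 1 := by rcases hs with rfl | rfl <;> norm_num
  have e : toR f = Phi s (lam * polMap x 0) (lam * polMap x 1) (polMap x 2) (polMap x 3) := by
    rw [← smul_Phi, ← bodyMap_eq, hxf, smul_inv_smul₀ hlam.ne']
  have hd : s * ((cdisc f : ℤ) : ℝ) = -((56 - 52 * s) * x 0 ^ 4 * lam ^ 4) := by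
    rw [← cdisc_toR, e, cdisc_Phi hs, ← polMap_disc hc h3.ne']
    linear_combination (-(56 - 52 * s) * ((lam * polMap x 0) ^ 2 + (lam * polMap x 1) ^ 2) ^ 2 *
      polMap x 3 ^ 6) * hss
  have hx4 : x 0 ^ 4 < r ^ 4 := pow_lt_pow_left₀ h0' h0.le (by norm_num)
  refine ⟨⟨_, _, _, _, e, by positivity, b3, b2, b2', b4⟩, ?_, ?_⟩
  · rw [hd]
    have : 0 < (56 - 52 * s) * x 0 ^ 4 * lam ^ 4 := by positivity
    linarith
  · rw [neg_mul, hd, neg_neg]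
    have h4 : (56 - 52 * s) * x 0 ^ 4 < 1 := by rw [← hr]; exact mul_lt_mul_of_pos_left hx4 hD0
    have := mul_lt_mul_of_pos_right h4 (pow_pos hlam 4)
    linarith

theorem mem_closedBody_of_isRed {s r h lam p q ξ η : ℝ} (hs : s = 1 ∨ s = -1) (hh : 0 < h)
    (hr0 : 0 < r) (hr : (56 - 52 * s) * r ^ 4 = 1) (hlam : 0 < lam) {f : Fin 4 → ℤ}
    (hf : IsRed s (toR f) p q ξ η) (hd : -s * ((cdisc f : ℤ) : ℝ) < lam ^ 4)
    (hη : η < h ^ 2 / 2) : f ∈ lat lam (closedBody s r h) := by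
  obtain ⟨e, hp, hη0, hξ0, hξ1, hn⟩ := hf
  have hD0 : 0 < 56 - 52 * s := by rcases hs with rfl | rfl <;> norm_num
  have hss : s * s = 1 := by rcases hs with rfl | rfl <;> norm_num
  have hπ := Real.pi_pos
  set ψ := Real.arcsin ξ with hψ
  have hsin : Real.sin ψ = ξ := Real.sin_arcsin (by linarith) (by linarith)
  have hψ0 : 0 ≤ ψ := Real.arcsin_nonneg.2 hξ0
  have hψ1 : ψ ≤ Real.pi / 6 := by
    refine Real.arcsin_le_iff_le_sin' ⟨by linarith, by linarith⟩ |>.2 ?_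
    rwa [Real.sin_pi_div_six]
  have hc : 0 < Real.cos ψ := Real.cos_pos_of_mem_Ioo ⟨by linarith, by linarith⟩
  have hcs := Real.sin_sq_add_cos_sq ψ
  rw [hsin] at hcs
  have hc2 : 1 / 2 ≤ Real.cos ψ := by nlinarith
  have hcη : Real.cos ψ ≤ η := by
    refine abs_le_of_sq_le_sq' (by linarith) hη0.le |>.2
  set υ := √(Real.cos ψ / η) with hυ
  have hυ2 : υ ^ 2 = Real.cos ψ / η := Real.sq_sqrt (by positivity)
  have hυ0 : 0 < υ := Real.sqrt_pos.2 (by positivity)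
  have hυ1 : υ ≤ 1 := by
    refine hυ ▸ Real.sqrt_le_one.2 ?_
    rwa [div_le_one hη0]
  have hυh : h⁻¹ ≤ υ := by
    refine abs_le_of_sq_le_sq' ?_ hυ0.le |>.2
    rw [hυ2, inv_pow, inv_le_comm₀ (by positivity) (by positivity), inv_div, div_le_iff₀ hc]
    nlinarith [pow_pos hh 2]
  set w := cosPow ψ * υ ^ 3 with hw
  have hw0 : 0 < w := mul_pos (cosPow_pos hc) (by positivity)
  have hwη : w ^ 4 * η ^ 6 = 1 := by
    have h1 := cosPow_sq hc
    have h2 : υ ^ 2 * η = Real.cos ψ := by rw [hυ2]; field_simp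
    calc w ^ 4 * η ^ 6 = (cosPow ψ ^ 2) ^ 2 * (υ ^ 2 * η) ^ 6 := by rw [hw]; ring
      _ = (cosPow ψ ^ 2 * Real.cos ψ ^ 3) ^ 2 := by rw [h2]; ring
      _ = 1 := by rw [h1, one_pow]
  set z : ℂ := ⟨lam⁻¹ * p / w, lam⁻¹ * q / w⟩ with hz
  have hzre : ‖z‖ * Real.cos z.arg = lam⁻¹ * p / w := Complex.norm_mul_cos_arg z
  have hzim : ‖z‖ * Real.sin z.arg = lam⁻¹ * q / w := Complex.norm_mul_sin_arg z
  have harg : |z.arg| ≤ Real.pi / 2 := Complex.abs_arg_le_pi_div_two_iff.2 (by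
    show 0 ≤ lam⁻¹ * p / w
    positivity)
  have hnorm : ‖z‖ ^ 2 = (lam⁻¹ * p / w) ^ 2 + (lam⁻¹ * q / w) ^ 2 := by
    rw [← hzre, ← hzim]
    linear_combination (-‖z‖ ^ 2) * Real.sin_sq_add_cos_sq z.arg
  have hρ : ‖z‖ ≤ r := by
    refine le_of_lt (lt_of_pow_lt_pow_left₀ 4 hr0.le ?_)
    have h1 : ‖z‖ ^ 4 * lam ^ 4 = (p ^ 2 + q ^ 2) ^ 2 * η ^ 6 := by
      calc ‖z‖ ^ 4 * lam ^ 4 = (‖z‖ ^ 2) ^ 2 * lam ^ 4 * (w ^ 4 * η ^ 6) := by rw [hwη]; ring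
        _ = _ := by rw [hnorm]; field_simp
    rw [← cdisc_toR, e, cdisc_Phi hs] at hd
    have h2 : (56 - 52 * s) * (‖z‖ ^ 4 * lam ^ 4) < lam ^ 4 := by
      rw [h1]
      linear_combination hd - ((56 - 52 * s) * (p ^ 2 + q ^ 2) ^ 2 * η ^ 6) * hss
    have h3 : (56 - 52 * s) * ‖z‖ ^ 4 < (56 - 52 * s) * r ^ 4 := by
      rw [hr]
      exact lt_of_mul_lt_mul_right (by linarith) (pow_nonneg hlam.le 4)
    exact lt_of_mul_lt_mul_left h3 hD0.le
  have h0 : polMap ![‖z‖, z.arg, ψ, υ] 0 = lam⁻¹ * p := by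
    show ‖z‖ * Real.cos z.arg * w = _
    rw [hzre]; field_simp
  have h1 : polMap ![‖z‖, z.arg, ψ, υ] 1 = lam⁻¹ * q := by
    show ‖z‖ * Real.sin z.arg * w = _
    rw [hzim]; field_simp
  have h2 : polMap ![‖z‖, z.arg, ψ, υ] 2 = ξ := hsin
  have h3 : polMap ![‖z‖, z.arg, ψ, υ] 3 = η := by
    show Real.cos ψ * (υ ^ 2)⁻¹ = η
    rw [hυ2]; field_simp
  refine ⟨![‖z‖, z.arg, ψ, υ], mem_closedBox.2 ⟨⟨norm_nonneg z, hρ⟩, abs_le.1 harg,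
    ⟨hψ0, hψ1⟩, hυh, hυ1⟩, ?_⟩
  rw [bodyMap_eq, h0, h1, h2, h3, ← smul_Phi, e]

theorem bodyMap_injOn {s : ℝ} (hs : s = 1 ∨ s = -1) (r : ℝ) {h : ℝ} (hh : 0 < h) :
    Set.InjOn (bodyMap s) (openBox r h) := by
  intro x hx y hy hxy
  obtain ⟨b0, b3, -⟩ := polMap_bounds hh hx
  obtain ⟨c0, c3, -⟩ := polMap_bounds hh hy
  rw [bodyMap_eq, bodyMap_eq] at hxy
  obtain ⟨e0, e1, e2, e3⟩ := Phi_inj hs b3 c3 b0.ne' hxy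
  have hπ := Real.pi_pos
  have hcx := cos_pos_of_closedBox (openBox_subset r h hx)
  have hx3 := pos_of_closedBox hh (openBox_subset r h hx)
  have hy3 := pos_of_closedBox hh (openBox_subset r h hy)
  obtain ⟨x0, x1, x2, x3⟩ := mem_openBox.1 hx
  obtain ⟨y0, y1, y2, y3⟩ := mem_openBox.1 hy
  have h2 : x 2 = y 2 := Real.injOn_sin ⟨by linarith, by linarith⟩ ⟨by linarith, by linarith⟩ e2
  have h3 : x 3 = y 3 := by
    rw [polMap_three, polMap_three, h2] at e3
    rw [h2] at hcx
    have := inv_injective (mul_left_cancel₀ hcx.ne' e3)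
    exact (pow_left_inj₀ hx3.le hy3.le two_ne_zero).1 this
  have hw : cosPow (x 2) * x 3 ^ 3 ≠ 0 := (mul_pos (cosPow_pos hcx) (pow_pos hx3 3)).ne'
  rw [polMap_zero, polMap_zero, ← h2, ← h3] at e0
  rw [polMap_one, polMap_one, ← h2, ← h3] at e1
  have f0 := mul_right_cancel₀ hw e0
  have f1 := mul_right_cancel₀ hw e1
  have h0 : x 0 = y 0 := by
    have : x 0 ^ 2 = y 0 ^ 2 := by
      linear_combination (x 0 * Real.cos (x 1) + y 0 * Real.cos (y 1)) * f0 +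
        (x 0 * Real.sin (x 1) + y 0 * Real.sin (y 1)) * f1 -
        x 0 ^ 2 * Real.sin_sq_add_cos_sq (x 1) + y 0 ^ 2 * Real.sin_sq_add_cos_sq (y 1)
    exact (pow_left_inj₀ x0.1.le y0.1.le two_ne_zero).1 this
  have h1 : x 1 = y 1 := by
    rw [← h0] at f1
    exact Real.injOn_sin ⟨x1.1.le, x1.2.le⟩ ⟨y1.1.le, y1.2.le⟩ (mul_left_cancel₀ x0.1.ne' f1)
  funext i
  fin_cases i
  exacts [h0, h1, h2, h3]

theorem volume_openBody {s r h : ℝ} (hs : s = 1 ∨ s = -1) (hh : 1 < h) (hr0 : 0 < r)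
    (hr : (56 - 52 * s) * r ^ 4 = 1) : (volume (openBody s r h)).toReal =
      (20 - 16 * s) / (56 - 52 * s) * (Real.pi ^ 2 / 24) * (1 - (h ^ 2)⁻¹) := by
  have hh0 : 0 < h := by linarith
  have hD0 : 0 < 56 - 52 * s := by rcases hs with rfl | rfl <;> norm_num
  have hm : MeasurableSet (openBox r h) := MeasurableSet.univ_pi fun _ => measurableSet_Ioo
  have h1 := integral_image_eq_integral_abs_det_fderiv_smul volume hm (f := bodyMap s)
    (f' := bodyDeriv s) (fun x hx => (bodyMap_hasStrictFDerivAt s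
      (cos_pos_of_closedBox (openBox_subset r h hx))
      (pos_of_closedBox hh0 (openBox_subset r h hx)).ne').hasFDerivAt.hasFDerivWithinAt)
    (bodyMap_injOn hs r hh0) (fun _ => (1 : ℝ))
  have h2 : ∫ x in openBox r h, |(bodyDeriv s x).det| • (1 : ℝ) = ∫ x in openBox r h,
      ∏ i, (![fun t => 2 * (20 - 16 * s) * t ^ 3, fun _ => 1, fun _ => 1, fun t => t] :
        Fin 4 → ℝ → ℝ) i (x i) := by
    refine setIntegral_congr_fun hm fun x hx => ?_
    have hxc := openBox_subset r h hx
    rw [bodyDeriv_det hs (mem_openBox.1 hx).1.1.le (cos_pos_of_closedBox hxc)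
      (pos_of_closedBox hh0 hxc), Fin.prod_univ_four]
    simp
  rw [h2, openBox, volume_pi, Measure.restrict_pi_pi, integral_fintype_prod_eq_prod,
    Fin.prod_univ_four] at h1
  rw [setIntegral_const, smul_eq_mul, mul_one] at h1
  have i0 : ∫ t in Set.Ioo 0 r, 2 * (20 - 16 * s) * t ^ 3 = 2 * (20 - 16 * s) * (r ^ 4 / 4) := by
    rw [← integral_Ioc_eq_integral_Ioo, ← intervalIntegral.integral_of_le hr0.le,
      intervalIntegral.integral_const_mul, integral_pow]
    norm_num
  have i3 : ∫ t in Set.Ioo h⁻¹ 1, t = (1 - (h ^ 2)⁻¹) / 2 := by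
    rw [← integral_Ioc_eq_integral_Ioo, ← intervalIntegral.integral_of_le (inv_le_one_of_one_le₀ hh.le),
      integral_id]
    field_simp
  have i1 : ∫ _ in Set.Ioo (-(Real.pi / 2)) (Real.pi / 2), (1 : ℝ) = Real.pi := by
    rw [setIntegral_const, Real.volume_real_Ioo_of_le (by linarith [Real.pi_pos])]; simp
  have i2 : ∫ _ in Set.Ioo 0 (Real.pi / 6), (1 : ℝ) = Real.pi / 6 := by
    rw [setIntegral_const, Real.volume_real_Ioo_of_le (by linarith [Real.pi_pos])]; simp
  rw [Measure.real] at h1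
  rw [openBody, openBox]
  refine h1.trans ?_
  simp only [loBox, hiBox, Matrix.cons_val]
  rw [i0, i1, i2, i3, show r ^ 4 = (56 - 52 * s)⁻¹ from eq_inv_of_mul_eq_one_right hr]
  field_simp
  ring

/-- Cubic forms over `ℤ/m` with nonzero leading coefficient and without a root. -/
def rootless (m : ℕ) : Set (Fin 4 → ZMod m) :=
  {v | v 0 ≠ 0 ∧ ∀ t, v 0 * t ^ 3 + v 1 * t ^ 2 + v 2 * t + v 3 ≠ 0}

/-- Cubic forms over `ℤ/m` that are `y` times a quadratic form with nonsquare discriminant. -/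
def lineQuadratic (m : ℕ) : Set (Fin 4 → ZMod m) :=
  {v | v 0 = 0 ∧ v 1 ≠ 0 ∧ ¬ IsSquare (v 2 ^ 2 - 4 * v 1 * v 3)}

theorem red_notMem_rootless {f : Fin 4 → ℤ} (hf : ¬ Irr f) {m : ℕ} (hm : m.Prime) :
    red m f ∉ rootless m := by
  have : Fact m.Prime := ⟨hm⟩
  rintro ⟨h0, hr⟩
  simp only [Irr, not_forall] at hf
  obtain ⟨x, y, hxy, hne⟩ := hf
  have hg : 0 < Int.gcd x y := Int.gcd_pos_iff.2 (by tauto)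
  obtain ⟨g, u, v, hg0, hco, rfl, rfl⟩ := Int.exists_gcd_one' hg
  rw [binEval_three] at hxy
  have hg0' : (g : ℤ) ^ 3 ≠ 0 := pow_ne_zero 3 (by exact_mod_cast hg0.ne')
  have h1 : f 0 * u ^ 3 + f 1 * u ^ 2 * v + f 2 * u * v ^ 2 + f 3 * v ^ 3 = 0 := by
    refine (mul_eq_zero.1 (?_ : (g : ℤ) ^ 3 * _ = 0)).resolve_left hg0'
    rw [← hxy]; ring
  have h2 : (f 0 : ZMod m) * u ^ 3 + f 1 * u ^ 2 * v + f 2 * u * v ^ 2 + f 3 * v ^ 3 = 0 := by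
    exact_mod_cast congrArg (Int.cast : ℤ → ZMod m) h1
  by_cases hv : (v : ZMod m) = 0
  · rw [hv] at h2
    have h3 : (f 0 : ZMod m) * u ^ 3 = 0 := by simpa using h2
    have hu : (u : ZMod m) = 0 := by
      rcases mul_eq_zero.1 h3 with h | h
      · exact absurd h h0
      · exact pow_eq_zero_iff three_ne_zero |>.1 h
    rw [ZMod.intCast_zmod_eq_zero_iff_dvd] at hu hv
    have h4 := Int.dvd_coe_gcd hu hv
    rw [hco] at h4
    exact hm.one_lt.ne' (by exact_mod_cast Int.eq_one_of_dvd_one (by positivity) h4)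
  · refine hr (u / v) ?_
    simp only [red]
    field_simp
    linear_combination h2

theorem red_notMem_lineQuadratic {f : Fin 4 → ℤ} (hf : IsSquare (cdisc f)) {m : ℕ} (hm : m.Prime) :
    red m f ∉ lineQuadratic m := by
  have : Fact m.Prime := ⟨hm⟩
  rintro ⟨h0, h1, hns⟩
  obtain ⟨k, hk⟩ := hf
  refine hns ⟨(k : ZMod m) / red m f 1, ?_⟩
  have h2 : cdisc (red m f) = (k : ZMod m) * k := by
    have h3 := cdisc_map (Int.castRingHom (ZMod m)) f
    rw [hk] at h3
    exact (by simpa using h3 : cdisc (fun i => (f i : ZMod m)) = _)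
  rw [cdisc, h0] at h2
  field_simp
  linear_combination h2

theorem card_le_two_mul_of_fibers {α β : Type*} [DecidableEq α] [Fintype β] (s : Finset α)
    (T : Set β) (g : α → β) (τ : α → α) (hg : ∀ x ∈ s, g x ∈ T)
    (h : ∀ x ∈ s, ∀ y ∈ s, g y = g x → y = x ∨ y = τ x) : s.card ≤ 2 * Nat.card T := by
  classical
  have h1 : s.card ≤ 2 * (s.image g).card := by
    refine Finset.card_le_mul_card_image s 2 fun b hb => ?_
    obtain ⟨x, hx, rfl⟩ := Finset.mem_image.1 hb
    refine (Finset.card_le_card (t := {x, τ x}) fun y hy => ?_).trans Finset.card_le_two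
    obtain ⟨hy, hyx⟩ := Finset.mem_filter.1 hy
    simpa using h x hx y hy hyx
  refine h1.trans (Nat.mul_le_mul_left 2 ?_)
  rw [Nat.card_coe_set_eq, ← Set.ncard_coe_finset]
  refine Set.ncard_le_ncard ?_ T.toFinite
  intro b hb
  obtain ⟨x, hx, rfl⟩ := Finset.mem_image.1 (Finset.mem_coe.1 hb)
  exact hg x hx

/-- Triples in `ℤ/m` whose first and last entries are nonzero. -/
def nzTriples (m : ℕ) [NeZero m] : Finset (ZMod m × ZMod m × ZMod m) :=
  (univ.erase 0) ×ˢ univ ×ˢ (univ.erase 0)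

theorem mem_nzTriples {m : ℕ} [NeZero m] {x : ZMod m × ZMod m × ZMod m} :
    x ∈ nzTriples m ↔ x.1 ≠ 0 ∧ x.2.2 ≠ 0 := by
  simp [nzTriples]

theorem le_card_nzTriples {m : ℕ} [NeZero m] (hm : 2 ≤ m) : m ^ 3 ≤ 4 * (nzTriples m).card := by
  rw [nzTriples, card_product, card_product, card_erase_of_mem (mem_univ _), card_univ, ZMod.card]
  obtain ⟨k, rfl⟩ : ∃ k, m = k + 1 := ⟨m - 1, by omega⟩
  have : 1 ≤ k := by omega
  rw [Nat.add_sub_cancel]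
  nlinarith [Nat.mul_le_mul this this, Nat.mul_le_mul (Nat.mul_le_mul this this) this]

theorem card_lineQuadratic {m : ℕ} (hm : m.Prime) (h3 : 3 < m) :
    m ^ 3 ≤ 8 * Nat.card (lineQuadratic m) := by
  have : Fact m.Prime := ⟨hm⟩
  have hchar : ringChar (ZMod m) ≠ 2 := by rw [ZMod.ringChar_zmod_n]; omega
  obtain ⟨n, hn⟩ := FiniteField.exists_nonsquare hchar
  have h2 : (2 : ZMod m) ≠ 0 := Ring.two_ne_zero hchar
  have h4 : (4 : ZMod m) ≠ 0 := by
    rw [show (4 : ZMod m) = 2 * 2 by norm_num]; exact mul_ne_zero h2 h2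
  have hn0 : n ≠ 0 := by rintro rfl; exact hn ⟨0, by simp⟩
  have key := card_le_two_mul_of_fibers (nzTriples m) (lineQuadratic m)
    (fun x => ![0, x.1, x.2.1, (x.2.1 ^ 2 - n * x.2.2 ^ 2) / (4 * x.1)])
    (fun x => (x.1, x.2.1, -x.2.2)) ?_ ?_
  · have := le_card_nzTriples (m := m) (by omega)
    omega
  · intro x hx
    obtain ⟨hx1, hx2⟩ := mem_nzTriples.1 hx
    refine ⟨rfl, hx1, fun ⟨k, hk⟩ => hn ⟨k / x.2.2, ?_⟩⟩
    simp only [Matrix.cons_val] at hk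
    field_simp at hk ⊢
    linear_combination hk
  · rintro ⟨b, c, u⟩ hx ⟨b', c', u'⟩ hy h
    obtain ⟨hx1, hx2⟩ := mem_nzTriples.1 hx
    have e1 : b' = b := congrFun h 1
    have e2 : c' = c := congrFun h 2
    subst e1 e2
    have e3 : (c' ^ 2 - n * u' ^ 2) / (4 * b') = (c' ^ 2 - n * u ^ 2) / (4 * b') := congrFun h 3
    have hb : 4 * b' ≠ 0 := mul_ne_zero h4 hx1
    have e4 : u' ^ 2 = u ^ 2 := by
      rw [div_left_inj' hb] at e3
      exact mul_left_cancel₀ hn0 (by linear_combination -e3)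
    rcases sq_eq_sq_iff_eq_or_eq_neg.1 e4 with h | h <;> simp [h]

theorem exists_rootless {m : ℕ} (hm : m.Prime) {a b u : ZMod m} (ha : a ≠ 0) (hu : u ≠ 0) :
    ∃ d, ![a, b, -(u * (a * u + b)), d] ∈ rootless m := by
  have : Fact m.Prime := ⟨hm⟩
  have h : ¬ Function.Surjective
      (fun t : ZMod m => -(a * t ^ 3 + b * t ^ 2 + -(u * (a * u + b)) * t)) := by
    intro h
    refine hu (Finite.injective_iff_surjective.2 h ?_)
    ring
  simp only [Function.Surjective, not_forall] at h
  obtain ⟨d, hd⟩ := h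
  refine ⟨d, ha, fun t ht => hd ⟨t, ?_⟩⟩
  simp only [Matrix.cons_val] at ht ⊢
  linear_combination -ht

theorem card_rootless {m : ℕ} (hm : m.Prime) : m ^ 3 ≤ 8 * Nat.card (rootless m) := by
  classical
  have : Fact m.Prime := ⟨hm⟩
  have hex : ∀ x : ZMod m × ZMod m × ZMod m, ∃ d, x.1 ≠ 0 → x.2.2 ≠ 0 →
      ![x.1, x.2.1, -(x.2.2 * (x.1 * x.2.2 + x.2.1)), d] ∈ rootless m := fun x => by
    by_cases h : x.1 ≠ 0 ∧ x.2.2 ≠ 0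
    · obtain ⟨d, hd⟩ := exists_rootless hm h.1 (b := x.2.1) h.2
      exact ⟨d, fun _ _ => hd⟩
    · exact ⟨0, fun h1 h2 => absurd ⟨h1, h2⟩ h⟩
  choose d hd using hex
  have key := card_le_two_mul_of_fibers (nzTriples m) (rootless m)
    (fun x => ![x.1, x.2.1, -(x.2.2 * (x.1 * x.2.2 + x.2.1)), d x])
    (fun x => (x.1, x.2.1, -x.2.1 / x.1 - x.2.2)) (fun x hx => ?_) ?_
  · have := le_card_nzTriples (m := m) hm.two_le
    omega
  · obtain ⟨hx1, hx2⟩ := mem_nzTriples.1 hx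
    exact hd x hx1 hx2
  · rintro ⟨a, b, u⟩ hx ⟨a', b', u'⟩ hy h
    obtain ⟨hx1, hx2⟩ := mem_nzTriples.1 hx
    have e1 : a' = a := congrFun h 0
    have e2 : b' = b := congrFun h 1
    subst e1 e2
    have e3 : -(u' * (a' * u' + b')) = -(u * (a' * u + b')) := congrFun h 2
    have e4 : (u' - u) * (a' * (u' + u) + b') = 0 := by linear_combination -e3
    replace hx1 : a' ≠ 0 := hx1
    rcases mul_eq_zero.1 e4 with h | h
    · left; rw [sub_eq_zero.1 h]
    · right
      have : u' = -b' / a' - u := by field_simp; linear_combination h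
      rw [this]

theorem tendsto_sum_inv_primes :
    Tendsto (fun n => ∑ p ∈ (range n).filter Nat.Prime, (1 : ℝ) / p) atTop atTop := by
  have h := (not_summable_iff_tendsto_nat_atTop_of_nonneg (fun n => ?_)).1
    not_summable_one_div_on_primes
  · refine h.congr fun n => ?_
    rw [Finset.sum_filter]
    exact Finset.sum_congr rfl fun i _ => by simp [Set.indicator_apply]
  · exact Set.indicator_nonneg (fun _ _ => by positivity) n

theorem exists_prod_lt (δ : ℕ → ℝ) (hδ : ∀ p : ℕ, p.Prime → 3 < p → 1 / (8 * p : ℝ) ≤ δ p ∧ δ p ≤ 1)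
    {ε : ℝ} (hε : 0 < ε) : ∃ P : Finset ℕ, (∀ p ∈ P, p.Prime ∧ 3 < p) ∧
      ∏ p ∈ P, (1 - δ p) < ε := by
  obtain ⟨n, hn⟩ := ((tendsto_atTop.1 tendsto_sum_inv_primes) (6 + 8 * (1 - Real.log ε))).exists
  refine ⟨(range n).filter (fun p => p.Prime ∧ 3 < p), fun p hp => (Finset.mem_filter.1 hp).2, ?_⟩
  have h1 : ∑ p ∈ (range n).filter Nat.Prime, (1 : ℝ) / p ≤
      ∑ p ∈ (range n).filter (fun p => p.Prime ∧ 3 < p), (1 : ℝ) / p + 4 := by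
    have hsub : (range n).filter Nat.Prime ⊆
        (range n).filter (fun p => p.Prime ∧ 3 < p) ∪ range 4 := by
      intro p hp
      simp only [Finset.mem_filter, Finset.mem_union, Finset.mem_range] at hp ⊢
      by_cases h : 3 < p
      · exact Or.inl ⟨hp.1, hp.2, h⟩
      · right; omega
    refine (Finset.sum_le_sum_of_subset_of_nonneg hsub fun i _ _ => by positivity).trans ?_
    have h := Finset.sum_union_inter (s₁ := (range n).filter (fun p => p.Prime ∧ 3 < p))
      (s₂ := range 4) (f := fun p : ℕ => (1 : ℝ) / p)
    have h0 : 0 ≤ ∑ p ∈ (range n).filter (fun p => p.Prime ∧ 3 < p) ∩ range 4, (1 : ℝ) / p :=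
      Finset.sum_nonneg fun _ _ => by positivity
    have h4 : ∑ p ∈ range 4, (1 : ℝ) / p ≤ 4 := by norm_num [Finset.sum_range_succ]
    linarith
  have h2 : ∏ p ∈ (range n).filter (fun p => p.Prime ∧ 3 < p), (1 - δ p) ≤
      Real.exp (-∑ p ∈ (range n).filter (fun p => p.Prime ∧ 3 < p), 1 / (8 * p : ℝ)) := by
    rw [← Finset.sum_neg_distrib, Real.exp_sum]
    refine Finset.prod_le_prod (fun p hp => ?_) fun p hp => ?_
    · have := (Finset.mem_filter.1 hp).2
      linarith [(hδ p this.1 this.2).2]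
    · have := (Finset.mem_filter.1 hp).2
      have h3 := Real.add_one_le_exp (-(1 / (8 * p : ℝ)))
      linarith [(hδ p this.1 this.2).1]
  refine h2.trans_lt ?_
  rw [← Real.lt_log_iff_exp_lt hε]
  have h3 : ∑ p ∈ (range n).filter (fun p => p.Prime ∧ 3 < p), 1 / (8 * p : ℝ) =
      (∑ p ∈ (range n).filter (fun p => p.Prime ∧ 3 < p), (1 : ℝ) / p) / 8 := by
    rw [Finset.sum_div]
    exact Finset.sum_congr rfl fun p _ => by rw [div_div, mul_comm]
  rw [h3]
  linarith

theorem card_forms_le {m : ℕ} (hm : 0 < m) (T : Set (Fin 4 → ZMod m)) :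
    Nat.card T ≤ m ^ 4 := by
  have : NeZero m := ⟨hm.ne'⟩
  refine (Finite.card_subtype_le (· ∈ T)).trans ?_
  rw [Nat.card_eq_fintype_card, Fintype.card_fun, ZMod.card, Fintype.card_fin]

theorem card_compl_forms {m : ℕ} (hm : 0 < m) (T : Set (Fin 4 → ZMod m)) :
    (Nat.card ↥Tᶜ : ℝ) = (m : ℝ) ^ 4 - Nat.card T := by
  have : NeZero m := ⟨hm.ne'⟩
  have h := Set.ncard_add_ncard_compl T
  rw [Nat.card_eq_fintype_card, Fintype.card_fun, ZMod.card, Fintype.card_fin] at h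
  rw [Nat.card_coe_set_eq, Nat.card_coe_set_eq, eq_sub_iff_add_eq, add_comm]
  exact_mod_cast h

/-- Forms avoiding, at every prime, a set of residues of density `≫ 1/p` have density zero. -/
theorem lat_sparse {B : Set (Fin 4 → ℝ)} (hB : Bornology.IsBounded B)
    (hBm : MeasurableSet B) (hfr : volume (frontier B) = 0) (T : ∀ m, Set (Fin 4 → ZMod m))
    (hT : ∀ m, m.Prime → 3 < m → m ^ 3 ≤ 8 * Nat.card (T m)) {E : Set (Fin 4 → ℤ)}
    (hE : ∀ f ∈ E, ∀ m, m.Prime → red m f ∉ T m) {ε : ℝ} (hε : 0 < ε) :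
    ∀ᶠ lam : ℝ in atTop, ((lat lam B ∩ E).ncard : ℝ) / lam ^ 4 < ε := by
  have hV : 0 ≤ (volume B).toReal := ENNReal.toReal_nonneg
  have hδ : ∀ p : ℕ, p.Prime → 3 < p → 1 / (8 * p : ℝ) ≤ (Nat.card (T (p ^ 1)) : ℝ) / (p : ℝ) ^ 4 ∧
      (Nat.card (T (p ^ 1)) : ℝ) / (p : ℝ) ^ 4 ≤ 1 := by
    intro p hp h3
    have hp0 : (0 : ℝ) < p := by exact_mod_cast hp.pos
    have h1 := hT (p ^ 1) (by simpa using hp) (by simpa using h3)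
    have h2 : ((p ^ 1 : ℕ) : ℝ) ^ 3 ≤ 8 * Nat.card (T (p ^ 1)) := by exact_mod_cast h1
    have h4 := card_forms_le (by simpa using hp.pos) (T (p ^ 1))
    rw [← pow_mul, one_mul] at h4
    replace h4 : (Nat.card (T (p ^ 1)) : ℝ) ≤ (p : ℝ) ^ 4 := by exact_mod_cast h4
    push_cast at h2
    rw [pow_one] at h2
    constructor
    · rw [div_le_div_iff₀ (by positivity) (by positivity)]
      nlinarith
    · rwa [div_le_one (by positivity)]
  obtain ⟨P, hP, hlt⟩ := exists_prod_lt _ hδ (ε := ε / ((volume B).toReal + 1)) (by positivity)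
  have h1 := lat_finset_tendsto hB hBm hfr (fun _ => 1) (fun p => (T (p ^ 1))ᶜ) P
    fun p hp => (hP p hp).1
  have h2 : (volume B).toReal * ∏ p ∈ P, (Nat.card ↥(T (p ^ 1))ᶜ : ℝ) / (p : ℝ) ^ (4 * 1) < ε := by
    have h3 : ∏ p ∈ P, (Nat.card ↥(T (p ^ 1))ᶜ : ℝ) / (p : ℝ) ^ (4 * 1) =
        ∏ p ∈ P, (1 - (Nat.card (T (p ^ 1)) : ℝ) / (p : ℝ) ^ 4) := by
      refine Finset.prod_congr rfl fun p hp => ?_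
      have hp0 := (hP p hp).1.pos
      have hp1 : (p : ℝ) ≠ 0 := by exact_mod_cast hp0.ne'
      rw [card_compl_forms (by simpa using hp0), sub_div, pow_one, mul_one, div_self (by positivity)]
    rw [h3]
    rw [lt_div_iff₀ (by positivity)] at hlt
    have h0 : 0 ≤ ∏ p ∈ P, (1 - (Nat.card (T (p ^ 1)) : ℝ) / (p : ℝ) ^ 4) := by
      rw [← h3]
      exact Finset.prod_nonneg fun p _ => by positivity
    nlinarith
  filter_upwards [h1.eventually_lt_const h2, eventually_gt_atTop 0] with lam hlam hlam0
  refine lt_of_le_of_lt ?_ hlam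
  gcongr
  · exact (lat_finite hB hlam0).subset Set.inter_subset_left
  · intro f hf p hp
    have := hE f hf (p ^ 1) (by simpa using (hP p hp).1)
    exact this

/-- Forms that have a rational zero, or have square discriminant. -/
def smallGal : Set (Fin 4 → ℤ) := {f | ¬ Irr f ∨ IsSquare (cdisc f)}

theorem lat_smallGal {B : Set (Fin 4 → ℝ)} (hB : Bornology.IsBounded B)
    (hBm : MeasurableSet B) (hfr : volume (frontier B) = 0) {ε : ℝ} (hε : 0 < ε) :
    ∀ᶠ lam : ℝ in atTop, ((lat lam B ∩ smallGal).ncard : ℝ) / lam ^ 4 < ε := by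
  have h1 := lat_sparse hB hBm hfr rootless (fun m hm _ => card_rootless hm) (E := {f | ¬ Irr f})
    (fun f hf m hm => red_notMem_rootless hf hm) (half_pos hε)
  have h2 := lat_sparse hB hBm hfr lineQuadratic (fun m hm h3 => card_lineQuadratic hm h3)
    (E := {f | IsSquare (cdisc f)}) (fun f hf m hm => red_notMem_lineQuadratic hf hm) (half_pos hε)
  filter_upwards [h1, h2, eventually_gt_atTop 0] with lam h1 h2 h0
  have e : lat lam B ∩ smallGal = (lat lam B ∩ {f | ¬ Irr f}) ∪ (lat lam B ∩ {f | IsSquare (cdisc f)}) := by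
    rw [← Set.inter_union_distrib_left]; rfl
  have h3 : ((lat lam B ∩ smallGal).ncard : ℝ) ≤ (lat lam B ∩ {f | ¬ Irr f}).ncard +
      (lat lam B ∩ {f | IsSquare (cdisc f)}).ncard := by
    rw [e]; exact_mod_cast Set.ncard_union_le _ _
  calc _ ≤ _ := div_le_div_of_nonneg_right h3 (by positivity)
    _ < ε := by rw [add_div]; linarith

theorem tendsto_prod_primes {μ : ℕ → ℝ} (h0 : ∀ p, p.Prime → 0 ≤ μ p) (h1 : ∀ p, p.Prime → μ p ≤ 1) :
    Tendsto (fun Y => ∏ p ∈ (range Y).filter Nat.Prime, μ p) atTop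
      (𝓝 (∏' q : Nat.Primes, μ (q : ℕ))) := by
  have hanti : Antitone fun t : Finset Nat.Primes => ∏ q ∈ t, μ (q : ℕ) := fun t u htu =>
    Finset.prod_le_prod_of_subset_of_le_one htu (fun q _ => h0 q q.2) (fun q _ _ => h1 q q.2)
  have hbdd : BddBelow (Set.range fun t : Finset Nat.Primes => ∏ q ∈ t, μ (q : ℕ)) :=
    ⟨0, by rintro _ ⟨t, rfl⟩; exact Finset.prod_nonneg fun q _ => h0 q q.2⟩
  have hp : HasProd (fun q : Nat.Primes => μ (q : ℕ)) _ := tendsto_atTop_ciInf hanti hbdd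
  rw [hp.tprod_eq]
  have ht : Tendsto (fun Y => (range Y).subtype Nat.Prime) atTop atTop := by
    refine tendsto_atTop_finset_of_monotone (fun a b hab => ?_) fun q => ⟨(q : ℕ) + 1, ?_⟩
    · exact Finset.subtype_mono (Finset.range_mono hab)
    · simp
  refine (Tendsto.comp hp ht).congr fun Y => ?_
  exact Finset.prod_subtype_eq_prod_filter (s := range Y) (p := Nat.Prime) μ

/-- The forms whose reductions modulo `p ^ j p` lie in the prescribed sets, for all `p ∈ P`. -/
def cong (j : ℕ → ℕ) (Sig : ∀ p : ℕ, Set (Fin 4 → ZMod (p ^ j p))) (P : Finset ℕ) :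
    Set (Fin 4 → ℤ) := {f | ∀ p ∈ P, red (p ^ j p) f ∈ Sig p}

theorem classes_ncard_le_lat {s lam : ℝ} (hs : s = 1 ∨ s = -1) (hlam : 0 < lam) {r : ℝ}
    (hr0 : 0 < r) (hr : (56 - 52 * s) * r ^ 4 = 1) (k : ℕ) {A T : Set (Fin 4 → ℤ)}
    (hA : A ⊆ irrSet s (lam ^ 4)) (hT : ∀ f ∈ A, ∀ g, FormEquiv f g → g ∈ T) :
    ((classes A).ncard : ℝ) ≤ (lat lam (closedBody s r (2 ^ k)) ∩ T).ncard +
      162 * (54 * lam) ^ 4 / 4 ^ k := by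
  obtain ⟨h1, h2⟩ := redSet_univ_bound hs hlam k
  have hfin : (lat lam (closedBody s r (2 ^ k)) ∩ T).Finite :=
    (lat_finite (closedBody_isCompact s r (by positivity)).isBounded hlam).subset
      Set.inter_subset_left
  have h3 := (classes_ncard_le (S := A) (hfin.union h1) fun f hf => ?_).2
  · have h4 := h3.trans (Set.ncard_union_le _ _)
    have h5 : ((classes A).ncard : ℝ) ≤ (lat lam (closedBody s r (2 ^ k)) ∩ T).ncard +
        (redSet s lam (4 ^ k / 2) Set.univ).ncard := by exact_mod_cast h4
    linarith
  · obtain ⟨g, ⟨hgT, p, q, ξ, η, hred, hη, hd⟩, hfg⟩ := exists_mem_redSet hs (hA hf).1 (hA hf).2.1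
      (hA hf).2.2 (hT f hf)
    refine ⟨g, ?_, hfg⟩
    rcases lt_or_ge η ((2 ^ k) ^ 2 / 2) with h | h
    · exact Or.inl ⟨mem_closedBody_of_isRed hs (by positivity) hr0 hr hlam hred hd h, hgT⟩
    · refine Or.inr ⟨trivial, p, q, ξ, η, hred, ?_, hd⟩
      rwa [← pow_mul, mul_comm, pow_mul, show (2 : ℝ) ^ 2 = 4 by norm_num] at h

theorem lat_ncard_le_classes {s lam : ℝ} (hs : s = 1 ∨ s = -1) (hlam : 1 ≤ lam) {r h : ℝ}
    (hh : 0 < h) (hr : (56 - 52 * s) * r ^ 4 = 1) {Y : ℕ} (hY : 3 ≤ Y) {A T : Set (Fin 4 → ℤ)}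
    (hA : A ⊆ irrSet s (lam ^ 4))
    (hT : ∀ f ∈ irrSet s (lam ^ 4), f ∈ T → ¬ IsSquare (cdisc f) → f ∈ A ∨ f ∈ sqTail Y) :
    ((lat lam (openBody s r h) ∩ T).ncard : ℝ) ≤ (lat lam (openBody s r h) ∩ smallGal).ncard +
      (classes A).ncard + (6 * (162 * 54 ^ 4) * lam ^ 4 / Y + 432 * 54 ^ 3 * lam ^ 3) := by
  have hlam0 : 0 < lam := by linarith
  set L := lat lam (openBody s r h) with hL
  have hfin : L.Finite := lat_finite ((closedBody_isCompact s r hh).isBounded.subset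
    (openBody_subset s r h)) hlam0
  have h1 : L ∩ T ⊆ (L ∩ smallGal) ∪ ((L ∩ T) \ smallGal) := fun f hf => by
    by_cases h : f ∈ smallGal
    exacts [Or.inl ⟨hf.1, h⟩, Or.inr ⟨hf, h⟩]
  have h2 : (L ∩ T).ncard ≤ (L ∩ smallGal).ncard + ((L ∩ T) \ smallGal).ncard :=
    (Set.ncard_le_ncard h1 ((hfin.subset Set.inter_subset_left).union
      (hfin.subset (Set.sdiff_subset.trans Set.inter_subset_left)))).trans (Set.ncard_union_le _ _)
  have hinj : Set.InjOn (Quot.mk (@FormEquiv 3)) ((L ∩ T) \ smallGal) := fun f hf g hg hfg => by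
    obtain ⟨⟨p, q, ξ, η, h1⟩, -⟩ := isStrictRed_of_mem_openBody hs hh hr hlam0 hf.1.1
    obtain ⟨⟨p', q', ξ', η', h1'⟩, -⟩ := isStrictRed_of_mem_openBody hs hh hr hlam0 hg.1.1
    exact h1.eq_of_equiv hs h1' (quot_eq_iff.1 hfg)
  have hirr := irrSet_classes_bound hs (X := lam ^ 4) (by positivity)
  have h3 : classes ((L ∩ T) \ smallGal) ⊆ classes A ∪ classes (irrSet s (lam ^ 4) ∩ sqTail Y) := by
    rintro _ ⟨f, ⟨⟨hfL, hfT⟩, hf⟩, rfl⟩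
    obtain ⟨-, hd, hd'⟩ := isStrictRed_of_mem_openBody hs hh hr hlam0 hfL
    simp only [smallGal, Set.mem_setOf_eq, not_or, not_not] at hf
    have hfi : f ∈ irrSet s (lam ^ 4) := ⟨hf.1, hd, hd'⟩
    rcases hT f hfi hfT hf.2 with h | h
    exacts [Or.inl ⟨f, h, rfl⟩, Or.inr ⟨f, ⟨hfi, h⟩, rfl⟩]
  have h4 : ((L ∩ T) \ smallGal).ncard ≤
      (classes A).ncard + (classes (irrSet s (lam ^ 4) ∩ sqTail Y)).ncard := by
    rw [← Set.ncard_image_of_injOn hinj]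
    exact (Set.ncard_le_ncard h3 ((hirr.1.subset (classes_mono hA)).union
      (hirr.1.subset (classes_mono Set.inter_subset_left)))).trans (Set.ncard_union_le _ _)
  have h5 := sqTail_classes_bound hs (X := lam ^ 4) (one_le_pow₀ hlam) hY
  have h6 : (lam ^ 4) ^ ((3 : ℝ) / 4) = lam ^ 3 := by
    rw [← Real.rpow_natCast, ← Real.rpow_mul hlam0.le, ← Real.rpow_natCast]; norm_num
  rw [h6] at h5
  have h7 : ((L ∩ T).ncard : ℝ) ≤ (L ∩ smallGal).ncard + ((classes A).ncard +
      (classes (irrSet s (lam ^ 4) ∩ sqTail Y)).ncard) := by exact_mod_cast h2.trans (by omega)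
  linarith

section Density

variable (j : ℕ → ℕ) (Sig : ∀ p : ℕ, Set (Fin 4 → ZMod (p ^ j p)))

/-- The `p`-adic density of `Sig p`. -/
noncomputable def density (p : ℕ) : ℝ := (Nat.card (Sig p) : ℝ) / (p : ℝ) ^ (4 * j p)

/-- The volume of the reduced region of bounded discriminant. -/
noncomputable def totalVolume (s : ℝ) : ℝ := (20 - 16 * s) / (56 - 52 * s) * (Real.pi ^ 2 / 24)

theorem totalVolume_pos {s : ℝ} (hs : s = 1 ∨ s = -1) : 0 < totalVolume s := by
  have := Real.pi_pos
  rw [totalVolume]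
  rcases hs with rfl | rfl <;> norm_num <;> positivity

theorem density_nonneg (p : ℕ) : 0 ≤ density j Sig p := by
  rw [density]; positivity

theorem density_le_one {p : ℕ} (hp : p.Prime) : density j Sig p ≤ 1 := by
  have h := card_forms_le (pow_pos hp.pos (j p)) (Sig p)
  have hp0 : (0 : ℝ) < p := by exact_mod_cast hp.pos
  rw [density, div_le_one (by positivity), mul_comm, pow_mul]
  exact_mod_cast h

theorem lat_openBody_tendsto {s r : ℝ} (hs : s = 1 ∨ s = -1) (hr0 : 0 < r)
    (hr : (56 - 52 * s) * r ^ 4 = 1) {k : ℕ} (hk : 1 ≤ k) {P : Finset ℕ} (hP : ∀ p ∈ P, p.Prime) :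
    Tendsto (fun lam : ℝ => ((lat lam (openBody s r (2 ^ k)) ∩ cong j Sig P).ncard : ℝ) / lam ^ 4)
      atTop (𝓝 (totalVolume s * (1 - (4 ^ k)⁻¹) * ∏ p ∈ P, density j Sig p)) := by
  have hh : (1 : ℝ) < 2 ^ k := one_lt_pow₀ one_lt_two (by omega)
  have h := lat_finset_tendsto ((closedBody_isCompact s r (zero_lt_one.trans hh)).isBounded.subset
    (openBody_subset s r _)) (openBody_isOpen hs r (zero_lt_one.trans hh)).measurableSet
    (frontier_openBody s r hs (zero_lt_one.trans hh)) j Sig P hP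
  rwa [volume_openBody hs hh hr0 hr, ← totalVolume, ← pow_mul, mul_comm k, pow_mul,
    show (2 : ℝ) ^ 2 = 4 by norm_num] at h

theorem lat_closedBody_tendsto {s r : ℝ} (hs : s = 1 ∨ s = -1) (hr0 : 0 < r)
    (hr : (56 - 52 * s) * r ^ 4 = 1) {k : ℕ} (hk : 1 ≤ k) {P : Finset ℕ} (hP : ∀ p ∈ P, p.Prime) :
    Tendsto (fun lam : ℝ => ((lat lam (closedBody s r (2 ^ k)) ∩ cong j Sig P).ncard : ℝ) / lam ^ 4)
      atTop (𝓝 (totalVolume s * (1 - (4 ^ k)⁻¹) * ∏ p ∈ P, density j Sig p)) := by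
  have hh : (1 : ℝ) < 2 ^ k := one_lt_pow₀ one_lt_two (by omega)
  have hc := closedBody_isCompact s r (zero_lt_one.trans hh)
  have h := lat_finset_tendsto hc.isBounded hc.measurableSet
    (frontier_closedBody s r hs (zero_lt_one.trans hh)) j Sig P hP
  rwa [volume_closedBody s r (zero_lt_one.trans hh), volume_openBody hs hh hr0 hr, ← totalVolume,
    ← pow_mul, mul_comm k, pow_mul, show (2 : ℝ) ^ 2 = 4 by norm_num] at h

theorem classes_eventually_le {s r : ℝ} (hs : s = 1 ∨ s = -1) (hr0 : 0 < r)
    (hr : (56 - 52 * s) * r ^ 4 = 1) {A : ℝ → Set (Fin 4 → ℤ)} (hA : ∀ X, A X ⊆ irrSet s X)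
    (hT : ∀ X, ∀ f ∈ A X, ∀ g, FormEquiv f g → ∀ p, p.Prime → red (p ^ j p) g ∈ Sig p)
    {ε : ℝ} (hε : 0 < ε) : ∀ᶠ lam : ℝ in atTop, ((classes (A (lam ^ 4))).ncard : ℝ) / lam ^ 4 <
      totalVolume s * (∏' q : Nat.Primes, density j Sig q) + ε := by
  have hc := totalVolume_pos hs
  have hprod := (tendsto_prod_primes (fun p _ => density_nonneg j Sig p)
    (fun p hp => density_le_one j Sig hp)).const_mul (totalVolume s)
  obtain ⟨Y, hY⟩ := (hprod.eventually_lt_const (lt_add_of_pos_right _ (div_pos hε three_pos))).exists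
  obtain ⟨k, hk, hk1⟩ := ((tendsto_pow_atTop_nhds_zero_of_lt_one (r := (4 : ℝ)⁻¹) (by norm_num)
    (by norm_num)).const_mul (162 * 54 ^ 4) |>.eventually_lt_const
      (show (162 * 54 ^ 4 * 0 : ℝ) < ε / 3 by linarith) |>.and (eventually_ge_atTop 1)).exists
  have hlat := lat_closedBody_tendsto j Sig hs hr0 hr hk1 (P := (range Y).filter Nat.Prime)
    fun p hp => (Finset.mem_filter.1 hp).2
  set M := ∏ p ∈ (range Y).filter Nat.Prime, density j Sig p with hM
  have hM0 : 0 ≤ M := Finset.prod_nonneg fun p _ => density_nonneg j Sig p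
  have hk0 : (0 : ℝ) < (4 ^ k)⁻¹ := by positivity
  filter_upwards [hlat.eventually_lt_const (lt_add_of_pos_right _ (div_pos hε three_pos)),
    eventually_gt_atTop 0] with lam h1 h0
  have h2 := classes_ncard_le_lat hs h0 hr0 hr k (hA (lam ^ 4))
    (T := cong j Sig ((range Y).filter Nat.Prime))
    fun f hf g hfg p hp => hT _ f hf g hfg p (Finset.mem_filter.1 hp).2
  have h3 := div_le_div_of_nonneg_right h2 (pow_nonneg h0.le 4)
  rw [add_div, show 162 * (54 * lam) ^ 4 / 4 ^ k / lam ^ 4 = 162 * 54 ^ 4 * (4 : ℝ)⁻¹ ^ k by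
    rw [inv_pow]; field_simp] at h3
  have h4 : totalVolume s * (1 - (4 ^ k)⁻¹) * M ≤ totalVolume s * M := by
    have := mul_nonneg (mul_nonneg hc.le hk0.le) hM0
    linarith
  linarith

theorem classes_eventually_ge {s r : ℝ} (hs : s = 1 ∨ s = -1) (hr0 : 0 < r)
    (hr : (56 - 52 * s) * r ^ 4 = 1) {A : ℝ → Set (Fin 4 → ℤ)} (hA : ∀ X, A X ⊆ irrSet s X)
    (hT : ∀ᶠ Y : ℕ in atTop, ∀ X, ∀ f ∈ irrSet s X, f ∈ cong j Sig ((range (Y + 1)).filter Nat.Prime) →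
      ¬ IsSquare (cdisc f) → f ∈ A X ∨ f ∈ sqTail Y)
    {ε : ℝ} (hε : 0 < ε) : ∀ᶠ lam : ℝ in atTop,
      totalVolume s * (∏' q : Nat.Primes, density j Sig q) - ε <
        ((classes (A (lam ^ 4))).ncard : ℝ) / lam ^ 4 := by
  have hc := totalVolume_pos hs
  have hε6 : 0 < ε / 6 := by positivity
  have hprod := ((tendsto_prod_primes (fun p _ => density_nonneg j Sig p)
    (fun p hp => density_le_one j Sig hp)).const_mul (totalVolume s)).comp (tendsto_add_atTop_nat 1)
  have hYlim := (tendsto_inv_atTop_nhds_zero_nat (𝕜 := ℝ)).const_mul (6 * (162 * 54 ^ 4))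
  obtain ⟨Y, hY, hYT, hY3, hYi⟩ := ((hprod.eventually_const_lt (sub_lt_self _ hε6)).and
    (hT.and ((eventually_ge_atTop 3).and (hYlim.eventually_lt_const
      (show (6 * (162 * 54 ^ 4) * 0 : ℝ) < ε / 6 by linarith))))).exists
  obtain ⟨k, hk, hk1⟩ := ((tendsto_pow_atTop_nhds_zero_of_lt_one (r := (4 : ℝ)⁻¹) (by norm_num)
    (by norm_num)).const_mul (totalVolume s) |>.eventually_lt_const
      (show totalVolume s * 0 < ε / 6 by linarith) |>.and (eventually_ge_atTop 1)).exists
  have hlat := lat_openBody_tendsto j Sig hs hr0 hr hk1 (P := (range (Y + 1)).filter Nat.Prime)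
    fun p hp => (Finset.mem_filter.1 hp).2
  simp only [Function.comp] at hY
  set M := ∏ p ∈ (range (Y + 1)).filter Nat.Prime, density j Sig p with hM
  have hM0 : 0 ≤ M := Finset.prod_nonneg fun p _ => density_nonneg j Sig p
  have hM1 : M ≤ 1 := Finset.prod_le_one (fun p _ => density_nonneg j Sig p)
    fun p hp => density_le_one j Sig (Finset.mem_filter.1 hp).2
  have hh : (0 : ℝ) < 2 ^ k := by positivity
  have hsmall := lat_smallGal ((closedBody_isCompact s r hh).isBounded.subset
    (openBody_subset s r _)) (openBody_isOpen hs r hh).measurableSet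
    (frontier_openBody s r hs hh) hε6
  have hlam := (tendsto_inv_atTop_zero (𝕜 := ℝ)).const_mul (432 * 54 ^ 3)
  filter_upwards [hlat.eventually_const_lt (sub_lt_self _ hε6), hsmall,
    hlam.eventually_lt_const (show (432 * 54 ^ 3 * 0 : ℝ) < ε / 6 by linarith),
    eventually_ge_atTop 1] with lam h1 h2 h3 h4
  have h0 : 0 < lam := by linarith
  have h5 := lat_ncard_le_classes hs h4 hh hr hY3 (hA (lam ^ 4)) (hYT (lam ^ 4))
  have h6 := div_le_div_of_nonneg_right h5 (pow_nonneg h0.le 4)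
  rw [add_div, add_div, show (6 * (162 * 54 ^ 4) * lam ^ 4 / Y + 432 * 54 ^ 3 * lam ^ 3) / lam ^ 4 =
    6 * (162 * 54 ^ 4) * (Y : ℝ)⁻¹ + 432 * 54 ^ 3 * lam⁻¹ by
      have hY0 : (Y : ℝ) ≠ 0 := by
        have : 0 < Y := by omega
        exact_mod_cast this.ne'
      field_simp] at h6
  have h7 : totalVolume s * M - totalVolume s * (4 : ℝ)⁻¹ ^ k ≤
      totalVolume s * (1 - (4 ^ k)⁻¹) * M := by
    rw [inv_pow]
    have h8 : (0 : ℝ) < (4 ^ k)⁻¹ := by positivity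
    have := mul_nonneg (mul_nonneg hc.le h8.le) (sub_nonneg.2 hM1)
    linarith
  linarith

end Density

theorem classes_tendsto {s : ℝ} (hs : s = 1 ∨ s = -1)
    (j : ℕ → ℕ) (Sig : ∀ p : ℕ, Set (Fin 4 → ZMod (p ^ j p)))
    {A : ℝ → Set (Fin 4 → ℤ)} (hA : ∀ X, A X ⊆ irrSet s X)
    (hT : ∀ X, ∀ f ∈ A X, ∀ g, FormEquiv f g → ∀ p, p.Prime → red (p ^ j p) g ∈ Sig p)
    (hT' : ∀ᶠ Y : ℕ in atTop, ∀ X, ∀ f ∈ irrSet s X, f ∈ cong j Sig ((range (Y + 1)).filter Nat.Prime) →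
      ¬ IsSquare (cdisc f) → f ∈ A X ∨ f ∈ sqTail Y) :
    Tendsto (fun X => ((classes (A X)).ncard : ℝ) / X) atTop
      (𝓝 (totalVolume s * ∏' q : Nat.Primes, density j Sig q)) := by
  have hD0 : 0 < 56 - 52 * s := by rcases hs with rfl | rfl <;> norm_num
  obtain ⟨r, hr0, hr⟩ : ∃ r : ℝ, 0 < r ∧ (56 - 52 * s) * r ^ 4 = 1 :=
    ⟨(56 - 52 * s)⁻¹ ^ ((4 : ℝ)⁻¹), by positivity, by
      rw [← Real.rpow_natCast, ← Real.rpow_mul (by positivity)]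
      norm_num
      exact mul_inv_cancel₀ hD0.ne'⟩
  have h1 : Tendsto (fun lam : ℝ => ((classes (A (lam ^ 4))).ncard : ℝ) / lam ^ 4) atTop
      (𝓝 (totalVolume s * ∏' q : Nat.Primes, density j Sig q)) := by
    rw [Metric.tendsto_nhds]
    intro ε hε
    filter_upwards [classes_eventually_le j Sig hs hr0 hr hA hT hε,
      classes_eventually_ge j Sig hs hr0 hr hA hT' hε] with lam h1 h2
    rw [Real.dist_eq, abs_lt]
    constructor <;> linarith
  refine (h1.comp (tendsto_rpow_atTop (y := (4 : ℝ)⁻¹) (by norm_num))).congr' ?_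
  filter_upwards [eventually_gt_atTop 0] with X hX
  have : (X ^ ((4 : ℝ)⁻¹)) ^ 4 = X := by
    rw [← Real.rpow_natCast, ← Real.rpow_mul hX.le]; norm_num
  simp only [Function.comp, this]

theorem card_classes_tendsto {s : ℝ} (hs : s = 1 ∨ s = -1)
    (j : ℕ → ℕ) (Sig : ∀ p : ℕ, Set (Fin 4 → ZMod (p ^ j p)))
    (hinv : ∀ p : ℕ, p.Prime → ∀ f ∈ Sig p, ∀ a b c d : ZMod (p ^ j p),
      IsUnit (a * d - b * c) →
      ∀ g : Fin 4 → ZMod (p ^ j p),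
        formPolyR (n := 3) g = MvPolynomial.bind₁
          ![MvPolynomial.C a * MvPolynomial.X 0 + MvPolynomial.C b * MvPolynomial.X 1,
            MvPolynomial.C c * MvPolynomial.X 0 + MvPolynomial.C d * MvPolynomial.X 1]
          (formPolyR (n := 3) f) → g ∈ Sig p)
    (hlarge : ∃ P : ℕ, ∀ p : ℕ, p.Prime → P < p →
      ∀ c : Fin 4 → ℤ, (fun i => ((c i : ZMod (p ^ j p)))) ∉ Sig p →
        ∀ D : ℤ, IsDisc (n := 3) c D → (p : ℤ) ^ 2 ∣ D) :
    Tendsto (fun X : ℝ =>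
      (Nat.card (Quot.mk (@FormEquiv 3) ''
        {c : Fin 4 → ℤ |
          (∀ p : ℕ, p.Prime → (fun i => ((c i : ZMod (p ^ j p)))) ∈ Sig p) ∧
          Irreducible (formPoly (n := 3) ℚ c) ∧
          Nonempty ((formPolyX (n := 3) ℚ c).Gal ≃* Equiv.Perm (Fin 3)) ∧
          s * ((cdisc c : ℤ) : ℝ) < 0 ∧ -s * ((cdisc c : ℤ) : ℝ) < X}) : ℝ) / X)
      atTop (𝓝 (totalVolume s * ∏' q : Nat.Primes, density j Sig q)) := by
  refine classes_tendsto hs j Sig (A := fun X => {c : Fin 4 → ℤ |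
    (∀ p : ℕ, p.Prime → (fun i => ((c i : ZMod (p ^ j p)))) ∈ Sig p) ∧
    Irreducible (formPoly (n := 3) ℚ c) ∧
    Nonempty ((formPolyX (n := 3) ℚ c).Gal ≃* Equiv.Perm (Fin 3)) ∧
    s * ((cdisc c : ℤ) : ℝ) < 0 ∧ -s * ((cdisc c : ℤ) : ℝ) < X}) ?_ ?_ ?_
  · exact fun X f hf => ⟨irr_of_irreducible hf.2.1, hf.2.2.2⟩
  · exact fun X f hf g hfg p hp => mem_of_formEquiv (hinv p hp) hfg (hf.1 p hp)
  · obtain ⟨P, hP⟩ := hlarge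
    filter_upwards [eventually_ge_atTop P] with Y hY X f hf hfc hsq
    by_cases h : ∀ p : ℕ, p.Prime → red (p ^ j p) f ∈ Sig p
    · exact Or.inl ⟨h, hf.1.irreducible, hf.1.gal_of_not_isSquare hsq, hf.2⟩
    · push Not at h
      obtain ⟨p, hp, hpf⟩ := h
      have hYp : Y < p := by
        by_contra! hle
        exact hpf (hfc p (by simp [hp]; omega))
      exact Or.inr ⟨p, hp, hYp, hP p hp (by omega) f hpf _ (isDisc_iff.2 rfl)⟩

end BinaryCubic

/-- the Davenport–Heilbronn theorem, refined by congruence conditions modulo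
bounded prime powers whose excluded sets at large primes `p` consist only of forms with
`p² ∣ disc`: the number of `GL₂(ℤ)`-classes of irreducible `S₃` binary cubic forms in `S`
with `-X < disc < 0` (resp. `0 < disc < X`) is `∼ (π²/24) X ∏ₚ μₚ(S)`
(resp. `∼ (π²/72) X ∏ₚ μₚ(S)`). -/
theorem davenport_heilbronn_congruence
    (J : ℕ) (j : ℕ → ℕ) (hJ : ∀ p, j p ≤ J)
    (Sig : ∀ p : ℕ, Set (Fin 4 → ZMod (p ^ j p)))
    (hinv : ∀ p : ℕ, p.Prime → ∀ f ∈ Sig p, ∀ a b c d : ZMod (p ^ j p),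
      IsUnit (a * d - b * c) →
      ∀ g : Fin 4 → ZMod (p ^ j p),
        formPolyR g = MvPolynomial.bind₁
          ![MvPolynomial.C a * MvPolynomial.X 0 + MvPolynomial.C b * MvPolynomial.X 1,
            MvPolynomial.C c * MvPolynomial.X 0 + MvPolynomial.C d * MvPolynomial.X 1]
          (formPolyR f) → g ∈ Sig p)
    (hlarge : ∃ P : ℕ, ∀ p : ℕ, p.Prime → P < p →
      ∀ c : Fin 4 → ℤ, (fun i => ((c i : ZMod (p ^ j p)))) ∉ Sig p →
        ∀ D : ℤ, IsDisc c D → (p : ℤ) ^ 2 ∣ D) :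
    Filter.Tendsto (fun X : ℝ =>
      (Nat.card (Quot.mk (@FormEquiv 3) ''
        {c : Fin 4 → ℤ |
          (∀ p : ℕ, p.Prime → (fun i => ((c i : ZMod (p ^ j p)))) ∈ Sig p) ∧
          Irreducible (formPoly ℚ c) ∧
          Nonempty ((formPolyX ℚ c).Gal ≃* Equiv.Perm (Fin 3)) ∧
          ∃ D : ℤ, IsDisc c D ∧ -X < (D : ℝ) ∧ D < 0}) : ℝ) / X)
      Filter.atTop
      (nhds (Real.pi ^ 2 / 24 * ∏' q : Nat.Primes,
        (Nat.card (Sig (q : ℕ)) : ℝ) / ((q : ℕ) : ℝ) ^ (4 * j (q : ℕ)))) ∧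
    Filter.Tendsto (fun X : ℝ =>
      (Nat.card (Quot.mk (@FormEquiv 3) ''
        {c : Fin 4 → ℤ |
          (∀ p : ℕ, p.Prime → (fun i => ((c i : ZMod (p ^ j p)))) ∈ Sig p) ∧
          Irreducible (formPoly ℚ c) ∧
          Nonempty ((formPolyX ℚ c).Gal ≃* Equiv.Perm (Fin 3)) ∧
          ∃ D : ℤ, IsDisc c D ∧ 0 < D ∧ (D : ℝ) < X}) : ℝ) / X)
      Filter.atTop
      (nhds (Real.pi ^ 2 / 72 * ∏' q : Nat.Primes,
        (Nat.card (Sig (q : ℕ)) : ℝ) / ((q : ℕ) : ℝ) ^ (4 * j (q : ℕ)))) := by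
  have h1 := BinaryCubic.card_classes_tendsto (Or.inl rfl) j Sig hinv hlarge
  have h2 := BinaryCubic.card_classes_tendsto (Or.inr rfl) j Sig hinv hlarge
  rw [show BinaryCubic.totalVolume 1 = Real.pi ^ 2 / 24 by
    rw [BinaryCubic.totalVolume]; norm_num] at h1
  rw [show BinaryCubic.totalVolume (-1) = Real.pi ^ 2 / 72 by
    rw [BinaryCubic.totalVolume]; ring] at h2
  constructor
  · refine h1.congr fun X => ?_
    congr 5
    ext c
    refine and_congr_right fun _ => and_congr_right fun _ => and_congr_right fun _ => ?_
    simp only [BinaryCubic.isDisc_iff, exists_eq_left, one_mul, Int.cast_lt_zero, neg_one_mul]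
    rw [neg_lt, and_comm]
  · refine h2.congr fun X => ?_
    congr 5
    ext c
    refine and_congr_right fun _ => and_congr_right fun _ => and_congr_right fun _ => ?_
    simp only [BinaryCubic.isDisc_iff, exists_eq_left, neg_neg, one_mul, neg_one_mul, neg_lt_zero,
      Int.cast_pos]
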